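/- Let n ≥ 1, let ν > −1/2 and μ > −1/2 be real, and let ã ∈ (0,∞)ⁿ have pairwise distinct entries. Set Z := ∫_{{g ∈ M_{2n}(ℝ) : I − g gᵀ is positive definite}} (det g gᵀ)^ν · det(I − g gᵀ)^μ dg (a finite positive number). Then, for every invariant test function φ, (1/Z) · ∫_{{g : I − g gᵀ > 0}} φ(g · D(ã) · gᵀ) · (det g gᵀ)^ν · det(I − g gᵀ)^μ dg = ∫_{(0,∞)ⁿ} φ(D(a)) · p(a) da, where p(a) = (1/n!) · (∏_{j=1}^n Γ(2ν+2μ+2n+2j)/(Γ(2ν+2j−1)·Γ(2μ+2n+1))) · (Δ_n(a²)/Δ_n(ã²)) · (∏_j a_j^{2ν} / ∏_j ã_j^{2ν+1}) · det[(1 − a_j/ã_k)^{2(μ+n)} · 1{a_j ≤ ã_k}]_{j,k=1,…,n}. -/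

import Mathlib

open MeasureTheory Matrix
open scoped BigOperators

noncomputable section

instance matrixMeasurableSpace {l : Type*} [Fintype l] : MeasurableSpace (Matrix l l ℝ) :=
  inferInstanceAs (MeasurableSpace (l → l → ℝ))

/-- The `2n × 2n` real antisymmetric matrix `D(a) = diag(a₁ J, …, aₙ J)`,
`J = [[0,1],[-1,0]]`. -/
def Dmat {n : ℕ} (a : Fin n → ℝ) : Matrix (Fin (2 * n)) (Fin (2 * n)) ℝ :=
  Matrix.of fun i j =>
    if i.val / 2 = j.val / 2 then
      a ⟨i.val / 2, by have := i.isLt; omega⟩ *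
        (if i.val % 2 = 0 ∧ j.val % 2 = 1 then 1
          else if i.val % 2 = 1 ∧ j.val % 2 = 0 then -1 else 0)
    else 0

/-- Vandermonde product `Δ_m(x) = ∏_{j<k} (x_k - x_j)`. -/
def vdm {m : ℕ} {R : Type*} [CommRing R] (x : Fin m → R) : R :=
  ∏ p ∈ Finset.univ.filter (fun p : Fin m × Fin m => p.1 < p.2), (x p.2 - x p.1)

/-- A bounded measurable `O(m)`-invariant test function on antisymmetric matrices. -/
def IsInvTest (m : ℕ) (φ : Matrix (Fin m) (Fin m) ℝ → ℝ) : Prop :=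
  Measurable φ ∧ (∃ C, ∀ X, |φ X| ≤ C) ∧
    ∀ X : Matrix (Fin m) (Fin m) ℝ, Xᵀ = -X →
      ∀ k ∈ Matrix.orthogonalGroup (Fin m) ℝ, φ (k * X * kᵀ) = φ X

/-- The (unnormalized) induced real Jacobi density `(det ggᵀ)^ν det(1-ggᵀ)^μ` in
coordinates. -/
def jacDens (n : ℕ) (ν μ : ℝ) (u : Fin (2 * n) → Fin (2 * n) → ℝ) : ℝ :=
  ((Matrix.of u * (Matrix.of u)ᵀ).det) ^ ν * ((1 - Matrix.of u * (Matrix.of u)ᵀ).det) ^ μ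

/-- The Jacobi domain `{g : 1 - ggᵀ positive definite}` in coordinates. -/
def jacDom (n : ℕ) : Set (Fin (2 * n) → Fin (2 * n) → ℝ) :=
  {u | (1 - Matrix.of u * (Matrix.of u)ᵀ).PosDef}

section
instance matBorel {N : ℕ} : BorelSpace (Matrix (Fin N) (Fin N) ℝ) :=
  inferInstanceAs (BorelSpace (Fin N → Fin N → ℝ))

abbrev OG (N : ℕ) := ↥(Matrix.orthogonalGroup (Fin N) ℝ)

instance ogTopGroup (N : ℕ) : IsTopologicalGroup (OG N) :=
  inferInstanceAs (IsTopologicalGroup (unitary (Matrix (Fin N) (Fin N) ℝ)))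

instance matSecond (N : ℕ) : SecondCountableTopology (Matrix (Fin N) (Fin N) ℝ) :=
  inferInstanceAs (SecondCountableTopology (Fin N → Fin N → ℝ))

instance matLC (N : ℕ) : LocallyCompactSpace (Matrix (Fin N) (Fin N) ℝ) :=
  inferInstanceAs (LocallyCompactSpace (Fin N → Fin N → ℝ))

instance ogSecond (N : ℕ) : SecondCountableTopology (OG N) :=
  TopologicalSpace.Subtype.secondCountableTopology _

lemma og_mul_tr {N : ℕ} (k : OG N) : (k : Matrix (Fin N) (Fin N) ℝ) * (k : Matrix _ _ ℝ)ᵀ = 1 := by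
  have := (Matrix.mem_orthogonalGroup_iff (Fin N) ℝ).1 k.2
  simpa [star_eq_conjTranspose] using this

lemma og_tr_mul {N : ℕ} (k : OG N) : (k : Matrix (Fin N) (Fin N) ℝ)ᵀ * (k : Matrix _ _ ℝ) = 1 := by
  have := (Matrix.mem_orthogonalGroup_iff' (Fin N) ℝ).1 k.2
  simpa [star_eq_conjTranspose] using this

def mkOG {N : ℕ} (k : Matrix (Fin N) (Fin N) ℝ) (h : k * kᵀ = 1) : OG N :=
  ⟨k, (Matrix.mem_orthogonalGroup_iff (Fin N) ℝ).2 (by simpa [star_eq_conjTranspose] using h)⟩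

@[simp] lemma mkOG_coe {N : ℕ} (k : Matrix (Fin N) (Fin N) ℝ) (h : k * kᵀ = 1) :
    ((mkOG k h : OG N) : Matrix (Fin N) (Fin N) ℝ) = k := rfl

lemma og_inv_coe {N : ℕ} (k : OG N) : ((k⁻¹ : OG N) : Matrix (Fin N) (Fin N) ℝ) = (k : Matrix _ _ ℝ)ᵀ := by
  rw [Matrix.UnitaryGroup.inv_val]; simp [star_eq_conjTranspose]

instance ogCompact (N : ℕ) : CompactSpace (OG N) := by
  have hc : IsCompact {u : Fin N → Fin N → ℝ | Matrix.of u * (Matrix.of u)ᵀ = 1} := by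
    apply IsCompact.of_isClosed_subset (s := Set.pi Set.univ (fun _ : Fin N => Set.pi Set.univ (fun _ : Fin N => Set.Icc (-1:ℝ) 1)))
    · exact isCompact_univ_pi fun _ => isCompact_univ_pi fun _ => isCompact_Icc
    · have : Continuous fun u : Fin N → Fin N → ℝ => (Matrix.of u * (Matrix.of u)ᵀ : Matrix (Fin N) (Fin N) ℝ) :=
        (Continuous.matrix_mul (A := fun u : Fin N → Fin N → ℝ => Matrix.of u) continuous_id (Continuous.matrix_transpose (A := fun u : Fin N → Fin N → ℝ => Matrix.of u) continuous_id))
      exact isClosed_eq this continuous_const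
    · intro u hu i _ j _
      have h := congrFun (congrFun hu i) i
      simp only [Matrix.mul_apply, Matrix.transpose_apply, Matrix.of_apply, Matrix.one_apply_eq] at h
      have h2 : u i j * u i j ≤ ∑ j, u i j * u i j :=
        Finset.single_le_sum (f := fun j => u i j * u i j) (fun j _ => mul_self_nonneg _) (Finset.mem_univ j)
      rw [h] at h2
      exact abs_le.1 (abs_le_one_iff_mul_self_le_one.2 h2)
  have : IsCompact ((Matrix.orthogonalGroup (Fin N) ℝ : Set (Matrix (Fin N) (Fin N) ℝ))) := by
    have he : (Matrix.orthogonalGroup (Fin N) ℝ : Set (Matrix (Fin N) (Fin N) ℝ)) =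
        {u : Fin N → Fin N → ℝ | Matrix.of u * (Matrix.of u)ᵀ = 1} := by
      refine Set.ext fun k => ?_
      change k ∈ Matrix.orthogonalGroup (Fin N) ℝ ↔ _
      rw [Matrix.mem_orthogonalGroup_iff]
      rfl
    rw [he]; exact hc
  exact isCompact_iff_compactSpace.1 this

def hm (N : ℕ) : Measure (OG N) := Measure.haarMeasure ⊤

instance hmHaar (N : ℕ) : (hm N).IsHaarMeasure := by unfold hm; infer_instance
instance hmProb (N : ℕ) : IsProbabilityMeasure (hm N) :=
  ⟨by have := Measure.haarMeasure_self (K₀ := (⊤ : TopologicalSpace.PositiveCompacts (OG N))); simpa [hm] using this⟩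

instance hmRight (N : ℕ) : (hm N).IsMulRightInvariant := by
  constructor
  intro g
  have : IsProbabilityMeasure (Measure.map (· * g) (hm N)) :=
    Measure.isProbabilityMeasure_map (by fun_prop)
  exact Measure.isHaarMeasure_eq_of_isProbabilityMeasure _ _

lemma hm_left {N : ℕ} (f : OG N → ℝ) (q : OG N) : ∫ k, f (q * k) ∂hm N = ∫ k, f k ∂hm N :=
  integral_mul_left_eq_self f q
lemma hm_right {N : ℕ} (f : OG N → ℝ) (q : OG N) : ∫ k, f (k * q) ∂hm N = ∫ k, f k ∂hm N :=
  integral_mul_right_eq_self f q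

lemma hm_integrable {N : ℕ} {f : OG N → ℝ} (hf : Continuous f) : Integrable f (hm N) :=
  hf.integrable_of_hasCompactSupport (HasCompactSupport.of_compactSpace f)

/-! leading minors -/

def lm {N : ℕ} (X : Matrix (Fin N) (Fin N) ℝ) (j : Fin N) : ℝ :=
  (X.submatrix (Fin.castLE j.isLt) (Fin.castLE j.isLt)).det

def pw {N : ℕ} (e : ℕ → ℕ) (X : Matrix (Fin N) (Fin N) ℝ) : ℝ := ∏ j : Fin N, lm X j ^ e j

lemma corner_tri {N m : ℕ} (h : m ≤ N) (M Z : Matrix (Fin N) (Fin N) ℝ)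
    (hM : ∀ i j, i < j → M i j = 0) :
    (M * Z * Mᵀ).submatrix (Fin.castLE h) (Fin.castLE h) =
      M.submatrix (Fin.castLE h) (Fin.castLE h) * Z.submatrix (Fin.castLE h) (Fin.castLE h) *
        (M.submatrix (Fin.castLE h) (Fin.castLE h))ᵀ := by
  have key : ∀ (a : Fin m) (f : Fin N → ℝ), ∑ c, M (Fin.castLE h a) c * f c =
      ∑ c : Fin m, M (Fin.castLE h a) (Fin.castLE h c) * f (Fin.castLE h c) := by
    intro a f
    have : ∑ c : Fin m, M (Fin.castLE h a) (Fin.castLE h c) * f (Fin.castLE h c) =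
        ∑ c ∈ Finset.univ.map (Fin.castLEEmb h), M (Fin.castLE h a) c * f c := by
      rw [Finset.sum_map]; rfl
    rw [this]
    symm
    apply Finset.sum_subset (Finset.subset_univ _)
    intro c _ hc
    rw [hM _ _ _, zero_mul]
    by_contra hcon
    apply hc
    rw [Finset.mem_map]
    have : (c : ℕ) ≤ a := by
      rw [not_lt] at hcon; exact hcon
    exact ⟨⟨c, by omega⟩, Finset.mem_univ _, by ext; simp⟩
  ext a b
  rw [Matrix.mul_assoc, Matrix.mul_assoc]
  simp only [Matrix.submatrix_apply, Matrix.mul_apply, Matrix.transpose_apply]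
  rw [key a (fun c => ∑ d, Z c d * M (Fin.castLE h b) d)]
  refine Finset.sum_congr rfl fun c _ => ?_
  congr 1
  have := key b (fun d => Z (Fin.castLE h c) d)
  simpa [mul_comm] using this

lemma lm_tri {N : ℕ} (j : Fin N) (M Z : Matrix (Fin N) (Fin N) ℝ)
    (hM : ∀ i j, i < j → M i j = 0) :
    lm (M * Z * Mᵀ) j = (M.submatrix (Fin.castLE j.isLt) (Fin.castLE j.isLt)).det ^ 2 * lm Z j := by
  unfold lm
  rw [corner_tri _ _ _ hM, Matrix.det_mul, Matrix.det_mul, Matrix.det_transpose]; ring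

lemma lm_one {N : ℕ} (j : Fin N) : lm (1 : Matrix (Fin N) (Fin N) ℝ) j = 1 := by
  unfold lm
  rw [Matrix.submatrix_one _ (Fin.castLE_injective _), Matrix.det_one]

/-- Any invertible `g` can be made orthogonal by a lower triangular matrix. -/
lemma exists_tri {N : ℕ} (g : Matrix (Fin N) (Fin N) ℝ) (hg : g.det ≠ 0) :
    ∃ M : Matrix (Fin N) (Fin N) ℝ, (∀ i j, i < j → M i j = 0) ∧ (M * g) * (M * g)ᵀ = 1 := by
  have hS : (g * gᵀ).PosDef := by
    have := Matrix.PosDef.mul_conjTranspose_self g ?_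
    · simpa using this
    · have := (Matrix.isUnit_iff_isUnit_det g).2 (isUnit_iff_ne_zero.2 hg)
      exact Matrix.vecMul_injective_of_isUnit this
  have hd := LDL.diag_eq_lowerInv_conj hS
  set U := LDL.lowerInv hS with hU
  have hUi : Invertible U := LDL.invertibleLowerInv hS
  have hD : (U * (g * gᵀ) * Uᴴ).PosDef := by
    apply Matrix.PosDef.mul_mul_conjTranspose_same hS
    exact Matrix.vecMul_injective_of_isUnit (isUnit_of_invertible U)
  rw [← hd, LDL.diag] at hD
  rw [Matrix.posDef_diagonal_iff] at hD
  refine ⟨Matrix.diagonal (fun i => 1 / Real.sqrt (LDL.diagEntries hS i)) * U, ?_, ?_⟩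
  · intro i j hij
    rw [Matrix.diagonal_mul, hU, LDL.lowerInv_triangular hS hij, mul_zero]
  · have h1 : U * g * gᵀ * Uᵀ = Matrix.diagonal (LDL.diagEntries hS) := by
      rw [← LDL.diag, hd]; simp [Matrix.mul_assoc]
    calc _ = Matrix.diagonal (fun i => 1 / Real.sqrt (LDL.diagEntries hS i)) * (U * g * gᵀ * Uᵀ) *
          Matrix.diagonal (fun i => 1 / Real.sqrt (LDL.diagEntries hS i)) := by
          simp [Matrix.mul_assoc, Matrix.transpose_mul]
      _ = 1 := by
        rw [h1, Matrix.diagonal_mul_diagonal, Matrix.diagonal_mul_diagonal, ← Matrix.diagonal_one]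
        congr 1; ext i
        have := hD i
        have h2 := Real.mul_self_sqrt this.le
        have h3 := Real.sqrt_pos.2 this
        rw [← h2]
        rw [Real.sqrt_mul_self h3.le]
        field_simp

lemma pw_LQ {N : ℕ} (e : ℕ → ℕ) (g : Matrix (Fin N) (Fin N) ℝ) (hg : g.det ≠ 0) :
    ∃ Q : OG N, ∀ Y, pw e (g * Y * gᵀ) = pw e (g * gᵀ) * pw e (Q.1 * Y * Q.1ᵀ) := by
  obtain ⟨M, hM, hQ⟩ := exists_tri g hg
  refine ⟨mkOG (M * g) hQ, fun Y => ?_⟩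
  unfold pw
  rw [← Finset.prod_mul_distrib]
  refine Finset.prod_congr rfl fun j _ => ?_
  rw [← mul_pow]
  congr 1
  have h1 := lm_tri j M (g * gᵀ) hM
  have h2 := lm_tri j M (g * Y * gᵀ) hM
  have e1 : M * (g * gᵀ) * Mᵀ = 1 := by rw [← hQ]; simp [Matrix.mul_assoc, Matrix.transpose_mul]
  have e2 : M * (g * Y * gᵀ) * Mᵀ = (M * g) * Y * (M * g)ᵀ := by
    simp [Matrix.mul_assoc, Matrix.transpose_mul]
  rw [e1, lm_one] at h1
  rw [e2] at h2
  rw [mkOG_coe, h2]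
  linear_combination (lm (g * Y * gᵀ) j) * h1

def sph {N : ℕ} (e : ℕ → ℕ) (X : Matrix (Fin N) (Fin N) ℝ) : ℝ :=
  ∫ k : OG N, pw e (k.1 * X * k.1ᵀ) ∂hm N

lemma continuous_lm {N : ℕ} (j : Fin N) : Continuous fun X : Matrix (Fin N) (Fin N) ℝ => lm X j := by
  unfold lm
  exact Continuous.matrix_det (Continuous.matrix_submatrix continuous_id _ _)

lemma continuous_pw {N : ℕ} (e : ℕ → ℕ) : Continuous (pw e : Matrix (Fin N) (Fin N) ℝ → ℝ) := by
  unfold pw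
  exact continuous_finsetProd _ fun j _ => (continuous_lm j).pow _

lemma continuous_conj {N : ℕ} :
    Continuous fun p : Matrix (Fin N) (Fin N) ℝ × OG N => p.2.1 * p.1 * p.2.1ᵀ := by
  have h : Continuous fun p : Matrix (Fin N) (Fin N) ℝ × OG N => (p.2 : Matrix (Fin N) (Fin N) ℝ) :=
    continuous_subtype_val.comp continuous_snd
  exact (h.matrix_mul continuous_fst).matrix_mul h.matrix_transpose

lemma continuous_sph {N : ℕ} (e : ℕ → ℕ) : Continuous (sph e : Matrix (Fin N) (Fin N) ℝ → ℝ) := by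
  have hc := (continuous_pw (N := N) e).comp continuous_conj
  have := continuous_parametric_integral_of_continuous (μ := hm N)
    (f := fun (X : Matrix (Fin N) (Fin N) ℝ) (k : OG N) => pw e (k.1 * X * k.1ᵀ))
    hc (s := Set.univ) isCompact_univ
  simp only [Measure.restrict_univ] at this
  exact this

lemma sph_conj {N : ℕ} (e : ℕ → ℕ) (X : Matrix (Fin N) (Fin N) ℝ) (q : OG N) :
    sph e (q.1 * X * q.1ᵀ) = sph e X := by
  unfold sph
  rw [← hm_right (fun k : OG N => pw e (k.1 * X * k.1ᵀ)) q]
  refine integral_congr_ae (Filter.Eventually.of_forall fun k => ?_)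
  simp [Matrix.mul_assoc, Matrix.transpose_mul]

lemma sph_LQ {N : ℕ} (e : ℕ → ℕ) (g X : Matrix (Fin N) (Fin N) ℝ) (hg : g.det ≠ 0) :
    ∫ k : OG N, pw e ((g * k.1) * X * (g * k.1)ᵀ) ∂hm N
      = pw e (g * gᵀ) * sph e X := by
  obtain ⟨Q, hQ⟩ := pw_LQ e g hg
  unfold sph
  rw [← hm_left (fun k : OG N => pw e (k.1 * X * k.1ᵀ)) Q,
    ← integral_const_mul]
  refine integral_congr_ae (Filter.Eventually.of_forall fun k => ?_)
  simp only
  rw [show (g * k.1) * X * (g * k.1)ᵀ =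
    g * (k.1 * X * k.1ᵀ) * gᵀ by
      simp [Matrix.mul_assoc, Matrix.transpose_mul], hQ]
  simp [Matrix.mul_assoc, Matrix.transpose_mul]
end

section
/-! block matrices -/
def blk {p q : ℕ} (A : Matrix (Fin p) (Fin p) ℝ) (B : Matrix (Fin p) (Fin q) ℝ)
    (C : Matrix (Fin q) (Fin p) ℝ) (D : Matrix (Fin q) (Fin q) ℝ) :
    Matrix (Fin (p + q)) (Fin (p + q)) ℝ :=
  (Matrix.fromBlocks A B C D).submatrix finSumFinEquiv.symm finSumFinEquiv.symm

lemma blk_mul {p q : ℕ} (A : Matrix (Fin p) (Fin p) ℝ) (B C D A' B' C' D') :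
    blk A B C D * blk (q := q) A' B' C' D' =
      blk (A * A' + B * C') (A * B' + B * D') (C * A' + D * C') (C * B' + D * D') := by
  unfold blk
  rw [Matrix.submatrix_mul_equiv, Matrix.fromBlocks_multiply]

lemma blk_tr {p q : ℕ} (A : Matrix (Fin p) (Fin p) ℝ) (B C) (D : Matrix (Fin q) (Fin q) ℝ) :
    (blk A B C D)ᵀ = blk Aᵀ Cᵀ Bᵀ Dᵀ := by
  unfold blk
  rw [Matrix.transpose_submatrix, Matrix.fromBlocks_transpose]

lemma blk_one {p q : ℕ} : blk (1 : Matrix (Fin p) (Fin p) ℝ) 0 0 (1 : Matrix (Fin q) (Fin q) ℝ) = 1 := by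
  unfold blk
  rw [Matrix.fromBlocks_one, Matrix.submatrix_one_equiv]

lemma blk_det_zero {p q : ℕ} (A : Matrix (Fin p) (Fin p) ℝ) (D : Matrix (Fin q) (Fin q) ℝ) :
    (blk A 0 0 D).det = A.det * D.det := by
  unfold blk
  rw [Matrix.det_submatrix_equiv_self, Matrix.det_fromBlocks_zero₂₁]

lemma blk_split {p q : ℕ} (X : Matrix (Fin (p + q)) (Fin (p + q)) ℝ) :
    X = blk (X.submatrix (Fin.castAdd q) (Fin.castAdd q)) (X.submatrix (Fin.castAdd q) (Fin.natAdd p))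
      (X.submatrix (Fin.natAdd p) (Fin.castAdd q)) (X.submatrix (Fin.natAdd p) (Fin.natAdd p)) := by
  ext i j
  unfold blk
  induction i using Fin.addCases <;> induction j using Fin.addCases <;> simp

def blkOG {p q : ℕ} (k : OG p) (k' : OG q) : OG (p + q) :=
  mkOG (blk k.1 0 0 k'.1) (by
    rw [blk_tr, blk_mul]; simp [og_mul_tr, blk_one])

/-! canonical form -/
def Dn (N : ℕ) (a : ℕ → ℝ) : Matrix (Fin N) (Fin N) ℝ :=
  Matrix.of fun i j =>
    if i.val / 2 = j.val / 2 then
      a (i.val / 2) *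
        (if i.val % 2 = 0 ∧ j.val % 2 = 1 then 1
          else if i.val % 2 = 1 ∧ j.val % 2 = 0 then -1 else 0)
    else 0

lemma Dn_congr {N : ℕ} {a b : ℕ → ℝ} (h : ∀ j < N / 2, a j = b j) : Dn N a = Dn N b := by
  ext i j
  simp only [Dn, Matrix.of_apply]
  split_ifs with h1 h2 h3
  · rw [h]; have := i.isLt; have := j.isLt; omega
  · rw [h]; have := i.isLt; have := j.isLt; omega
  · simp
  · rfl

lemma Dn_tr (N : ℕ) (a : ℕ → ℝ) : (Dn N a)ᵀ = - Dn N a := by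
  ext i j
  simp only [Dn, Matrix.of_apply, Matrix.transpose_apply, Matrix.neg_apply]
  by_cases h : i.val / 2 = j.val / 2
  · rw [if_pos h.symm, if_pos h, h]
    rcases Nat.mod_two_eq_zero_or_one i.val with hi | hi <;>
    rcases Nat.mod_two_eq_zero_or_one j.val with hj | hj <;> simp [hi, hj]
  · rw [if_neg (fun h' => h h'.symm), if_neg h]; simp

lemma Dn_blk (N : ℕ) (a : ℕ → ℝ) :
    Dn (2 + N) a = blk (!![0, a 0; -a 0, 0]) 0 0 (Dn N (fun j => a (j + 1))) := by
  rw [blk_split (p := 2) (q := N) (Dn (2 + N) a)]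
  congr 1
  · ext i j; fin_cases i <;> fin_cases j <;> simp [Dn]
  · ext i j
    simp only [Dn, Matrix.submatrix_apply, Matrix.of_apply, Fin.val_castAdd, Fin.val_natAdd]
    rw [if_neg]; · rfl
    have := i.isLt; omega
  · ext i j
    simp only [Dn, Matrix.submatrix_apply, Matrix.of_apply, Fin.val_castAdd, Fin.val_natAdd]
    rw [if_neg]; · rfl
    have := j.isLt; omega
  · ext i j
    simp only [Dn, Matrix.submatrix_apply, Matrix.of_apply, Fin.val_natAdd]
    have h1 : (2 + i.val) / 2 = i.val / 2 + 1 := by omega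
    have h2 : (2 + j.val) / 2 = j.val / 2 + 1 := by omega
    rw [h1, h2]
    simp

lemma det_Dn (t : ℝ) (N : ℕ) : ∀ (a : ℕ → ℝ), (t • (1 : Matrix (Fin N) (Fin N) ℝ) + Dn N a).det =
    t ^ (N % 2) * ∏ j ∈ Finset.range (N / 2), (t ^ 2 + a j ^ 2) := by
  induction N using Nat.twoStepInduction with
  | zero => intro a; simp
  | one => intro a; simp [Matrix.det_unique, Dn]
  | more N ih _ =>
    intro a
    rw [show N + 2 = 2 + N by ring]
    have : t • (1 : Matrix (Fin (2 + N)) (Fin (2 + N)) ℝ) + Dn (2 + N) a =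
        blk (!![t, a 0; -a 0, t]) 0 0 (t • (1 : Matrix (Fin N) (Fin N) ℝ) + Dn N (fun j => a (j + 1))) := by
      rw [Dn_blk, ← blk_one]
      unfold blk
      ext i j
      induction i using Fin.addCases <;> induction j using Fin.addCases <;> simp [-Matrix.fromBlocks_one]
      rename_i i j
      fin_cases i <;> fin_cases j <;> simp
    rw [this, blk_det_zero, ih, Matrix.det_fin_two_of]
    rw [show (2 + N) % 2 = N % 2 by omega, show (2 + N) / 2 = N / 2 + 1 by omega,
      Finset.prod_range_succ']
    ring

lemma exists_basis2 {N : ℕ} (X : Matrix (Fin (2 + N)) (Fin (2 + N)) ℝ) (hX : Xᵀ = -X) :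
    ∃ (k : OG (2 + N)) (s : ℝ) (Y : Matrix (Fin N) (Fin N) ℝ), 0 ≤ s ∧ Yᵀ = -Y ∧
      k.1 * X * k.1ᵀ = blk (!![0, s; -s, 0]) 0 0 Y := by
  by_cases h0 : X = 0
  · refine ⟨1, 0, 0, le_rfl, by simp, ?_⟩
    subst h0
    have : !![(0:ℝ), 0; -0, 0] = 0 := by ext i j; fin_cases i <;> fin_cases j <;> simp
    rw [this]
    simp [blk]
  have hH : (X * X).IsHermitian := by
    unfold Matrix.IsHermitian
    rw [Matrix.conjTranspose_mul]; simp [hX]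
  have hex : ∃ i, hH.eigenvalues i ≠ 0 := by
    by_contra hcon
    push Not at hcon
    have h1 : X * X = 0 := by
      rw [← hH.eigenvalues_eq_zero_iff]; ext i; exact hcon i
    apply h0
    have : Xᴴ * X = 0 := by
      simp [hX, h1]
    exact Matrix.conjTranspose_mul_self_eq_zero.1 this
  obtain ⟨i, hi⟩ := hex
  set u : Fin (2 + N) → ℝ := (hH.eigenvectorBasis i).ofLp with hu
  have hun : u ⬝ᵥ u = 1 := by
    have := hH.eigenvectorBasis.orthonormal.1 i
    rw [EuclideanSpace.norm_eq, Real.sqrt_eq_one] at this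
    simpa [dotProduct, sq] using this
  have hev : X *ᵥ (X *ᵥ u) = hH.eigenvalues i • u := by
    rw [Matrix.mulVec_mulVec]; exact hH.mulVec_eigenvectorBasis i
  have hanti : ∀ v w : Fin (2 + N) → ℝ, v ⬝ᵥ (X *ᵥ w) = - (w ⬝ᵥ (X *ᵥ v)) := by
    intro v w
    rw [Matrix.dotProduct_mulVec, ← Matrix.mulVec_transpose, hX, Matrix.neg_mulVec, neg_dotProduct,
      dotProduct_comm]
  have hneg : hH.eigenvalues i = - ((X *ᵥ u) ⬝ᵥ (X *ᵥ u)) := by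
    have h := hanti (X *ᵥ u) u
    rw [hev, dotProduct_smul, hun] at h
    rw [h]; simp
  set s := Real.sqrt ((X *ᵥ u) ⬝ᵥ (X *ᵥ u)) with hs
  have hnn : 0 ≤ (X *ᵥ u) ⬝ᵥ (X *ᵥ u) := Finset.sum_nonneg fun i _ => mul_self_nonneg _
  have hss : s * s = (X *ᵥ u) ⬝ᵥ (X *ᵥ u) := Real.mul_self_sqrt hnn
  have hs0 : s ≠ 0 := by
    intro h; rw [h] at hss; apply hi; rw [hneg, ← hss]; simp
  set v : Fin (2 + N) → ℝ := (-s⁻¹) • (X *ᵥ u) with hv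
  have hXu : X *ᵥ u = (-s) • v := by
    rw [hv, smul_smul]; field_simp; simp
  have hXv : X *ᵥ v = s • u := by
    rw [hv, Matrix.mulVec_smul, hev, smul_smul, hneg, ← hss]; congr 1; field_simp
  have huu : u ⬝ᵥ (X *ᵥ u) = 0 := by have := hanti u u; linarith
  have huv : u ⬝ᵥ v = 0 := by rw [hv, dotProduct_smul, huu]; simp
  have hvv : v ⬝ᵥ v = 1 := by
    rw [hv, dotProduct_smul, smul_dotProduct, ← hss]; simp; field_simp
  let f : Fin (2 + N) → EuclideanSpace ℝ (Fin (2 + N)) :=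
    fun i => if i = Fin.castAdd N 0 then WithLp.toLp 2 u else WithLp.toLp 2 v
  have h01 : (Fin.castAdd N (1 : Fin 2)) ≠ Fin.castAdd N 0 := by
    intro h; have := congrArg Fin.val h; simp at this
  have f0 : f (Fin.castAdd N 0) = WithLp.toLp 2 u := by simp [f]
  have f1 : f (Fin.castAdd N 1) = WithLp.toLp 2 v := by simp only [f]; rw [if_neg h01]
  have hon : Orthonormal ℝ (Set.domRestrict {Fin.castAdd N (0 : Fin 2), Fin.castAdd N 1} f) := by
    rw [orthonormal_iff_ite]
    rintro ⟨a, ha⟩ ⟨b, hb⟩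
    simp only [Set.mem_insert_iff, Set.mem_singleton_iff] at ha hb
    simp only [Subtype.mk.injEq]
    change inner ℝ (f a) (f b) = _
    rcases ha with rfl | rfl <;> rcases hb with rfl | rfl
    · rw [f0, EuclideanSpace.inner_toLp_toLp]; simpa using hun
    · rw [f0, f1, EuclideanSpace.inner_toLp_toLp, if_neg h01.symm]
      simpa [dotProduct_comm] using huv
    · rw [f0, f1, EuclideanSpace.inner_toLp_toLp, if_neg h01]
      simpa [dotProduct_comm] using huv
    · rw [f1, EuclideanSpace.inner_toLp_toLp]; simpa using hvv
  obtain ⟨b, hb⟩ := hon.exists_orthonormalBasis_extension_of_card_eq (by simp)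
  have hb0 := hb (Fin.castAdd N 0) (by simp)
  have hb1 := hb (Fin.castAdd N 1) (by simp)
  rw [f0] at hb0
  rw [f1] at hb1
  let K : Matrix (Fin (2 + N)) (Fin (2 + N)) ℝ := Matrix.of fun i j => b i j
  have hbb : ∀ i j, (b i).ofLp ⬝ᵥ (b j).ofLp = if i = j then 1 else 0 := by
    intro i j
    have := orthonormal_iff_ite.1 b.orthonormal j i
    rw [EuclideanSpace.inner_eq_star_dotProduct] at this
    simpa [eq_comm] using this
  have hK : K * Kᵀ = 1 := by
    ext i j
    have := hbb i j
    simpa [K, Matrix.mul_apply, Matrix.one_apply, dotProduct] using this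
  have hent : ∀ i j, (K * X * Kᵀ) i j = (b i).ofLp ⬝ᵥ (X *ᵥ (b j).ofLp) := by
    intro i j
    rw [Matrix.mul_assoc, Matrix.mul_apply]
    simp only [K, dotProduct, Matrix.mulVec, Matrix.mul_apply, Matrix.transpose_apply, Matrix.of_apply]
  have hc0 : ∀ i, (K * X * Kᵀ) i (Fin.castAdd N 0) = if i = Fin.castAdd N 1 then -s else 0 := by
    intro i
    rw [hent, hb0]
    change _ ⬝ᵥ (X *ᵥ u) = _
    rw [hXu, dotProduct_smul]
    have := hbb i (Fin.castAdd N 1)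
    rw [hb1] at this
    change _ ⬝ᵥ v = _ at this
    rw [this]; split_ifs <;> simp
  have hc1 : ∀ i, (K * X * Kᵀ) i (Fin.castAdd N 1) = if i = Fin.castAdd N 0 then s else 0 := by
    intro i
    rw [hent, hb1]
    change _ ⬝ᵥ (X *ᵥ v) = _
    rw [hXv, dotProduct_smul]
    have := hbb i (Fin.castAdd N 0)
    rw [hb0] at this
    change _ ⬝ᵥ u = _ at this
    rw [this]; split_ifs <;> simp
  have hA : (K * X * Kᵀ)ᵀ = - (K * X * Kᵀ) := by
    simp [Matrix.transpose_mul, hX, Matrix.mul_assoc]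
  have hA' : ∀ i j, (K * X * Kᵀ) i j = - (K * X * Kᵀ) j i := by
    intro i j; have := congrFun (congrFun hA j) i; simpa using this
  have hne : ∀ (i : Fin N) (j : Fin 2), Fin.natAdd 2 i ≠ Fin.castAdd N j := by
    intro i j h; have := congrArg Fin.val h; simp at this; omega
  refine ⟨mkOG K hK, s, (K * X * Kᵀ).submatrix (Fin.natAdd 2) (Fin.natAdd 2), Real.sqrt_nonneg _, ?_, ?_⟩
  · rw [Matrix.transpose_submatrix, hA]; rfl
  · rw [mkOG_coe]
    conv_lhs => rw [blk_split (p := 2) (q := N) (K * X * Kᵀ)]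
    congr 1
    · ext i j
      fin_cases i <;> fin_cases j
      · simp [hc0, h01.symm]
      · simp [hc1]
      · simp [hc0]
      · simp [hc1, h01]
    · ext i j
      rw [Matrix.submatrix_apply, hA']
      fin_cases i
      · simp [hc0, hne]
      · simp [hc1, hne]
    · ext i j
      rw [Matrix.submatrix_apply]
      fin_cases j
      · simp [hc0, hne]
      · simp [hc1, hne]
end

section
lemma canon0 (N : ℕ) : ∀ X : Matrix (Fin N) (Fin N) ℝ, Xᵀ = -X →
    ∃ (k : OG N) (a : ℕ → ℝ), (∀ j, 0 ≤ a j) ∧ X = k.1 * Dn N a * k.1ᵀ := by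
  induction N using Nat.twoStepInduction with
  | zero => intro X _; exact ⟨1, 0, fun _ => le_rfl, by ext i; exact i.elim0⟩
  | one =>
    intro X hX
    refine ⟨1, 0, fun _ => le_rfl, ?_⟩
    ext i j
    have hi : i = 0 := Subsingleton.elim _ _
    have hj : j = 0 := Subsingleton.elim _ _
    subst hi hj
    have := congrFun (congrFun hX 0) 0
    simp at this
    have h2 : X 0 0 = 0 := by linarith
    simp [h2, Dn]
  | more N ih _ =>
    rw [show N + 2 = 2 + N by ring]
    intro X hX
    obtain ⟨k, s, Y, hs, hY, hk⟩ := exists_basis2 X hX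
    obtain ⟨k', a, ha, hk'⟩ := ih Y hY
    refine ⟨k⁻¹ * blkOG 1 k', fun j => Nat.casesOn j s a, ?_, ?_⟩
    · intro j; cases j; exacts [hs, ha _]
    · have h1 : (blkOG (1 : OG 2) k').1 * Dn (2 + N) (fun j => Nat.casesOn j s a) * (blkOG (1 : OG 2) k').1ᵀ
          = blk (!![0, s; -s, 0]) 0 0 Y := by
        rw [Dn_blk]
        simp only [blkOG, mkOG_coe]
        rw [blk_tr, blk_mul, blk_mul]
        simp [hk']
      have h2 : ((k⁻¹ * blkOG 1 k' : OG (2 + N))).1 = k.1ᵀ * (blkOG (1 : OG 2) k').1 := by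
        rw [← og_inv_coe]; rfl
      rw [h2, Matrix.transpose_mul, Matrix.transpose_transpose]
      calc X = (k.1ᵀ * k.1) * X * (k.1ᵀ * k.1) := by rw [og_tr_mul]; simp
        _ = k.1ᵀ * (k.1 * X * k.1ᵀ) * k.1 := by simp only [Matrix.mul_assoc]
        _ = _ := by rw [hk, ← h1]; simp only [Matrix.mul_assoc]

lemma permOG_aux {N : ℕ} (π : Equiv.Perm (Fin N)) (X : Matrix (Fin N) (Fin N) ℝ) :
    ((1 : Matrix (Fin N) (Fin N) ℝ).submatrix π id) * X * ((1 : Matrix (Fin N) (Fin N) ℝ).submatrix π id)ᵀ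
      = X.submatrix π π := by
  ext i j
  simp [Matrix.mul_apply, Matrix.one_apply]

def permOG {N : ℕ} (π : Equiv.Perm (Fin N)) : OG N :=
  mkOG ((1 : Matrix (Fin N) (Fin N) ℝ).submatrix π id) (by
    have := permOG_aux π 1
    rw [Matrix.mul_one] at this
    rw [this, Matrix.submatrix_one_equiv])

/-- block permutation -/
def blkPerm (N : ℕ) (σ : Equiv.Perm (Fin (N / 2))) : Equiv.Perm (Fin N) :=
  Equiv.ofBijective (fun i => if h : i.val / 2 < N / 2 then
      ⟨2 * (σ ⟨i.val / 2, h⟩).val + i.val % 2, by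
        have := (σ ⟨i.val / 2, h⟩).isLt; omega⟩ else i) (by
    apply Finite.injective_iff_bijective.1
    intro i j hij
    dsimp only at hij
    have hi := i.isLt
    have hj := j.isLt
    split_ifs at hij with h1 h2 h2
    · have h3 := congrArg Fin.val hij
      simp only at h3
      have h4 : (σ ⟨i.val / 2, h1⟩) = (σ ⟨j.val / 2, h2⟩) := by ext; omega
      have h5 := congrArg Fin.val (σ.injective h4)
      simp only at h5
      ext; omega
    · have h3 := congrArg Fin.val hij
      have := (σ ⟨i.val / 2, h1⟩).isLt
      simp only at h3; omega
    · have h3 := congrArg Fin.val hij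
      have := (σ ⟨j.val / 2, h2⟩).isLt
      simp only at h3; omega
    · exact hij)

lemma blkPerm_val {N : ℕ} (σ : Equiv.Perm (Fin (N / 2))) (i : Fin N) (h : i.val / 2 < N / 2) :
    (blkPerm N σ i).val = 2 * (σ ⟨i.val / 2, h⟩).val + i.val % 2 := by
  simp [blkPerm, h]

lemma blkPerm_val' {N : ℕ} (σ : Equiv.Perm (Fin (N / 2))) (i : Fin N) (h : ¬ i.val / 2 < N / 2) :
    (blkPerm N σ i).val = i := by
  simp [blkPerm, h]

lemma Dn_perm {N : ℕ} (a : ℕ → ℝ) (σ : Equiv.Perm (Fin (N / 2))) :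
    (Dn N a).submatrix (blkPerm N σ) (blkPerm N σ) =
      Dn N (fun j => if h : j < N / 2 then a (σ ⟨j, h⟩) else 0) := by
  ext i j
  have hi := i.isLt
  have hj := j.isLt
  by_cases h1 : i.val / 2 < N / 2 <;> by_cases h2 : j.val / 2 < N / 2
  · simp only [Matrix.submatrix_apply, Dn, Matrix.of_apply, blkPerm_val σ i h1, blkPerm_val σ j h2]
    have e1 : (2 * (σ ⟨i.val / 2, h1⟩).val + i.val % 2) / 2 = (σ ⟨i.val / 2, h1⟩).val := by omega
    have e2 : (2 * (σ ⟨j.val / 2, h2⟩).val + j.val % 2) / 2 = (σ ⟨j.val / 2, h2⟩).val := by omega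
    have e3 : (2 * (σ ⟨i.val / 2, h1⟩).val + i.val % 2) % 2 = i.val % 2 := by omega
    have e4 : (2 * (σ ⟨j.val / 2, h2⟩).val + j.val % 2) % 2 = j.val % 2 := by omega
    rw [e1, e2, e3, e4, dif_pos h1]
    have : ((σ ⟨i.val / 2, h1⟩).val = (σ ⟨j.val / 2, h2⟩).val) ↔ i.val / 2 = j.val / 2 := by
      rw [← Fin.ext_iff, σ.injective.eq_iff, Fin.mk.injEq]
    simp only [this]
  · have := (σ ⟨i.val / 2, h1⟩).isLt
    simp only [Matrix.submatrix_apply, Dn, Matrix.of_apply, blkPerm_val σ i h1, blkPerm_val' σ j h2]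
    rw [if_neg (by omega), if_neg (by omega)]
  · have := (σ ⟨j.val / 2, h2⟩).isLt
    simp only [Matrix.submatrix_apply, Dn, Matrix.of_apply, blkPerm_val' σ i h1, blkPerm_val σ j h2]
    rw [if_neg (by omega), if_neg (by omega)]
  · simp only [Matrix.submatrix_apply, Dn, Matrix.of_apply, blkPerm_val' σ i h1, blkPerm_val' σ j h2]
    have : i.val % 2 = 0 := by omega
    have : j.val % 2 = 0 := by omega
    simp [*]

/-- sorted canonical form -/
lemma canon (N : ℕ) (X : Matrix (Fin N) (Fin N) ℝ) (hX : Xᵀ = -X) :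
    ∃ (k : OG N) (a : ℕ → ℝ), (∀ j, 0 ≤ a j) ∧ (∀ i j, i ≤ j → j < N / 2 → a i ≤ a j) ∧
      X = k.1 * Dn N a * k.1ᵀ := by
  obtain ⟨k, a, ha, hk⟩ := canon0 N X hX
  set σ := Tuple.sort (fun j : Fin (N / 2) => a j) with hσ
  refine ⟨k * (permOG (blkPerm N σ))⁻¹, fun j => if h : j < N / 2 then a (σ ⟨j, h⟩) else 0, ?_, ?_, ?_⟩
  · intro j; dsimp only; split_ifs; exacts [ha _, le_rfl]
  · intro i j hij hj
    dsimp only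
    rw [dif_pos hj, dif_pos (lt_of_le_of_lt hij hj)]
    exact Tuple.monotone_sort (fun j : Fin (N / 2) => a j) (show (⟨i, lt_of_le_of_lt hij hj⟩ : Fin (N / 2)) ≤ ⟨j, hj⟩ from hij)
  · rw [← Dn_perm]
    have h1 := permOG_aux (blkPerm N σ) (Dn N a)
    rw [← h1]
    have h2 : (k * (permOG (blkPerm N σ))⁻¹ : OG N).1 = k.1 * (permOG (blkPerm N σ)).1ᵀ := by
      rw [← og_inv_coe]; rfl
    have h3 := og_tr_mul (permOG (blkPerm N σ))
    rw [h2, Matrix.transpose_mul, Matrix.transpose_transpose]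
    change X = k.1 * (permOG (blkPerm N σ)).1ᵀ * ((permOG (blkPerm N σ)).1 * Dn N a * (permOG (blkPerm N σ)).1ᵀ) * ((permOG (blkPerm N σ)).1 * k.1ᵀ)
    calc X = k.1 * Dn N a * k.1ᵀ := hk
      _ = k.1 * ((permOG (blkPerm N σ)).1ᵀ * (permOG (blkPerm N σ)).1) * Dn N a * ((permOG (blkPerm N σ)).1ᵀ * (permOG (blkPerm N σ)).1) * k.1ᵀ := by
          rw [h3]; simp
      _ = _ := by simp only [Matrix.mul_assoc]

lemma og_det_conj {N : ℕ} (k : OG N) (t : ℝ) (X : Matrix (Fin N) (Fin N) ℝ) :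
    (t • (1 : Matrix (Fin N) (Fin N) ℝ) + k.1 * X * k.1ᵀ).det = (t • (1 : Matrix (Fin N) (Fin N) ℝ) + X).det := by
  have h : t • (1 : Matrix (Fin N) (Fin N) ℝ) + k.1 * X * k.1ᵀ = k.1 * (t • (1 : Matrix (Fin N) (Fin N) ℝ) + X) * k.1ᵀ := by
    rw [Matrix.mul_add, Matrix.add_mul]; simp [og_mul_tr]
  have h2 : k.1.det * k.1.det = 1 := by
    have := congrArg Matrix.det (og_mul_tr k)
    rwa [Matrix.det_mul, Matrix.det_transpose, Matrix.det_one] at this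
  rw [h, Matrix.det_mul, Matrix.det_mul, Matrix.det_transpose]
  linear_combination ((t • (1 : Matrix (Fin N) (Fin N) ℝ) + X).det) * h2

open Polynomial in
/-- sorted roots are unique -/
lemma sorted_unique {n : ℕ} (x y : Fin n → ℝ) (hx : Monotone x) (hy : Monotone y)
    (T : Set ℝ) (hT : T.Infinite) (h : ∀ t ∈ T, ∏ j, (t - x j) = ∏ j, (t - y j)) : x = y := by
  have hp : (∏ j, (X - C (x j)) : ℝ[X]) = ∏ j, (X - C (y j)) := by
    apply Polynomial.eq_of_infinite_eval_eq
    refine hT.mono fun t ht => ?_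
    simp only [Set.mem_ofPred_eq, Polynomial.eval_prod, eval_sub, eval_X, eval_C]
    exact h t ht
  have hm : ∀ z : Fin n → ℝ, (∏ j, (X - C (z j)) : ℝ[X]).roots = Finset.univ.val.map z := by
    intro z
    have := Polynomial.roots_multiset_prod_X_sub_C (Finset.univ.val.map z)
    rw [Multiset.map_map] at this
    exact this
  have hr := congrArg Polynomial.roots hp
  rw [hm, hm] at hr
  have h1 : (List.ofFn x).Perm (List.ofFn y) := by
    rw [← Multiset.coe_eq_coe]
    simpa [List.ofFn_eq_map, Fin.univ_val_map] using hr
  have h2 := List.Perm.eq_of_pairwise' (r := (· ≤ ·)) (List.pairwise_ofFn.2 fun i j hij => hx hij.le)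
    (List.pairwise_ofFn.2 fun i j hij => hy hij.le) h1
  exact List.ofFn_injective h2
end

section
def dd (N : ℕ) (a : ℕ → ℝ) (i : ℕ) : ℝ := if i / 2 < N / 2 then a (i / 2) ^ 2 else 0

lemma blk_diag {p q : ℕ} (f : Fin (p + q) → ℝ) :
    Matrix.diagonal f = blk (Matrix.diagonal fun i => f (Fin.castAdd q i)) 0 0
      (Matrix.diagonal fun i => f (Fin.natAdd p i)) := by
  rw [blk_split (Matrix.diagonal f)]
  congr 1
  · exact Matrix.submatrix_diagonal _ _ (Fin.castAdd_injective _ _)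
  · ext i j
    simp only [Matrix.submatrix_apply]
    rw [Matrix.diagonal_apply_ne]; · rfl
    intro h; have := congrArg Fin.val h; simp at this; omega
  · ext i j
    simp only [Matrix.submatrix_apply]
    rw [Matrix.diagonal_apply_ne]; · rfl
    intro h; have := congrArg Fin.val h; simp at this; omega
  · exact Matrix.submatrix_diagonal _ _ (Fin.natAdd_injective _ _)

lemma Dn_sq (N : ℕ) : ∀ a : ℕ → ℝ, Dn N a * Dn N a = Matrix.diagonal (fun i : Fin N => - dd N a i) := by
  induction N using Nat.twoStepInduction with
  | zero => intro a; ext i; exact i.elim0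
  | one =>
    intro a; ext i j
    have hi : i = 0 := Subsingleton.elim _ _
    have hj : j = 0 := Subsingleton.elim _ _
    subst hi hj
    simp [Dn, dd, Matrix.mul_apply]
  | more N ih _ =>
    intro a
    rw [show N + 2 = 2 + N by ring, Dn_blk, blk_mul, blk_diag]
    congr 1
    · ext i j
      fin_cases i <;> fin_cases j <;> simp [dd, sq]
    · simp
    · simp
    · simp only [Matrix.zero_mul, zero_add, ih]
      congr 1
      ext i
      simp only [dd, Fin.val_natAdd]
      have h1 : (2 + i.val) / 2 = i.val / 2 + 1 := by omega
      have h2 : (2 + N) / 2 = N / 2 + 1 := by omega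
      rw [h1, h2]; simp

lemma dd_nonneg (N : ℕ) (a : ℕ → ℝ) (i : ℕ) : 0 ≤ dd N a i := by
  unfold dd; split_ifs; exacts [sq_nonneg _, le_rfl]

lemma quad_anti {N : ℕ} (B : Matrix (Fin N) (Fin N) ℝ) (hB : Bᵀ = -B) (v : Fin N → ℝ) :
    v ⬝ᵥ (B *ᵥ v) = 0 := by
  have : v ⬝ᵥ (B *ᵥ v) = - (v ⬝ᵥ (B *ᵥ v)) := by
    conv_lhs => rw [Matrix.dotProduct_mulVec, ← Matrix.mulVec_transpose, hB, Matrix.neg_mulVec, neg_dotProduct,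
      dotProduct_comm]
  linarith

lemma corner_det {N : ℕ} (k : OG (N + 1)) (a : ℕ → ℝ) (t : ℝ) (ht : 0 < t) :
    (t • (1 : Matrix (Fin N) (Fin N) ℝ) +
      (k.1 * Dn (N + 1) a * k.1ᵀ).submatrix Fin.castSucc Fin.castSucc).det =
    (t • (1 : Matrix (Fin (N + 1)) (Fin (N + 1)) ℝ) + Dn (N + 1) a).det *
      (t * ∑ i : Fin (N + 1), (k.1 (Fin.last N) i) ^ 2 / (t ^ 2 + dd (N + 1) a i)) := by
  set D := Dn (N + 1) a with hD
  set E := Matrix.diagonal (fun i : Fin (N + 1) => (t ^ 2 + dd (N + 1) a i)⁻¹) with hE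
  have hpos : ∀ i : Fin (N + 1), t ^ 2 + dd (N + 1) a i ≠ 0 := fun i => by
    have := dd_nonneg (N + 1) a i; positivity
  have h1 : (t • (1 : Matrix (Fin (N + 1)) (Fin (N + 1)) ℝ) + D) * (t • (1 : Matrix (Fin (N + 1)) (Fin (N + 1)) ℝ) - D)
      = Matrix.diagonal (fun i : Fin (N + 1) => (t ^ 2 + dd (N + 1) a i)) := by
    have : (t • (1 : Matrix (Fin (N + 1)) (Fin (N + 1)) ℝ) + D) * (t • (1 : Matrix (Fin (N + 1)) (Fin (N + 1)) ℝ) - D)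
        = (t ^ 2) • (1 : Matrix (Fin (N + 1)) (Fin (N + 1)) ℝ) - D * D := by
      simp only [Matrix.add_mul, Matrix.mul_sub, Matrix.smul_mul, Matrix.mul_smul, Matrix.one_mul, Matrix.mul_one, smul_add, smul_smul, sq]
      abel
    rw [this, hD, Dn_sq]
    ext i j
    by_cases hij : i = j
    · subst hij; simp
    · simp [hij]
  have hDE : D * E = E * D := by
    have hc : D * (Matrix.diagonal (fun i : Fin (N + 1) => (t ^ 2 + dd (N + 1) a i))) =
        (Matrix.diagonal (fun i : Fin (N + 1) => (t ^ 2 + dd (N + 1) a i))) * D := by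
      rw [← h1]
      simp only [Matrix.add_mul, Matrix.mul_add, Matrix.mul_sub, Matrix.sub_mul, Matrix.smul_mul, Matrix.mul_smul, Matrix.one_mul, Matrix.mul_one, Matrix.mul_assoc]
    have hFE : (Matrix.diagonal (fun i : Fin (N + 1) => (t ^ 2 + dd (N + 1) a i))) * E = 1 := by
      rw [hE, Matrix.diagonal_mul_diagonal, ← Matrix.diagonal_one]
      congr 1; ext i; exact mul_inv_cancel₀ (hpos i)
    have hEF : E * (Matrix.diagonal (fun i : Fin (N + 1) => (t ^ 2 + dd (N + 1) a i))) = 1 := by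
      rw [hE, Matrix.diagonal_mul_diagonal, ← Matrix.diagonal_one]
      congr 1; ext i; exact inv_mul_cancel₀ (hpos i)
    calc D * E = (E * (Matrix.diagonal (fun i : Fin (N + 1) => (t ^ 2 + dd (N + 1) a i)))) * D * E := by
          rw [hEF, Matrix.one_mul]
      _ = E * (D * (Matrix.diagonal (fun i : Fin (N + 1) => (t ^ 2 + dd (N + 1) a i)))) * E := by
          rw [hc]; simp only [Matrix.mul_assoc]
      _ = E * D * ((Matrix.diagonal (fun i : Fin (N + 1) => (t ^ 2 + dd (N + 1) a i))) * E) := by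
          simp only [Matrix.mul_assoc]
      _ = _ := by rw [hFE, Matrix.mul_one]
  set R := (t • (1 : Matrix (Fin (N + 1)) (Fin (N + 1)) ℝ) - D) * E with hR
  have hTR : (t • (1 : Matrix (Fin (N + 1)) (Fin (N + 1)) ℝ) + D) * R = 1 := by
    rw [hR, ← Matrix.mul_assoc, h1, hE, Matrix.diagonal_mul_diagonal, ← Matrix.diagonal_one]
    congr 1; ext i; exact mul_inv_cancel₀ (hpos i)
  set Z := t • (1 : Matrix (Fin (N + 1)) (Fin (N + 1)) ℝ) + k.1 * D * k.1ᵀ with hZ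
  have hZ' : Z = k.1 * (t • (1 : Matrix (Fin (N + 1)) (Fin (N + 1)) ℝ) + D) * k.1ᵀ := by
    rw [hZ, Matrix.mul_add, Matrix.add_mul]; simp [og_mul_tr]
  have hZR : Z * (k.1 * R * k.1ᵀ) = 1 := by
    rw [hZ']
    calc _ = k.1 * (t • (1 : Matrix (Fin (N + 1)) (Fin (N + 1)) ℝ) + D) * (k.1ᵀ * k.1) * R * k.1ᵀ := by
          simp only [Matrix.mul_assoc]
      _ = k.1 * ((t • (1 : Matrix (Fin (N + 1)) (Fin (N + 1)) ℝ) + D) * R) * k.1ᵀ := by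
          rw [og_tr_mul]; simp only [Matrix.mul_assoc, Matrix.one_mul]
      _ = 1 := by rw [hTR, Matrix.mul_one, og_mul_tr]
  have hadj : Z.adjugate = Z.det • (k.1 * R * k.1ᵀ) := by
    calc Z.adjugate = Z.adjugate * (Z * (k.1 * R * k.1ᵀ)) := by rw [hZR, Matrix.mul_one]
      _ = _ := by rw [← Matrix.mul_assoc, Matrix.adjugate_mul, Matrix.smul_mul, Matrix.one_mul]
  have hent := congrFun (congrFun hadj (Fin.last N)) (Fin.last N)
  rw [Matrix.adjugate_fin_succ_eq_det_submatrix] at hent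
  have hsgn : (-1 : ℝ) ^ ((Fin.last N : ℕ) + (Fin.last N : ℕ)) = 1 := Even.neg_one_pow ⟨_, rfl⟩
  rw [hsgn, one_mul, Matrix.smul_apply, smul_eq_mul, hZ, og_det_conj] at hent
  have hs : (t • (1 : Matrix (Fin (N + 1)) (Fin (N + 1)) ℝ) + k.1 * D * k.1ᵀ).submatrix (Fin.last N).succAbove (Fin.last N).succAbove
      = t • (1 : Matrix (Fin N) (Fin N) ℝ) + (k.1 * D * k.1ᵀ).submatrix Fin.castSucc Fin.castSucc := by
    ext i j
    simp [Matrix.one_apply]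
  rw [hs] at hent
  rw [hent]
  congr 1
  set v := k.1 (Fin.last N) with hv
  have hq : (k.1 * R * k.1ᵀ) (Fin.last N) (Fin.last N) = v ⬝ᵥ (R *ᵥ v) := by
    rw [Matrix.mul_assoc, Matrix.mul_apply]
    simp only [dotProduct, Matrix.mulVec, Matrix.mul_apply, Matrix.transpose_apply, hv]
  have hR2 : R = t • E - D * E := by rw [hR, Matrix.sub_mul]; simp
  have hanti : (D * E)ᵀ = - (D * E) := by
    rw [Matrix.transpose_mul, hE, Matrix.diagonal_transpose, ← hE, hD, Dn_tr, ← hD, Matrix.mul_neg, hDE]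
  rw [hq, hR2, Matrix.sub_mulVec, dotProduct_sub, quad_anti _ hanti, sub_zero, Matrix.smul_mulVec,
    dotProduct_smul, smul_eq_mul]
  congr 1
  rw [dotProduct]
  refine Finset.sum_congr rfl fun i _ => ?_
  rw [hE, Matrix.mulVec_diagonal]
  field_simp
end

section
lemma vdm_eq_det {n : ℕ} (x : Fin n → ℝ) : vdm x = (Matrix.vandermonde x).det := by
  rw [Matrix.det_vandermonde, vdm, Finset.prod_filter, Finset.univ_product_univ.symm, Finset.prod_product]
  refine Finset.prod_congr rfl fun i _ => ?_
  rw [← Finset.prod_filter]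
  refine Finset.prod_congr ?_ fun j _ => rfl
  ext j; simp

lemma prod_ne_eq {n : ℕ} (z : Fin n → ℝ) :
    |∏ i, ∏ j ∈ Finset.univ.erase i, (z i - z j)| = |vdm z| ^ 2 := by
  have h1 : ∏ i, ∏ j ∈ Finset.univ.erase i, (z i - z j) =
      ∏ p ∈ Finset.univ.filter (fun p : Fin n × Fin n => p.1 ≠ p.2), (z p.1 - z p.2) := by
    rw [Finset.prod_filter, Finset.univ_product_univ.symm, Finset.prod_product]
    refine Finset.prod_congr rfl fun i _ => ?_
    rw [← Finset.prod_filter]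
    refine Finset.prod_congr ?_ fun j _ => rfl
    ext j; simp [eq_comm]
  have h2 : (Finset.univ.filter (fun p : Fin n × Fin n => p.1 ≠ p.2)) =
      (Finset.univ.filter (fun p : Fin n × Fin n => p.1 < p.2)) ∪
      (Finset.univ.filter (fun p : Fin n × Fin n => p.2 < p.1)) := by
    ext p; simp only [Finset.mem_filter, Finset.mem_union, Finset.mem_univ, true_and]; exact ne_iff_lt_or_gt
  have h3 : ∏ p ∈ Finset.univ.filter (fun p : Fin n × Fin n => p.2 < p.1), (z p.1 - z p.2) = vdm z := by
    rw [vdm]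
    refine Finset.prod_nbij' Prod.swap Prod.swap ?_ ?_ ?_ ?_ ?_ <;> simp
  have h4 : |∏ p ∈ Finset.univ.filter (fun p : Fin n × Fin n => p.1 < p.2), (z p.1 - z p.2)| = |vdm z| := by
    rw [vdm, Finset.abs_prod, Finset.abs_prod]
    exact Finset.prod_congr rfl fun p _ => abs_sub_comm _ _
  rw [h1, h2, Finset.prod_union, abs_mul, h3, h4, sq]
  rw [Finset.disjoint_filter]
  intro p _ h; exact not_lt.2 h.le

lemma vdm_pos {n : ℕ} {x : Fin n → ℝ} (hx : StrictMono x) : 0 < vdm x := by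
  unfold vdm
  refine Finset.prod_pos fun p hp => ?_
  simp at hp
  exact sub_pos.2 (hx hp)

lemma vdm_cons {n : ℕ} (y : Fin (n + 1) → ℝ) :
    vdm y = (∏ k : Fin n, (y k.succ - y 0)) * vdm (fun k : Fin n => y k.succ) := by
  rw [vdm_eq_det, vdm_eq_det, Matrix.det_vandermonde, Matrix.det_vandermonde, Fin.prod_univ_succ]
  congr 1
  · rw [Fin.Ioi_zero_eq_map, Finset.prod_map]; rfl
  · refine Finset.prod_congr rfl fun i _ => ?_
    rw [← Fin.map_succEmb_Ioi, Finset.prod_map]; rfl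

open Polynomial in
lemma det_eval_two {m : ℕ} (q : Fin m → ℝ[X]) (hq : ∀ k, (q k).natDegree < m) (x y : Fin m → ℝ) :
    (Matrix.of fun j k => (q k).eval (x j)).det * vdm y = vdm x * (Matrix.of fun j k => (q k).eval (y j)).det := by
  have h : ∀ z : Fin m → ℝ, (Matrix.of fun j k => (q k).eval (z j)) =
      Matrix.vandermonde z * Matrix.of fun (i : Fin m) k => (q k).coeff i := by
    intro z
    ext j k
    rw [Matrix.mul_apply, Matrix.of_apply, Polynomial.eval_eq_sum_range' (hq k), ← Fin.sum_univ_eq_sum_range (fun i => (q k).coeff i * z j ^ i)]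
    refine Finset.sum_congr rfl fun i _ => ?_
    simp [Matrix.vandermonde, mul_comm]
  rw [h, h, Matrix.det_mul, Matrix.det_mul, vdm_eq_det, vdm_eq_det]; ring

/-! the interlacing map -/
def Phi {n : ℕ} (x : Fin (n + 1) → ℝ) (v : Fin (n + 1) → ℝ) : Fin (n + 1) → ℝ := fun j =>
  v 0 * ∏ k : Fin n, ((x j - v k.succ) / (x j - x (j.succAbove k)))

def PhiDom {n : ℕ} (x : Fin (n + 1) → ℝ) : Set (Fin (n + 1) → ℝ) :=
  {v | 0 < v 0 ∧ ∀ k : Fin n, x k.castSucc < v k.succ ∧ v k.succ < x k.succ}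

lemma lt_of_dom {n : ℕ} {x v : Fin (n + 1) → ℝ} (hx : StrictMono x) (hv : v ∈ PhiDom x) (j : Fin (n + 1)) (k : Fin n) :
    0 < (x j - v k.succ) / (x j - x (j.succAbove k)) := by
  have h := hv.2 k
  by_cases hjk : k.castSucc < j
  · rw [Fin.succAbove_of_castSucc_lt _ _ hjk]
    apply div_pos
    · have : x k.succ ≤ x j := hx.monotone (Fin.castSucc_lt_iff_succ_le.1 hjk)
      linarith
    · exact sub_pos.2 (hx hjk)
  · rw [not_lt] at hjk
    rw [Fin.succAbove_of_le_castSucc _ _ hjk]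
    apply div_pos_of_neg_of_neg
    · have : x j ≤ x k.castSucc := hx.monotone hjk
      linarith
    · exact sub_neg.2 (hx (Fin.le_castSucc_iff.1 hjk))

lemma Phi_pos {n : ℕ} {x v : Fin (n + 1) → ℝ} (hx : StrictMono x) (hv : v ∈ PhiDom x) (j : Fin (n + 1)) :
    0 < Phi x v j :=
  mul_pos hv.1 (Finset.prod_pos fun k _ => lt_of_dom hx hv j k)

open Polynomial in
def nodeP {n : ℕ} (z : Fin n → ℝ) : ℝ[X] := ∏ k, (X - C (z k))

open Polynomial in
lemma nodeP_eval {n : ℕ} (z : Fin n → ℝ) (y : ℝ) : (nodeP z).eval y = ∏ k, (y - z k) := by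
  simp [nodeP, Polynomial.eval_prod]

lemma nodeP_deg {n : ℕ} (z : Fin n → ℝ) : (nodeP z).natDegree = n := by
  unfold nodeP
  rw [Polynomial.natDegree_finsetProd_X_sub_C_eq_card]; simp

lemma nodeP_coeff {n : ℕ} (z : Fin n → ℝ) : (nodeP z).coeff n = 1 := by
  have h : (nodeP z).Monic := Polynomial.monic_prod_X_sub_C _ _
  have := h.coeff_natDegree
  rwa [nodeP_deg] at this

lemma C_ne {n : ℕ} {x : Fin (n + 1) → ℝ} (hx : StrictMono x) (j : Fin (n + 1)) :
    ∏ k : Fin n, (x j - x (j.succAbove k)) ≠ 0 :=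
  Finset.prod_ne_zero_iff.2 fun k _ => sub_ne_zero.2 fun h => Fin.succAbove_ne j k (hx.injective h).symm

def wP {n : ℕ} (x w : Fin (n + 1) → ℝ) : Polynomial ℝ :=
  ∑ j, Polynomial.C (w j) * nodeP (fun k => x (j.succAbove k))

lemma wP_deg {n : ℕ} (x w : Fin (n + 1) → ℝ) : (wP x w).degree < (n + 1 : ℕ) := by
  have : (wP x w).natDegree ≤ n := by
    apply Polynomial.natDegree_sum_le_of_forall_le
    intro j _
    refine (Polynomial.natDegree_C_mul_le _ _).trans ?_
    rw [nodeP_deg]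
  exact lt_of_le_of_lt Polynomial.degree_le_natDegree (by exact_mod_cast Nat.lt_succ_of_le this)

lemma wP_coeff {n : ℕ} (x w : Fin (n + 1) → ℝ) : (wP x w).coeff n = ∑ j, w j := by
  simp [wP, nodeP_coeff]

lemma wP_eval {n : ℕ} (x w : Fin (n + 1) → ℝ) (i : Fin (n + 1)) :
    (wP x w).eval (x i) = w i * ∏ k : Fin n, (x i - x (i.succAbove k)) := by
  rw [wP, Polynomial.eval_finsetSum, Finset.sum_eq_single i]
  · simp [nodeP_eval]
  · intro j _ hj
    obtain ⟨k, hk⟩ := Fin.exists_succAbove_eq hj.symm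
    simp only [Polynomial.eval_mul, nodeP_eval]
    rw [Finset.prod_eq_zero (Finset.mem_univ k) (by rw [hk]; simp), mul_zero]
  · simp

lemma wP_Phi {n : ℕ} {x : Fin (n + 1) → ℝ} (hx : StrictMono x) (v : Fin (n + 1) → ℝ) :
    wP x (Phi x v) = Polynomial.C (v 0) * nodeP (fun k : Fin n => v k.succ) := by
  apply Polynomial.eq_of_degrees_lt_of_eval_index_eq (s := Finset.univ) (v := x)
  · exact hx.injective.injOn
  · simpa using wP_deg x (Phi x v)
  · simp only [Finset.card_univ, Fintype.card_fin]
    refine lt_of_le_of_lt Polynomial.degree_le_natDegree ?_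
    have := (Polynomial.natDegree_C_mul_le (v 0) (nodeP (fun k : Fin n => v k.succ)))
    rw [nodeP_deg] at this
    exact_mod_cast Nat.lt_succ_of_le this
  · intro i _
    rw [wP_eval, Polynomial.eval_mul, Polynomial.eval_C, nodeP_eval, Phi, Finset.prod_div_distrib]
    have := C_ne hx i
    field_simp

lemma Phi_sum {n : ℕ} {x : Fin (n + 1) → ℝ} (hx : StrictMono x) (v : Fin (n + 1) → ℝ) :
    ∑ j, Phi x v j = v 0 := by
  rw [← wP_coeff x, wP_Phi hx, Polynomial.coeff_C_mul, nodeP_coeff, mul_one]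

lemma dom_mono {n : ℕ} {x v : Fin (n + 1) → ℝ} (hx : StrictMono x) (hv : v ∈ PhiDom x) :
    StrictMono (fun k : Fin n => v k.succ) := by
  intro i j hij
  have h1 := (hv.2 i).2
  have h2 := (hv.2 j).1
  have : x i.succ ≤ x j.castSucc := hx.monotone (by rw [Fin.le_def]; simp; exact hij)
  dsimp only; linarith

lemma Phi_inj {n : ℕ} {x : Fin (n + 1) → ℝ} (hx : StrictMono x) : Set.InjOn (Phi x) (PhiDom x) := by
  intro v hv v' hv' h
  have h0 : v 0 = v' 0 := by rw [← Phi_sum hx v, ← Phi_sum hx v', h]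
  have h1 : (fun k : Fin n => v k.succ) = (fun k : Fin n => v' k.succ) := by
    apply sorted_unique _ _ (dom_mono hx hv).monotone (dom_mono hx hv').monotone Set.univ Set.infinite_univ
    intro t _
    have h2 := congrArg (fun p => Polynomial.eval t p) (wP_Phi hx v)
    have h3 := congrArg (fun p => Polynomial.eval t p) (wP_Phi hx v')
    simp only [Polynomial.eval_mul, Polynomial.eval_C, nodeP_eval] at h2 h3
    rw [h, h3, h0] at h2
    exact (mul_left_cancel₀ hv'.1.ne' h2).symm
  ext j
  induction j using Fin.cases with
  | zero => exact h0
  | succ k => exact congrFun h1 k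

lemma Phi_surj {n : ℕ} {x : Fin (n + 1) → ℝ} (hx : StrictMono x) (w : Fin (n + 1) → ℝ) (hw : ∀ j, 0 < w j) :
    ∃ v ∈ PhiDom x, Phi x v = w := by
  have hroot : ∀ k : Fin n, ∃ ξ ∈ Set.Ioo (x k.castSucc) (x k.succ), (wP x w).eval ξ = 0 := by
    intro k
    have hlt : x k.castSucc < x k.succ := hx (Fin.castSucc_lt_succ)
    -- opposite signs
    have hsgn : (wP x w).eval (x k.castSucc) * (wP x w).eval (x k.succ) < 0 := by
      rw [wP_eval, wP_eval]
      have hp : (∏ l : Fin n, (x k.castSucc - x (k.castSucc.succAbove l))) *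
          (∏ l : Fin n, (x k.succ - x (k.succ.succAbove l))) < 0 := by
        rw [← Finset.prod_mul_distrib, ← Finset.mul_prod_erase _ _ (Finset.mem_univ k)]
        apply mul_neg_of_neg_of_pos
        · rw [Fin.succAbove_of_le_castSucc _ _ le_rfl, Fin.succAbove_of_castSucc_lt _ _ Fin.castSucc_lt_succ]
          nlinarith
        · apply Finset.prod_pos
          intro l hl
          have hne : l ≠ k := (Finset.mem_erase.1 hl).1
          rcases lt_or_gt_of_ne hne with h | h
          · have h1 : l.castSucc < k.castSucc := by simpa using h
            have h2 : l.castSucc < k.succ := h1.trans Fin.castSucc_lt_succ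
            rw [Fin.succAbove_of_castSucc_lt _ _ h1, Fin.succAbove_of_castSucc_lt _ _ h2]
            exact mul_pos (sub_pos.2 (hx h1)) (sub_pos.2 (hx h2))
          · have h1 : k.castSucc < l.castSucc := by simpa using h
            have h2 : k.succ ≤ l.castSucc := Fin.castSucc_lt_iff_succ_le.1 h1
            rw [Fin.succAbove_of_le_castSucc _ _ h1.le, Fin.succAbove_of_le_castSucc _ _ h2]
            have h3 : l.castSucc < l.succ := Fin.castSucc_lt_succ
            exact mul_pos_of_neg_of_neg (sub_neg.2 (hx (h1.trans h3))) (sub_neg.2 (hx (lt_of_le_of_lt h2 h3)))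
      have := mul_pos (hw k.castSucc) (hw k.succ)
      nlinarith
    have hc : ContinuousOn (fun y => (wP x w).eval y) (Set.Icc (x k.castSucc) (x k.succ)) :=
      (wP x w).continuous.continuousOn
    rcases mul_neg_iff.1 hsgn with ⟨h1, h2⟩ | ⟨h1, h2⟩
    · obtain ⟨ξ, hξ, h⟩ := intermediate_value_Ioo' hlt.le hc ⟨h2, h1⟩
      exact ⟨ξ, hξ, h⟩
    · obtain ⟨ξ, hξ, h⟩ := intermediate_value_Ioo hlt.le hc ⟨h1, h2⟩
      exact ⟨ξ, hξ, h⟩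
  choose ξ hξ hξ0 using hroot
  set r := ∑ j, w j with hr
  let v : Fin (n + 1) → ℝ := Fin.cons r ξ
  have hv : v ∈ PhiDom x := ⟨Finset.sum_pos (fun j _ => hw j) ⟨0, Finset.mem_univ _⟩, fun k => by simpa [v] using hξ k⟩
  refine ⟨v, hv, ?_⟩
  have hmono := dom_mono hx hv
  have hp : wP x w = Polynomial.C r * nodeP ξ := by
    rw [← sub_eq_zero]
    have hdeg : (wP x w - Polynomial.C r * nodeP ξ).degree < n := by
      rw [Polynomial.degree_lt_iff_coeff_zero]
      intro m hm
      rcases hm.eq_or_lt with rfl | hm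
      · rw [Polynomial.coeff_sub, wP_coeff, Polynomial.coeff_C_mul, nodeP_coeff]; simp [hr]
      · rw [Polynomial.coeff_sub, Polynomial.coeff_C_mul, Polynomial.coeff_eq_zero_of_degree_lt,
          Polynomial.coeff_eq_zero_of_natDegree_lt (by rwa [nodeP_deg]), mul_zero, sub_zero]
        exact (wP_deg x w).trans_le (by exact_mod_cast hm)
    apply Polynomial.eq_zero_of_degree_lt_of_eval_index_eq_zero (s := Finset.univ) (v := ξ)
    · intro i _ j _ hij
      exact hmono.injective (by simpa [v] using hij)
    · simpa using hdeg
    · intro i _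
      rw [Polynomial.eval_sub, hξ0, Polynomial.eval_mul, nodeP_eval, Finset.prod_eq_zero (Finset.mem_univ i) (by simp)]
      simp
  ext j
  have h1 := congrArg (fun p => Polynomial.eval (x j) p) hp
  simp only [Polynomial.eval_mul, Polynomial.eval_C, nodeP_eval, wP_eval] at h1
  have h2 := C_ne hx j
  simp only [Phi, v, Fin.cons_zero, Fin.cons_succ, Finset.prod_div_distrib]
  field_simp
  linarith
end

section
open Polynomial in
def qP {n : ℕ} (v : Fin (n + 1) → ℝ) : Fin (n + 1) → ℝ[X] :=
  Fin.cons (nodeP (fun k : Fin n => v k.succ))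
    (fun k : Fin n => C (- v 0) * ∏ l ∈ Finset.univ.erase k, (X - C (v l.succ)))

def PhiJac {n : ℕ} (x v : Fin (n + 1) → ℝ) : Matrix (Fin (n + 1)) (Fin (n + 1)) ℝ :=
  Matrix.diagonal (fun j => (∏ k : Fin n, (x j - x (j.succAbove k)))⁻¹) *
    Matrix.of fun j k => (qP v k).eval (x j)

lemma qP_deg {n : ℕ} (v : Fin (n + 1) → ℝ) (k : Fin (n + 1)) : (qP v k).natDegree < n + 1 := by
  induction k using Fin.cases with
  | zero => simp [qP, nodeP_deg]
  | succ k =>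
    simp only [qP, Fin.cons_succ]
    refine Nat.lt_succ_of_le ((Polynomial.natDegree_C_mul_le _ _).trans ?_)
    rw [Polynomial.natDegree_finsetProd_X_sub_C_eq_card]
    simp

lemma Phi_hasFDeriv {n : ℕ} (x v : Fin (n + 1) → ℝ) :
    HasFDerivAt (Phi x) (Matrix.toLin' (PhiJac x v)).toContinuousLinearMap v := by
  rw [hasFDerivAt_pi']
  intro j
  have h0 : HasFDerivAt (fun v : Fin (n + 1) → ℝ => v 0) (ContinuousLinearMap.proj (R := ℝ) (φ := fun _ : Fin (n + 1) => ℝ) 0) v :=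
    (ContinuousLinearMap.proj (R := ℝ) (φ := fun _ : Fin (n + 1) => ℝ) 0).hasFDerivAt
  have hk : ∀ k ∈ (Finset.univ : Finset (Fin n)), HasFDerivAt (fun v : Fin (n + 1) → ℝ => x j - v k.succ)
      (- ContinuousLinearMap.proj (R := ℝ) (φ := fun _ : Fin (n + 1) => ℝ) k.succ) v := fun k _ =>
    ((ContinuousLinearMap.proj (R := ℝ) (φ := fun _ : Fin (n + 1) => ℝ) k.succ).hasFDerivAt).const_sub (x j)
  have hp := HasFDerivAt.finsetProd hk
  have hm := (h0.mul hp).mul_const ((∏ k : Fin n, (x j - x (j.succAbove k)))⁻¹)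
  refine (hm.congr_fderiv ?_).congr_of_eventuallyEq (Filter.Eventually.of_forall fun u => ?_)
  · ext u
    simp only [ContinuousLinearMap.comp_apply, ContinuousLinearMap.proj_apply, LinearMap.coe_toContinuousLinearMap',
      Matrix.toLin'_apply, PhiJac, _root_.smul_apply, _root_.add_apply, smul_eq_mul,
      _root_.sum_apply, _root_.neg_apply]
    rw [← Matrix.mulVec_mulVec, Matrix.mulVec_diagonal]
    congr 1
    simp only [Matrix.mulVec, dotProduct, Matrix.of_apply]
    rw [Fin.sum_univ_succ]
    simp only [qP, Fin.cons_zero, Fin.cons_succ, nodeP_eval, Polynomial.eval_mul, Polynomial.eval_C,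
      Polynomial.eval_prod, Polynomial.eval_sub, Polynomial.eval_X]
    rw [Finset.mul_sum, add_comm]
    congr 1
    refine Finset.sum_congr rfl fun k _ => ?_
    ring
  · simp only [Phi, Finset.prod_div_distrib, div_eq_mul_inv, Finset.prod_mul_distrib, Finset.prod_inv_distrib, Pi.mul_apply]
    ring

lemma prod_succAbove {n : ℕ} (x : Fin (n + 1) → ℝ) (j : Fin (n + 1)) :
    ∏ k : Fin n, (x j - x (j.succAbove k)) = ∏ k ∈ Finset.univ.erase j, (x j - x k) := by
  have : Finset.univ.erase j = Finset.univ.map (Fin.succAboveEmb j) := by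
    ext k; simp [Fin.exists_succAbove_eq_iff]
  rw [this, Finset.prod_map]; rfl

lemma PhiJac_det {n : ℕ} {x v : Fin (n + 1) → ℝ} (hx : StrictMono x) (hv : v ∈ PhiDom x) :
    |(PhiJac x v).det| = v 0 ^ n * vdm (fun k : Fin n => v k.succ) / vdm x := by
  set ξ := fun k : Fin n => v k.succ with hξ
  have hVx := vdm_pos hx
  have hVξ := vdm_pos (dom_mono hx hv)
  let y : Fin (n + 1) → ℝ := Fin.cons (x 0) ξ
  have hlt : ∀ k, x 0 < ξ k := fun k => lt_of_le_of_lt (hx.monotone (Fin.zero_le _)) (hv.2 k).1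
  have hP : 0 < ∏ k, (ξ k - x 0) := Finset.prod_pos fun k _ => sub_pos.2 (hlt k)
  have hVy : vdm y = (∏ k, (ξ k - x 0)) * vdm ξ := by
    rw [vdm_cons]; simp [y]
  have h2 := det_eval_two (qP v) (qP_deg v) x y
  have htri : (Matrix.of fun j k => (qP v k).eval (y j)).det =
      (∏ k, (x 0 - ξ k)) * ∏ k, (- v 0 * ∏ l ∈ Finset.univ.erase k, (ξ k - ξ l)) := by
    rw [Matrix.det_of_isUpperTriangular, Fin.prod_univ_succ]
    · simp [qP, y, nodeP_eval, Polynomial.eval_prod, hξ]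
    · intro i j hij
      simp only [id] at hij
      induction i using Fin.cases with
      | zero => exact absurd hij (Fin.not_lt_zero j)
      | succ i =>
        induction j using Fin.cases with
        | zero =>
          simp only [Matrix.of_apply, qP, Fin.cons_zero, nodeP_eval, y, Fin.cons_succ]
          exact Finset.prod_eq_zero (Finset.mem_univ i) (by simp [hξ])
        | succ j =>
          simp only [Matrix.of_apply, qP, Fin.cons_succ, y, Polynomial.eval_mul, Polynomial.eval_prod]
          rw [Finset.prod_eq_zero (i := i), mul_zero]
          · rw [Finset.mem_erase]; refine ⟨?_, Finset.mem_univ _⟩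
            rintro rfl; exact lt_irrefl _ hij
          · simp [hξ]
  have h3 : |(Matrix.of fun j k => (qP v k).eval (x j)).det| = v 0 ^ n * vdm ξ * vdm x := by
    have h4 : |(Matrix.of fun j k => (qP v k).eval (y j)).det| = (∏ k, (ξ k - x 0)) * (v 0 ^ n * vdm ξ ^ 2) := by
      rw [htri, abs_mul, Finset.prod_mul_distrib, abs_mul, prod_ne_eq, abs_of_pos hVξ]
      congr 1
      · rw [Finset.abs_prod]
        refine Finset.prod_congr rfl fun k _ => ?_
        rw [abs_sub_comm, abs_of_pos (sub_pos.2 (hlt k))]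
      · congr 1
        rw [Finset.prod_const, abs_pow, abs_neg, abs_of_pos hv.1]; simp
    have h5 := congrArg abs h2
    rw [abs_mul, abs_mul, h4, hVy, abs_of_pos (mul_pos hP hVξ), abs_of_pos hVx] at h5
    have : (∏ k, (ξ k - x 0)) * vdm ξ ≠ 0 := (mul_pos hP hVξ).ne'
    apply mul_right_cancel₀ this
    rw [h5]; ring
  have h6 : |∏ j, (∏ k : Fin n, (x j - x (j.succAbove k)))⁻¹| = (vdm x ^ 2)⁻¹ := by
    rw [Finset.prod_inv_distrib, abs_inv]
    simp only [prod_succAbove]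
    rw [prod_ne_eq, abs_of_pos hVx]
  rw [PhiJac, Matrix.det_mul, Matrix.det_diagonal, abs_mul, h6, h3]
  field_simp

lemma PhiDom_eq {n : ℕ} (x : Fin (n + 1) → ℝ) : PhiDom x =
    Set.pi Set.univ (Fin.cons (Set.Ioi 0) (fun k : Fin n => Set.Ioo (x k.castSucc) (x k.succ)) : Fin (n + 1) → Set ℝ) := by
  ext v
  simp only [PhiDom, Set.mem_ofPred_eq, Set.mem_pi, Set.mem_univ, true_implies]
  rw [Fin.forall_fin_succ]
  simp

lemma Phi_image {n : ℕ} {x : Fin (n + 1) → ℝ} (hx : StrictMono x) : Phi x '' PhiDom x = {w | ∀ j, 0 < w j} := by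
  ext w
  constructor
  · rintro ⟨v, hv, rfl⟩; exact Phi_pos hx hv
  · intro hw; obtain ⟨v, hv, h⟩ := Phi_surj hx w hw; exact ⟨v, hv, h⟩

lemma PhiDom_meas {n : ℕ} (x : Fin (n + 1) → ℝ) : MeasurableSet (PhiDom x) := by
  rw [PhiDom_eq]
  refine MeasurableSet.univ_pi fun j => ?_
  induction j using Fin.cases <;> simp [measurableSet_Ioi, measurableSet_Ioo]

lemma Phi_cov {n : ℕ} {x : Fin (n + 1) → ℝ} (hx : StrictMono x) (f : (Fin (n + 1) → ℝ) → ℝ) :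
    ∫ w in {w | ∀ j, 0 < w j}, f w =
      ∫ v in PhiDom x, (v 0 ^ n * vdm (fun k : Fin n => v k.succ) / vdm x) * f (Phi x v) := by
  rw [← Phi_image hx, integral_image_eq_integral_abs_det_fderiv_smul volume (PhiDom_meas x)
    (fun v _ => (Phi_hasFDeriv x v).hasFDerivWithinAt) (Phi_inj hx)]
  refine setIntegral_congr_fun (PhiDom_meas x) fun v hv => ?_
  rw [smul_eq_mul]
  congr 1
  rw [← PhiJac_det hx hv, ContinuousLinearMap.det]
  simp [LinearMap.det_toLin']
end

section
lemma det_diff {n : ℕ} (f : Fin (n + 1) → Fin n → ℝ) :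
    (Matrix.of fun j k : Fin n => f j.succ k - f j.castSucc k).det =
      (Matrix.of fun j : Fin (n + 1) => (Fin.cons 1 (f j) : Fin (n + 1) → ℝ)).det := by
  set A : Matrix (Fin (n + 1)) (Fin (n + 1)) ℝ := Matrix.of fun j : Fin (n + 1) => (Fin.cons 1 (f j) : Fin (n + 1) → ℝ) with hA
  let B : Matrix (Fin (n + 1)) (Fin (n + 1)) ℝ := Matrix.of (Fin.cons (A 0) (fun i => A i.succ - A i.castSucc))
  have h := Matrix.det_eq_of_forall_row_eq_smul_add_pred (A := A) (B := B) (fun _ => 1) (fun j => by simp [B])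
    (fun i j => by simp [B])
  rw [h, Matrix.det_succ_column_zero, Fin.sum_univ_succ, Finset.sum_eq_zero]
  · simp only [Fin.val_zero, pow_zero, one_mul, add_zero]
    have : B 0 0 = 1 := by simp [B, hA]
    rw [this, one_mul]
    congr 1
  · intro i _
    have : B i.succ 0 = 0 := by simp [B, hA]
    rw [this]; simp

lemma int_rpow_Ioo {a b p : ℝ} (hab : a ≤ b) (hp : -1 < p) :
    IntegrableOn (fun s : ℝ => s ^ p) (Set.Ioo a b) ∧
    ∫ s in Set.Ioo a b, s ^ p = (b ^ (p + 1) - a ^ (p + 1)) / (p + 1) := by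
  constructor
  · exact ((intervalIntegrable_iff_integrableOn_Ioc_of_le hab).1 (intervalIntegral.intervalIntegrable_rpow' hp)).mono_set Set.Ioo_subset_Ioc_self
  · rw [← integral_Ioc_eq_integral_Ioo, ← intervalIntegral.integral_of_le hab, integral_rpow (Or.inl hp)]

lemma box_int {n : ℕ} {x : Fin (n + 1) → ℝ} (hx : StrictMono x)
    {G : ℝ → ℝ} (hG : IntegrableOn G (Set.Ioi 0)) (p : Fin n → ℝ) (hp : ∀ k, -1 < p k) :
    ∫ v in PhiDom x, G (v 0) * (Matrix.of fun j k : Fin n => v j.succ ^ p k).det =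
      (∫ r in Set.Ioi 0, G r) * (Matrix.of fun j k : Fin n =>
        (x j.succ ^ (p k + 1) - x j.castSucc ^ (p k + 1)) / (p k + 1)).det := by
  have hlt : ∀ k : Fin n, x k.castSucc ≤ x k.succ := fun k => (hx Fin.castSucc_lt_succ).le
  rw [PhiDom_eq, volume_pi, Measure.restrict_pi_pi]
  set S : Fin (n + 1) → Set ℝ := (Fin.cons (Set.Ioi 0) (fun k : Fin n => Set.Ioo (x k.castSucc) (x k.succ))) with hS
  set F : Equiv.Perm (Fin n) → Fin (n + 1) → ℝ → ℝ := fun σ =>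
    Fin.cons G (fun j : Fin n => fun s => s ^ p (σ j)) with hF
  have hInt : ∀ σ, Integrable (fun v : Fin (n + 1) → ℝ => ∏ i, F σ i (v i)) (Measure.pi fun i => volume.restrict (S i)) := by
    intro σ
    apply Integrable.fintype_prod
    intro i
    induction i using Fin.cases with
    | zero => simpa [F, S, IntegrableOn] using hG
    | succ j => simpa [F, S, IntegrableOn] using (int_rpow_Ioo (hlt j) (hp (σ j))).1
  have hval : ∀ σ, ∫ v, ∏ i, F σ i (v i) ∂(Measure.pi fun i => volume.restrict (S i)) =
      (∫ r in Set.Ioi 0, G r) * ∏ j : Fin n, (x j.succ ^ (p (σ j) + 1) - x j.castSucc ^ (p (σ j) + 1)) / (p (σ j) + 1) := by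
    intro σ
    rw [integral_fintype_prod_eq_prod, Fin.prod_univ_succ]
    simp only [F, S, Fin.cons_zero, Fin.cons_succ]
    congr 1
    exact Finset.prod_congr rfl fun j _ => (int_rpow_Ioo (hlt j) (hp (σ j))).2
  have hexp : ∀ v : Fin (n + 1) → ℝ, G (v 0) * (Matrix.of fun j k : Fin n => v j.succ ^ p k).det =
      ∑ σ : Equiv.Perm (Fin n), ((Equiv.Perm.sign σ : ℤ) : ℝ) * ∏ i, F σ i (v i) := by
    intro v
    rw [← Matrix.det_transpose, Matrix.det_apply', Finset.mul_sum]
    refine Finset.sum_congr rfl fun σ _ => ?_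
    rw [Fin.prod_univ_succ]
    simp only [F, Fin.cons_zero, Fin.cons_succ, Matrix.transpose_apply, Matrix.of_apply]
    ring
  simp only [hexp]
  rw [integral_finsetSum _ (fun σ _ => (hInt σ).const_mul _), ← Matrix.det_transpose, Matrix.det_apply', Finset.mul_sum]
  refine Finset.sum_congr rfl fun σ _ => ?_
  rw [integral_const_mul, hval]
  simp only [Matrix.transpose_apply, Matrix.of_apply]
  ring

lemma interlace {n : ℕ} {x : Fin (n + 1) → ℝ} (hx : StrictMono x) (hx0 : 0 ≤ x 0) {θ : ℝ} (hθ : -1 < θ)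
    (hor : θ = 0 ∨ x 0 = 0) (l : Fin n → ℕ) (h : (Fin (n + 1) → ℝ) → ℝ) (C : ℝ)
    (hh : ∀ v ∈ PhiDom x, h (Phi x v) * vdm (fun k : Fin n => v k.succ) =
      C * (Matrix.of fun j k : Fin n => v j.succ ^ l k).det) :
    (∫ w in {w : Fin (n + 1) → ℝ | ∀ j, 0 < w j}, h w * (w 0 ^ θ * Real.exp (-∑ j, w j))) * vdm x =
      C * Real.Gamma (n + θ + 1) * (∏ k : Fin n, x k.succ ^ (-θ)) *
        (Matrix.of fun j k : Fin n =>
        (x j.succ ^ (l k + θ + 1) - x j.castSucc ^ (l k + θ + 1)) / (l k + θ + 1)).det := by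
  have hV := vdm_pos hx
  have hGi : IntegrableOn (fun r : ℝ => Real.exp (-r) * r ^ ((n + θ + 1 : ℝ) - 1)) (Set.Ioi 0) :=
    Real.GammaIntegral_convergent (by have : (0:ℝ) ≤ n := Nat.cast_nonneg n; linarith)
  have hGv : ∫ r in Set.Ioi 0, Real.exp (-r) * r ^ ((n + θ + 1 : ℝ) - 1) = Real.Gamma (n + θ + 1) :=
    (Real.Gamma_eq_integral (by have : (0:ℝ) ≤ n := Nat.cast_nonneg n; linarith)).symm
  have hbox := box_int hx hGi (fun k => l k + θ) (fun k => by
    have : (0:ℝ) ≤ l k := Nat.cast_nonneg _; linarith)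
  rw [hGv] at hbox
  rw [Phi_cov hx]
  have hpt : ∀ v ∈ PhiDom x, (v 0 ^ n * vdm (fun k : Fin n => v k.succ) / vdm x) *
      (h (Phi x v) * (Phi x v 0 ^ θ * Real.exp (-∑ j, Phi x v j))) =
      (C / vdm x * (∏ k : Fin n, x k.succ ^ (-θ))) * ((fun r : ℝ => Real.exp (-r) * r ^ ((n + θ + 1 : ℝ) - 1)) (v 0) *
        (Matrix.of fun j k : Fin n => v j.succ ^ ((fun k => l k + θ) k)).det) := by
    intro v hv
    rw [Phi_sum hx]
    have hpos : ∀ k : Fin n, 0 < v k.succ := fun k =>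
      lt_of_le_of_lt (hx0.trans (hx.monotone (Fin.zero_le _))) (hv.2 k).1
    have hxpos : ∀ k : Fin n, 0 < x k.succ := fun k => lt_of_le_of_lt hx0 (hx (Fin.succ_pos k))
    have hdet : (Matrix.of fun j k : Fin n => v j.succ ^ ((fun k => l k + θ) k)).det =
        (∏ j : Fin n, v j.succ ^ θ) * (Matrix.of fun j k : Fin n => v j.succ ^ l k).det := by
      rw [← Matrix.det_mul_column]
      congr 1
      ext j k
      simp only [Matrix.of_apply]
      rw [add_comm, Real.rpow_add (hpos j), Real.rpow_natCast]
    have hw0 : Phi x v 0 ^ θ = v 0 ^ θ * ((∏ j : Fin n, v j.succ ^ θ) * (∏ k : Fin n, x k.succ ^ (-θ))) := by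
      rcases hor with rfl | h0
      · simp
      · have hP : Phi x v 0 = v 0 * ∏ k : Fin n, (v k.succ / x k.succ) := by
          simp only [Phi, h0, Fin.succAbove_zero]
          congr 1
          refine Finset.prod_congr rfl fun k _ => ?_
          rw [zero_sub, zero_sub, neg_div_neg_eq]
        have hq : ∀ k ∈ (Finset.univ : Finset (Fin n)), 0 ≤ v k.succ / x k.succ := fun k _ => (div_pos (hpos k) (hxpos k)).le
        rw [hP, Real.mul_rpow hv.1.le (Finset.prod_nonneg hq), ← Real.finsetProd_rpow _ _ hq,
          ← Finset.prod_mul_distrib]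
        congr 1
        refine Finset.prod_congr rfl fun k _ => ?_
        rw [Real.div_rpow (hpos k).le (hxpos k).le, Real.rpow_neg (hxpos k).le]; rfl
    have hr : v 0 ^ ((n + θ + 1 : ℝ) - 1) = v 0 ^ n * v 0 ^ θ := by
      rw [show (n + θ + 1 : ℝ) - 1 = n + θ by ring, Real.rpow_add hv.1, Real.rpow_natCast]
    simp only [hr]
    rw [hdet, hw0]
    have := hh v hv
    calc _ = v 0 ^ n * v 0 ^ θ * Real.exp (-v 0) * (∏ j : Fin n, v j.succ ^ θ) * (∏ k : Fin n, x k.succ ^ (-θ)) / vdm x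
          * (h (Phi x v) * vdm (fun k : Fin n => v k.succ)) := by ring
      _ = _ := by rw [this]; ring
  rw [setIntegral_congr_fun (PhiDom_meas x) hpt, integral_const_mul, hbox]
  have e : ∀ k : Fin n, (l k : ℝ) + θ + 1 = l k + θ + 1 := fun _ => rfl
  field_simp
end

section
lemma conj_of_det {N : ℕ} (Y Z : Matrix (Fin N) (Fin N) ℝ) (hY : Yᵀ = -Y) (hZ : Zᵀ = -Z)
    (h : ∀ t : ℝ, 0 < t → (t • (1 : Matrix (Fin N) (Fin N) ℝ) + Y).det = (t • (1 : Matrix (Fin N) (Fin N) ℝ) + Z).det) :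
    ∃ q : OG N, Y = q.1 * Z * q.1ᵀ := by
  obtain ⟨k, a, ha, hab, hk⟩ := canon N Y hY
  obtain ⟨k', a', ha', hab', hk'⟩ := canon N Z hZ
  have hfun : (fun j : Fin (N/2) => a j ^ 2) = fun j : Fin (N/2) => a' j ^ 2 := by
    apply sorted_unique
    · intro i j hij
      exact pow_le_pow_left₀ (ha _) (hab _ _ hij j.isLt) 2
    · intro i j hij
      exact pow_le_pow_left₀ (ha' _) (hab' _ _ hij j.isLt) 2
    · exact Set.Iio_infinite (0:ℝ)
    · intro s hs
      have hs : s < 0 := hs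
      have ht := h (Real.sqrt (-s)) (Real.sqrt_pos.2 (by linarith))
      rw [hk, hk', og_det_conj, og_det_conj, det_Dn, det_Dn] at ht
      have h0 : (Real.sqrt (-s)) ^ (N % 2) ≠ 0 := pow_ne_zero _ (Real.sqrt_pos.2 (by linarith)).ne'
      have ht := mul_left_cancel₀ h0 ht
      rw [Finset.prod_range, Finset.prod_range, Real.sq_sqrt (by linarith)] at ht
      have e : ∀ b : ℕ → ℝ, ∏ j : Fin (N/2), (s - b j ^ 2) = (-1)^(N/2) * ∏ j : Fin (N/2), (-s + b j ^ 2) := by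
        intro b
        rw [show ((-1:ℝ))^(N/2) = ∏ j : Fin (N/2), (-1:ℝ) by simp, ← Finset.prod_mul_distrib]
        exact Finset.prod_congr rfl fun j _ => by ring
      rw [e, e, ht]
  have hD : Dn N a = Dn N a' := Dn_congr fun j hj => by
    have := congrFun hfun ⟨j, hj⟩
    exact (pow_left_inj₀ (ha j) (ha' j) two_ne_zero).1 this
  refine ⟨k * k'⁻¹, ?_⟩
  have h2 : (k * k'⁻¹ : OG N).1 = k.1 * k'.1ᵀ := by rw [← og_inv_coe]; rfl
  rw [h2, hk', hk, hD, Matrix.transpose_mul, Matrix.transpose_transpose]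
  calc k.1 * Dn N a' * k.1ᵀ = k.1 * (k'.1ᵀ * k'.1) * Dn N a' * (k'.1ᵀ * k'.1) * k.1ᵀ := by
        rw [og_tr_mul]; simp
    _ = _ := by simp only [Matrix.mul_assoc]

lemma sph_of_det {N : ℕ} (e : ℕ → ℕ) (Y Z : Matrix (Fin N) (Fin N) ℝ) (hY : Yᵀ = -Y) (hZ : Zᵀ = -Z)
    (h : ∀ t : ℝ, 0 < t → (t • (1 : Matrix (Fin N) (Fin N) ℝ) + Y).det = (t • (1 : Matrix (Fin N) (Fin N) ℝ) + Z).det) :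
    sph e Y = sph e Z := by
  obtain ⟨q, hq⟩ := conj_of_det Y Z hY hZ h
  rw [hq, sph_conj]

/-- corner function -/
def psi {N : ℕ} (e : ℕ → ℕ) (X M : Matrix (Fin (N + 1)) (Fin (N + 1)) ℝ) : ℝ :=
  sph e ((M * X * Mᵀ).submatrix Fin.castSucc Fin.castSucc)

lemma continuous_psi {N : ℕ} (e : ℕ → ℕ) (X : Matrix (Fin (N + 1)) (Fin (N + 1)) ℝ) :
    Continuous (psi e X) := by
  refine (continuous_sph e).comp ?_
  exact ((continuous_id.matrix_mul continuous_const).matrix_mul continuous_id.matrix_transpose).matrix_submatrix _ _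

lemma pw_succ {N : ℕ} (e : ℕ → ℕ) (X : Matrix (Fin (N + 1)) (Fin (N + 1)) ℝ) :
    pw e X = pw e (X.submatrix Fin.castSucc Fin.castSucc) * X.det ^ e N := by
  unfold pw
  rw [Fin.prod_univ_castSucc]
  congr 1

lemma corner_blk {N : ℕ} (k : OG N) (Y : Matrix (Fin (N + 1)) (Fin (N + 1)) ℝ) :
    ((blkOG k (1 : OG 1)).1 * Y * (blkOG k (1 : OG 1)).1ᵀ).submatrix Fin.castSucc Fin.castSucc =
      k.1 * Y.submatrix Fin.castSucc Fin.castSucc * k.1ᵀ := by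
  have h1 : (blkOG k (1 : OG 1)).1 = blk k.1 0 0 1 := rfl
  rw [h1, blk_tr]
  conv_lhs => rw [blk_split (p := N) (q := 1) Y]
  rw [blk_mul, blk_mul]
  ext i j
  simp [blk, Matrix.submatrix_apply]
  rfl

lemma og_det_sq {N : ℕ} (k : OG N) : k.1.det * k.1.det = 1 := by
  have := congrArg Matrix.det (og_mul_tr k)
  rwa [Matrix.det_mul, Matrix.det_transpose, Matrix.det_one] at this

lemma sph_succ {N : ℕ} (e : ℕ → ℕ) (X : Matrix (Fin (N + 1)) (Fin (N + 1)) ℝ) :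
    sph e X = X.det ^ e N * ∫ k : OG (N + 1), psi e X k.1 ∂hm (N + 1) := by
  have hc : Continuous fun p : OG N × OG (N + 1) =>
      pw e ((blkOG p.1 (1 : OG 1) * p.2 : OG (N+1)).1 * X * (blkOG p.1 (1 : OG 1) * p.2 : OG (N+1)).1ᵀ) := by
    refine (continuous_pw e).comp ?_
    have h1 : Continuous fun k : OG N => (blkOG k (1 : OG 1)).1 := by
      unfold blkOG
      simp only [mkOG_coe]
      refine Continuous.matrix_submatrix ?_ _ _
      exact Continuous.matrix_fromBlocks continuous_subtype_val continuous_const continuous_const continuous_const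
    have h2 : Continuous fun p : OG N × OG (N + 1) => (blkOG p.1 (1 : OG 1) * p.2 : OG (N+1)).1 :=
      (h1.comp continuous_fst).matrix_mul (continuous_subtype_val.comp continuous_snd)
    exact (h2.matrix_mul continuous_const).matrix_mul h2.matrix_transpose
  have hint := hc.integrable_of_hasCompactSupport (μ := (hm N).prod (hm (N+1)))
    (HasCompactSupport.of_compactSpace _)
  have hsw := integral_integral_swap (μ := hm N) (ν := hm (N+1)) (f := fun k' k =>
    pw e ((blkOG k' (1 : OG 1) * k : OG (N+1)).1 * X * (blkOG k' (1 : OG 1) * k : OG (N+1)).1ᵀ)) hint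
  have hl : ∀ k' : OG N, ∫ k, pw e ((blkOG k' (1 : OG 1) * k : OG (N+1)).1 * X * (blkOG k' (1 : OG 1) * k : OG (N+1)).1ᵀ) ∂hm (N+1) = sph e X :=
    fun k' => hm_left (fun k : OG (N+1) => pw e (k.1 * X * k.1ᵀ)) (blkOG k' 1)
  simp only [hl] at hsw
  rw [integral_const] at hsw
  simp only [probReal_univ, one_smul] at hsw
  rw [hsw, ← integral_const_mul]
  refine integral_congr_ae (Filter.Eventually.of_forall fun k => ?_)
  dsimp only
  rw [psi, sph, ← integral_const_mul]
  refine integral_congr_ae (Filter.Eventually.of_forall fun k' => ?_)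
  dsimp only
  have hm2 : (blkOG k' (1 : OG 1) * k : OG (N+1)).1 * X * (blkOG k' (1 : OG 1) * k : OG (N+1)).1ᵀ =
     (blkOG k' (1 : OG 1)).1 * (k.1 * X * k.1ᵀ) * (blkOG k' (1 : OG 1)).1ᵀ := by
    have : (blkOG k' (1 : OG 1) * k : OG (N+1)).1 = (blkOG k' (1 : OG 1)).1 * k.1 := rfl
    rw [this, Matrix.transpose_mul]; simp only [Matrix.mul_assoc]
  rw [pw_succ]
  have hd : ((blkOG k' (1 : OG 1) * k : OG (N+1)).1 * X * (blkOG k' (1 : OG 1) * k : OG (N+1)).1ᵀ).det = X.det := by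
    rw [Matrix.det_mul, Matrix.det_mul, Matrix.det_transpose]
    linear_combination X.det * og_det_sq (blkOG k' (1 : OG 1) * k : OG (N+1))
  rw [hd, mul_comm, hm2, corner_blk]
end

section
/-! Householder -/
def nrm {N : ℕ} (u : Fin N → ℝ) : ℝ := Real.sqrt (u ⬝ᵥ u)

def hz {N : ℕ} (p : Fin N) (u : Fin N → ℝ) : Fin N → ℝ := fun i => (if i = p then 1 else 0) - u i / nrm u

def HH {N : ℕ} (p : Fin N) (u : Fin N → ℝ) : Matrix (Fin N) (Fin N) ℝ :=
  1 - (2 / (hz p u ⬝ᵥ hz p u)) • vecMulVec (hz p u) (hz p u)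

lemma HH_tr {N : ℕ} (p : Fin N) (u : Fin N → ℝ) : (HH p u)ᵀ = HH p u := by
  unfold HH
  rw [transpose_sub, transpose_one, transpose_smul]
  congr 2
  ext i j; simp [vecMulVec_apply, mul_comm]

lemma HH_orth {N : ℕ} (p : Fin N) (u : Fin N → ℝ) : HH p u * (HH p u)ᵀ = 1 := by
  rw [HH_tr]
  unfold HH
  set z := hz p u
  have hv : vecMulVec z z * vecMulVec z z = (z ⬝ᵥ z) • vecMulVec z z := by
    rw [vecMulVec_mul_vecMulVec]
    ext i j; simp [vecMulVec_apply]; ring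
  by_cases h : z ⬝ᵥ z = 0
  · simp [h]
  · rw [sub_mul, mul_sub, mul_sub, one_mul, mul_one, Matrix.smul_mul, Matrix.mul_smul (vecMulVec z z), hv, Matrix.one_mul]
    rw [smul_smul, smul_smul]
    have : 2 / (z ⬝ᵥ z) * (2 / (z ⬝ᵥ z)) * (z ⬝ᵥ z) = 2 * (2 / (z ⬝ᵥ z)) := by field_simp
    rw [this, mul_smul, two_smul]
    abel

def HG {N : ℕ} (p : Fin N) (u : Fin N → ℝ) : OG N := mkOG (HH p u) (HH_orth p u)

lemma dot_pos {N : ℕ} {u : Fin N → ℝ} (hu : u ≠ 0) : 0 < u ⬝ᵥ u := by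
  have := (dotProduct_self_star_pos_iff (v := u)).2 hu
  simpa using this

lemma nrm_sq {N : ℕ} (u : Fin N → ℝ) : nrm u ^ 2 = u ⬝ᵥ u := by
  unfold nrm
  rw [Real.sq_sqrt]
  simpa using (dotProduct_self_star_nonneg u)

lemma nrm_pos {N : ℕ} {u : Fin N → ℝ} (hu : u ≠ 0) : 0 < nrm u := Real.sqrt_pos.2 (dot_pos hu)

lemma HH_row {N : ℕ} (p : Fin N) {u : Fin N → ℝ} (hu : u ≠ 0) (i : Fin N) : HH p u p i = u i / nrm u := by
  have hn := nrm_pos hu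
  have hs := nrm_sq u
  have hzz : hz p u ⬝ᵥ hz p u = 2 * (1 - u p / nrm u) := by
    have : hz p u ⬝ᵥ hz p u = ∑ i, ((if i = p then 1 else 0) - 2 * (if i = p then u p / nrm u else 0)) + (u ⬝ᵥ u) / nrm u ^ 2 := by
      unfold dotProduct
      rw [Finset.sum_div, ← Finset.sum_add_distrib]
      refine Finset.sum_congr rfl fun i _ => ?_
      unfold hz
      split_ifs with h
      · subst h; field_simp; ring
      · field_simp; ring
    rw [this, ← hs, div_self (by positivity), Finset.sum_sub_distrib, ← Finset.mul_sum]
    simp; ring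
  have hrow : HH p u p i = (if p = i then 1 else 0) - 2 / (hz p u ⬝ᵥ hz p u) * (hz p u p * hz p u i) := by
    simp [HH, Matrix.one_apply, vecMulVec_apply]
  rw [hrow]
  by_cases h0 : hz p u ⬝ᵥ hz p u = 0
  · have hz0 : hz p u = 0 := by
      by_contra hne
      exact (dot_pos hne).ne' h0
    have := congrFun hz0 i
    simp only [hz, Pi.zero_apply] at this
    rw [h0]; simp only [div_zero, zero_mul, sub_zero]
    simp only [eq_comm (a := p)]
    linarith
  · have hp : hz p u p = 1 - u p / nrm u := by simp [hz]
    rw [hzz] at h0 ⊢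
    rw [hp]
    have : 2 / (2 * (1 - u p / nrm u)) * ((1 - u p / nrm u) * hz p u i) = hz p u i := by
      have : (1 - u p / nrm u) ≠ 0 := fun h => h0 (by rw [h]; ring)
      generalize 1 - u p / nrm u = y at *
      field_simp
    rw [this]
    simp only [hz, eq_comm (a := p)]; ring

lemma measurable_HH {N : ℕ} (p : Fin N) : Measurable fun u : Fin N → ℝ => HH p u := by
  have hd : ∀ f : (Fin N → ℝ) → Fin N → ℝ, (∀ i, Measurable fun u => f u i) → Measurable fun u => f u ⬝ᵥ f u :=
    fun f hf => Finset.measurable_sum _ fun i _ => (hf i).mul (hf i)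
  have hn : Measurable fun u : Fin N → ℝ => nrm u := (hd id fun i => measurable_pi_apply i).sqrt
  have hz' : ∀ i, Measurable fun u : Fin N → ℝ => hz p u i := fun i =>
    measurable_const.sub ((measurable_pi_apply i).div hn)
  refine measurable_pi_lambda _ fun i => measurable_pi_lambda _ fun j => ?_
  have : (fun u : Fin N → ℝ => HH p u i j) = fun u => (1 : Matrix (Fin N) (Fin N) ℝ) i j - 2 / (hz p u ⬝ᵥ hz p u) * (hz p u i * hz p u j) := by
    funext u; simp [HH, vecMulVec_apply]
  rw [this]
  exact measurable_const.sub ((measurable_const.div (hd _ hz')).mul ((hz' i).mul (hz' j)))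

/-- orthogonal invariance of Lebesgue -/
lemma og_det_abs {N : ℕ} (k : OG N) : |k.1.det| = 1 := by
  have := og_det_sq k
  rcases mul_self_eq_one_iff.1 this with h | h <;> simp [h]

lemma og_mp {N : ℕ} (k : OG N) : MeasurePreserving (fun u : Fin N → ℝ => k.1 *ᵥ u) volume volume := by
  constructor
  · exact (Continuous.matrix_mulVec continuous_const continuous_id).measurable
  · have h0 : k.1.det ≠ 0 := fun h => by have := og_det_abs k; simp [h] at this
    have := Real.map_matrix_volume_pi_eq_smul_volume_pi h0
    rw [abs_inv, og_det_abs k] at this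
    simp only [ENNReal.ofReal_one, one_smul, inv_one] at this
    exact this

lemma og_int {N : ℕ} (k : OG N) (f : (Fin N → ℝ) → ℝ) : ∫ u, f (k.1 *ᵥ u) = ∫ u, f u := by
  refine (og_mp k).integral_comp ?_ f
  refine (Homeomorph.measurableEmbedding (⟨⟨fun u => k.1 *ᵥ u, fun u => k.1ᵀ *ᵥ u, fun u => ?_, fun u => ?_⟩, ?_, ?_⟩ : (Fin N → ℝ) ≃ₜ (Fin N → ℝ)))
  · simp [og_tr_mul]
  · simp [og_mul_tr]
  · exact Continuous.matrix_mulVec continuous_const continuous_id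
  · exact Continuous.matrix_mulVec continuous_const continuous_id

lemma nrm_og {N : ℕ} (k : OG N) (u : Fin N → ℝ) : nrm (k.1 *ᵥ u) = nrm u := by
  unfold nrm
  rw [dotProduct_mulVec, vecMul_mulVec, og_tr_mul]; simp

def gam {N : ℕ} (u : Fin N → ℝ) : ℝ := Real.exp (-(Real.pi * (u ⬝ᵥ u)))

lemma gam_prod {N : ℕ} (u : Fin N → ℝ) : gam u = ∏ i, Real.exp (-Real.pi * (u i)^2) := by
  unfold gam dotProduct
  rw [← Real.exp_sum, ← Finset.mul_sum]
  congr 1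
  rw [neg_mul]; simp only [pow_two]

lemma gam_integrable (N : ℕ) : Integrable (gam : (Fin N → ℝ) → ℝ) := by
  have : (gam : (Fin N → ℝ) → ℝ) = fun u => ∏ i, Real.exp (-Real.pi * (u i)^2) := funext gam_prod
  rw [this]
  exact Integrable.fintype_prod (f := fun _ (x : ℝ) => Real.exp (-Real.pi * x^2)) fun i => integrable_exp_neg_mul_sq Real.pi_pos

lemma gam_integral (N : ℕ) : ∫ u : Fin N → ℝ, gam u = 1 := by
  have : (gam : (Fin N → ℝ) → ℝ) = fun u => ∏ i, Real.exp (-Real.pi * (u i)^2) := funext gam_prod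
  rw [this, integral_fintype_prod_volume_eq_prod (fun _ (x : ℝ) => Real.exp (-Real.pi * x^2))]
  simp only [integral_gaussian, div_self Real.pi_pos.ne', Real.sqrt_one, Finset.prod_const_one]

/-- averaging over the orthogonal group via a Gaussian vector -/
lemma haar_gauss {N : ℕ} (f : Matrix (Fin (N+1)) (Fin (N+1)) ℝ → ℝ) (hf : Continuous f)
    (hrow : ∀ k k' : OG (N+1), (∀ i, k.1 (Fin.last N) i = k'.1 (Fin.last N) i) → f k.1 = f k'.1) :
    ∫ k : OG (N+1), f k.1 ∂hm (N+1) = ∫ u : Fin (N+1) → ℝ, gam u * f (HH (Fin.last N) u) := by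
  obtain ⟨B, hB⟩ : ∃ B, ∀ k : OG (N+1), |f k.1| ≤ B := by
    have : Continuous fun k : OG (N+1) => |f k.1| := (hf.comp continuous_subtype_val).abs
    obtain ⟨B, hB⟩ := (isCompact_range this).bddAbove
    exact ⟨B, fun k => hB ⟨k, rfl⟩⟩
  set p := Fin.last N
  have hmeas : Measurable fun q : OG (N+1) × (Fin (N+1) → ℝ) => gam q.2 * f (HH p q.2 * q.1.1) := by
    have h1 : Measurable fun q : OG (N+1) × (Fin (N+1) → ℝ) => HH p q.2 := (measurable_HH p).comp measurable_snd
    have h2 : Measurable fun q : OG (N+1) × (Fin (N+1) → ℝ) => q.1.1 := measurable_subtype_coe.comp measurable_fst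
    have h3 : Measurable fun q : OG (N+1) × (Fin (N+1) → ℝ) => HH p q.2 * q.1.1 := by
      have hc : Continuous fun q : Matrix (Fin (N+1)) (Fin (N+1)) ℝ × Matrix (Fin (N+1)) (Fin (N+1)) ℝ => q.1 * q.2 :=
        continuous_fst.matrix_mul continuous_snd
      exact hc.measurable.comp (h1.prodMk h2)
    have h4 : Measurable fun q : OG (N+1) × (Fin (N+1) → ℝ) => gam q.2 := by
      have : Continuous (gam : (Fin (N+1) → ℝ) → ℝ) := by unfold gam dotProduct; fun_prop
      exact this.measurable.comp measurable_snd
    exact h4.mul (hf.measurable.comp h3)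
  have hint : Integrable (fun q : OG (N+1) × (Fin (N+1) → ℝ) => gam q.2 * f (HH p q.2 * q.1.1)) ((hm (N+1)).prod volume) := by
    have hg : Integrable (fun q : OG (N+1) × (Fin (N+1) → ℝ) => gam q.2 * B) ((hm (N+1)).prod volume) := by
      have := Integrable.mul_prod (μ := hm (N+1)) (ν := (volume : Measure (Fin (N+1) → ℝ))) (f := fun _ => B) (integrable_const B) (gam_integrable (N+1))
      simpa [mul_comm] using this
    refine hg.mono' hmeas.aestronglyMeasurable (Filter.Eventually.of_forall fun q => ?_)
    rw [Real.norm_eq_abs, abs_mul, abs_of_pos (show 0 < gam q.2 from Real.exp_pos _)]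
    refine mul_le_mul_of_nonneg_left ?_ (Real.exp_pos _).le
    exact hB (HG p q.2 * q.1)
  have hsw := integral_integral_swap (f := fun (k : OG (N+1)) (u : Fin (N+1) → ℝ) => gam u * f (HH p u * k.1)) hint
  have hL : ∀ k : OG (N+1), ∫ u : Fin (N+1) → ℝ, gam u * f (HH p u * k.1) = ∫ u : Fin (N+1) → ℝ, gam u * f (HH p u) := by
    intro k
    rw [← og_int k⁻¹ (fun u => gam u * f (HH p u))]
    have h0 : ∀ᵐ u : Fin (N+1) → ℝ, u ≠ 0 := by simp [ae_iff]
    refine integral_congr_ae (h0.mono fun u hu => ?_)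
    dsimp only
    have hg : gam ((k⁻¹).1 *ᵥ u) = gam u := by
      unfold gam
      rw [← nrm_sq, nrm_og, nrm_sq]
    have hu' : (k⁻¹).1 *ᵥ u ≠ 0 := fun h => by
      have := nrm_og k⁻¹ u
      rw [h] at this
      have h2 := nrm_pos hu
      rw [← this] at h2
      simp [nrm] at h2
    rw [hg]
    congr 1
    refine hrow (HG p u * k) (HG p ((k⁻¹).1 *ᵥ u)) fun i => ?_
    change (HH p u * k.1) p i = HH p _ p i
    rw [HH_row p hu', nrm_og, og_inv_coe, Matrix.mul_apply, mulVec, dotProduct, Finset.sum_div]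
    refine Finset.sum_congr rfl fun j _ => ?_
    rw [HH_row p hu, transpose_apply]; ring
  have hR : ∀ u : Fin (N+1) → ℝ, ∫ k : OG (N+1), gam u * f (HH p u * k.1) ∂hm (N+1) = gam u * ∫ k : OG (N+1), f k.1 ∂hm (N+1) := by
    intro u
    rw [integral_const_mul, ← hm_left (fun k : OG (N+1) => f k.1) (HG p u)]
    rfl
  simp only [hL, hR] at hsw
  rw [integral_const, integral_mul_const, gam_integral] at hsw
  simpa using hsw.symm
end

section
lemma mp_of_lintegral {α β : Type*} [MeasurableSpace α] [MeasurableSpace β] {μ : Measure α} {ν : Measure β}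
    {T : α → β} (hT : Measurable T) (h : ∀ f : β → ENNReal, Measurable f → ∫⁻ a, f (T a) ∂μ = ∫⁻ b, f b ∂ν) :
    MeasurePreserving T μ ν := by
  refine ⟨hT, Measure.ext_of_lintegral _ fun f hf => ?_⟩
  rw [lintegral_map hf hT, h f hf]

lemma sq_image_Ioi : (fun s : ℝ => Real.pi * s ^ 2) '' Set.Ioi 0 = Set.Ioi 0 := by
  ext w
  simp only [Set.mem_image, Set.mem_Ioi]
  constructor
  · rintro ⟨s, hs, rfl⟩; positivity
  · intro hw
    refine ⟨Real.sqrt (w / Real.pi), Real.sqrt_pos.2 (by positivity), ?_⟩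
    rw [Real.sq_sqrt (by positivity)]; field_simp

lemma sq_image_Iio : (fun s : ℝ => Real.pi * s ^ 2) '' Set.Iio 0 = Set.Ioi 0 := by
  rw [← sq_image_Ioi]
  ext w
  simp only [Set.mem_image, Set.mem_Ioi, Set.mem_Iio]
  constructor
  · rintro ⟨s, hs, rfl⟩; exact ⟨-s, by linarith, by ring⟩
  · rintro ⟨s, hs, rfl⟩; exact ⟨-s, by linarith, by ring⟩

lemma sq_deriv (S : Set ℝ) (x : ℝ) : HasDerivWithinAt (fun s : ℝ => Real.pi * s ^ 2) (2 * Real.pi * x) S x := by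
  have := ((hasDerivAt_pow 2 x).const_mul Real.pi).hasDerivWithinAt (s := S)
  convert! this using 1; simp; ring

lemma sq_inj_Ioi : Set.InjOn (fun s : ℝ => Real.pi * s ^ 2) (Set.Ioi 0) := by
  intro x hx y hy h
  have hx : 0 < x := hx
  have hy : 0 < y := hy
  have := mul_left_cancel₀ Real.pi_pos.ne' h
  exact (pow_left_inj₀ hx.le hy.le two_ne_zero).1 this

lemma sq_inj_Iio : Set.InjOn (fun s : ℝ => Real.pi * s ^ 2) (Set.Iio 0) := by
  intro x hx y hy h
  have hx : x < 0 := hx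
  have hy : y < 0 := hy
  have := @sq_inj_Ioi (-x) (by simpa using hx) (-y) (by simpa using hy) (by simpa using h)
  linarith

lemma law1 : MeasurePreserving (fun s : ℝ => Real.pi * s ^ 2) volume
    ((volume.restrict (Set.Ioi (0:ℝ))).withDensity fun w => ENNReal.ofReal ((Real.sqrt Real.pi)⁻¹ * w ^ (-(1/2) : ℝ))) := by
  have hdm : Measurable fun w : ℝ => ENNReal.ofReal ((Real.sqrt Real.pi)⁻¹ * w ^ (-(1/2) : ℝ)) := by fun_prop
  refine mp_of_lintegral (by fun_prop) fun f hf => ?_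
  rw [lintegral_withDensity_eq_lintegral_mul _ hdm hf]
  set g : ℝ → ENNReal := fun w => ENNReal.ofReal ((2 * Real.sqrt Real.pi)⁻¹ * w ^ (-(1/2) : ℝ)) * f w with hg
  have hgm : Measurable g := by fun_prop
  have key : ∀ s : ℝ, s ≠ 0 → ENNReal.ofReal |2 * Real.pi * s| * g (Real.pi * s ^ 2) = f (Real.pi * s ^ 2) := by
    intro s hs
    rw [hg]; dsimp only
    rw [← mul_assoc, ← ENNReal.ofReal_mul (abs_nonneg _)]
    have : |2 * Real.pi * s| * ((2 * Real.sqrt Real.pi)⁻¹ * (Real.pi * s ^ 2) ^ (-(1/2) : ℝ)) = 1 := by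
      have hp := Real.pi_pos
      have hs' := abs_pos.2 hs
      rw [Real.rpow_neg (by positivity), ← Real.sqrt_eq_rpow, Real.sqrt_mul hp.le, Real.sqrt_sq_eq_abs,
        abs_mul, abs_of_pos (by positivity : (0:ℝ) < 2 * Real.pi)]
      have := Real.mul_self_sqrt hp.le
      field_simp
      rw [pow_two, this]
    rw [this]; simp
  have h1 := lintegral_image_eq_lintegral_abs_deriv_mul measurableSet_Ioi (fun x _ => sq_deriv _ x) sq_inj_Ioi g
  have h2 := lintegral_image_eq_lintegral_abs_deriv_mul measurableSet_Iio (fun x _ => sq_deriv _ x) sq_inj_Iio g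
  rw [sq_image_Ioi, setLIntegral_congr_fun measurableSet_Ioi (fun s (hs : (0:ℝ) < s) => key s hs.ne')] at h1
  rw [sq_image_Iio, setLIntegral_congr_fun measurableSet_Iio (fun s (hs : s < (0:ℝ)) => key s hs.ne)] at h2
  rw [← lintegral_add_compl (fun a => f (Real.pi * a ^ 2)) (measurableSet_Ioi (a := (0:ℝ))), Set.compl_Ioi,
    setLIntegral_congr Iio_ae_eq_Iic.symm, ← h1, ← h2, ← lintegral_add_left hgm]
  refine lintegral_congr fun w => ?_
  rw [hg]; simp only [Pi.mul_apply]
  rw [← add_mul]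
  congr 1
  rw [mul_inv, mul_assoc, ENNReal.ofReal_mul (p := 2⁻¹) (by positivity), ← add_mul, ← ENNReal.ofReal_add (by positivity) (by positivity)]
  norm_num

lemma law2 : MeasurePreserving (fun u : Fin 2 → ℝ => Real.pi * (u 0 ^ 2 + u 1 ^ 2)) volume (volume.restrict (Set.Ioi (0:ℝ))) := by
  have hT : MeasurePreserving (fun p : ℝ × ℝ => Real.pi * (p.1 ^ 2 + p.2 ^ 2)) volume (volume.restrict (Set.Ioi (0:ℝ))) := by
    refine mp_of_lintegral (by fun_prop) fun f hf => ?_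
    rw [← lintegral_comp_polarCoord_symm]
    have hf' : Measurable fun a : ℝ => f (Real.pi * a ^ 2) := hf.comp (by fun_prop)
    have e : ∀ p : ℝ × ℝ, ENNReal.ofReal p.1 • f (Real.pi * ((polarCoord.symm p).1 ^ 2 + (polarCoord.symm p).2 ^ 2)) =
        (ENNReal.ofReal p.1 * f (Real.pi * p.1 ^ 2)) * 1 := by
      intro p
      simp only [polarCoord_symm_apply, smul_eq_mul, mul_one]
      congr 2
      have := Real.sin_sq_add_cos_sq p.2
      linear_combination Real.pi * p.1 ^ 2 * this
    simp only [e]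
    change ∫⁻ p in Set.Ioi (0:ℝ) ×ˢ Set.Ioo (-Real.pi) Real.pi, _ = _
    rw [Measure.volume_eq_prod, ← Measure.prod_restrict,
      lintegral_prod_mul (f := fun a : ℝ => ENNReal.ofReal a * f (Real.pi * a ^ 2)) (g := fun _ : ℝ => (1:ENNReal)) (by fun_prop) (by fun_prop)]
    have h1 := lintegral_image_eq_lintegral_abs_deriv_mul measurableSet_Ioi (fun x _ => sq_deriv _ x) sq_inj_Ioi f
    rw [sq_image_Ioi] at h1
    rw [h1]
    simp only [lintegral_one, Measure.restrict_apply MeasurableSet.univ, Set.univ_inter, Real.volume_Ioo]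
    rw [← lintegral_mul_const _ (by fun_prop)]
    refine setLIntegral_congr_fun measurableSet_Ioi fun s (hs : 0 < s) => ?_
    rw [abs_of_pos (by have := Real.pi_pos; positivity), mul_right_comm, ← ENNReal.ofReal_mul hs.le]
    congr 2; ring
  exact hT.comp (volume_preserving_finTwoArrow ℝ)

lemma mp_uncurry (m : ℕ) : MeasurePreserving
    (fun (u : Fin (2 * m) → ℝ) (j : Fin m) (c : Fin 2) => u ⟨2 * j.1 + c.1, by omega⟩) volume volume := by
  have hmeas : Measurable (fun (u : Fin m → Fin 2 → ℝ) (i : Fin (2 * m)) => u ⟨i.1 / 2, by omega⟩ ⟨i.1 % 2, by omega⟩) := by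
    fun_prop
  have h1 : Measure.map (fun (u : Fin m → Fin 2 → ℝ) (i : Fin (2 * m)) => u ⟨i.1 / 2, by omega⟩ ⟨i.1 % 2, by omega⟩) volume = volume := by
    symm
    refine Measure.pi_eq fun s hs => ?_
    rw [Measure.map_apply hmeas (MeasurableSet.univ_pi hs)]
    have : (fun (u : Fin m → Fin 2 → ℝ) (i : Fin (2 * m)) => u ⟨i.1 / 2, by omega⟩ ⟨i.1 % 2, by omega⟩) ⁻¹' (Set.univ.pi s) =
        Set.univ.pi fun j : Fin m => Set.univ.pi fun c : Fin 2 => s ⟨2 * j.1 + c.1, by omega⟩ := by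
      ext u
      simp only [Set.mem_preimage, Set.mem_univ_pi]
      constructor
      · intro h j c
        have := h ⟨2 * j.1 + c.1, by omega⟩
        convert this using 2
        · congr 1; ext; simp; omega
        · ext; simp; omega
      · intro h i
        have := h ⟨i.1 / 2, by omega⟩ ⟨i.1 % 2, by omega⟩
        convert this using 2
        ext; simp; omega
    rw [this, volume_pi_pi]
    simp only [volume_pi_pi]
    rw [← Fintype.prod_prod_type' (f := fun (j : Fin m) (c : Fin 2) => volume (s ⟨2 * j.1 + c.1, by omega⟩))]
    refine Fintype.prod_equiv (finProdFinEquiv.trans (finCongr (by ring))) _ _ fun p => ?_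
    congr 2; apply Fin.ext; simp; ring
  have h2 : MeasurePreserving (fun (u : Fin m → Fin 2 → ℝ) (i : Fin (2 * m)) => u ⟨i.1 / 2, by omega⟩ ⟨i.1 % 2, by omega⟩) volume volume := ⟨hmeas, h1⟩
  let E : (Fin m → Fin 2 → ℝ) ≃ᵐ (Fin (2 * m) → ℝ) :=
    { toFun := fun u i => u ⟨i.1 / 2, by omega⟩ ⟨i.1 % 2, by omega⟩
      invFun := fun u j c => u ⟨2 * j.1 + c.1, by omega⟩
      left_inv := fun u => by
        funext j c
        have e1 : (⟨(2 * j.1 + c.1) / 2, by omega⟩ : Fin m) = j := Fin.ext (by simp; omega)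
        have e2 : (⟨(2 * j.1 + c.1) % 2, by omega⟩ : Fin 2) = c := Fin.ext (by simp; omega)
        change u ⟨(2 * j.1 + c.1) / 2, _⟩ ⟨(2 * j.1 + c.1) % 2, _⟩ = u j c
        rw [e1, e2]
      right_inv := fun u => by
        funext i
        dsimp only
        congr 1; apply Fin.ext; simp; omega
      measurable_toFun := hmeas
      measurable_invFun := by
        change Measurable (fun (u : Fin (2 * m) → ℝ) (j : Fin m) (c : Fin 2) => u ⟨2 * j.1 + c.1, by omega⟩)
        fun_prop }
  exact MeasurePreserving.symm E h2

def WA (m : ℕ) (u : Fin (2 * m) → ℝ) (j : Fin m) : ℝ :=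
  Real.pi * (u ⟨2 * j.1, by omega⟩ ^ 2 + u ⟨2 * j.1 + 1, by omega⟩ ^ 2)

lemma pos_set (m : ℕ) : {w : Fin m → ℝ | ∀ j, 0 < w j} = Set.univ.pi fun _ => Set.Ioi 0 := by
  ext w; simp

lemma lawA (m : ℕ) : MeasurePreserving (WA m) volume (volume.restrict {w | ∀ j, 0 < w j}) := by
  rw [pos_set, volume_pi, volume_pi, Measure.restrict_pi_pi]
  exact (measurePreserving_pi (fun _ : Fin m => (volume : Measure (Fin 2 → ℝ))) (fun _ => (volume : Measure ℝ).restrict (Set.Ioi 0))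
    (f := fun _ u => Real.pi * (u 0 ^ 2 + u 1 ^ 2)) fun _ => law2).comp (mp_uncurry m)

def WB (m : ℕ) (u : Fin (2 * m + 1) → ℝ) : Fin (m + 1) → ℝ :=
  Fin.cons (Real.pi * u (Fin.last _) ^ 2) (WA m fun i => u i.castSucc)

lemma lawB (m : ℕ) : MeasurePreserving (WB m) volume ((volume.restrict {w | ∀ j, 0 < w j}).withDensity
    fun w => ENNReal.ofReal ((Real.sqrt Real.pi)⁻¹ * w 0 ^ (-(1/2) : ℝ))) := by
  have hdm : Measurable fun w : ℝ => ENNReal.ofReal ((Real.sqrt Real.pi)⁻¹ * w ^ (-(1/2) : ℝ)) := by fun_prop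
  have h1 := volume_preserving_piFinSuccAbove (fun _ : Fin (2 * m + 1) => ℝ) (Fin.last _)
  have h2 := law1.prod (lawA m)
  rw [prod_withDensity_left hdm, Measure.prod_restrict] at h2
  have h3 := (volume_preserving_piFinSuccAbove (fun _ : Fin (m + 1) => ℝ) 0).symm
  have h4 : MeasurePreserving (MeasurableEquiv.piFinSuccAbove (fun _ : Fin (m + 1) => ℝ) 0).symm
      (((volume.prod volume).restrict (Set.Ioi (0:ℝ) ×ˢ {w : Fin m → ℝ | ∀ j, 0 < w j})).withDensity fun z => ENNReal.ofReal ((Real.sqrt Real.pi)⁻¹ * z.1 ^ (-(1/2) : ℝ)))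
      ((volume.restrict {w | ∀ j, 0 < w j}).withDensity
        fun w => ENNReal.ofReal ((Real.sqrt Real.pi)⁻¹ * w 0 ^ (-(1/2) : ℝ))) := by
    refine mp_of_lintegral (MeasurableEquiv.measurable _) fun f hf => ?_
    have hS : MeasurableSet {w : Fin (m+1) → ℝ | ∀ j, 0 < w j} := by
      rw [pos_set]; exact MeasurableSet.univ_pi fun _ => measurableSet_Ioi
    have h5 := h3.restrict_preimage hS
    have hd2 : Measurable fun z : ℝ × (Fin m → ℝ) => ENNReal.ofReal ((Real.sqrt Real.pi)⁻¹ * z.1 ^ (-(1/2) : ℝ)) := by fun_prop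
    have hf2 : Measurable fun a => f ((MeasurableEquiv.piFinSuccAbove (fun _ : Fin (m + 1) => ℝ) 0).symm a) := hf.comp (MeasurableEquiv.measurable _)
    rw [lintegral_withDensity_eq_lintegral_mul _ hd2 hf2,
      lintegral_withDensity_eq_lintegral_mul _ (by fun_prop) hf,
      ← h5.lintegral_comp (by fun_prop)]
    have : (MeasurableEquiv.piFinSuccAbove (fun _ : Fin (m + 1) => ℝ) 0).symm ⁻¹' {w : Fin (m+1) → ℝ | ∀ j, 0 < w j} =
        Set.Ioi (0:ℝ) ×ˢ {w : Fin m → ℝ | ∀ j, 0 < w j} := by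
      ext ⟨x, w⟩
      simp [Fin.forall_fin_succ]
    rw [this]
    rfl
  have h6 := h4.comp (h2.comp h1)
  convert! h6 using 1
  funext u j
  refine Fin.cases ?_ (fun j => ?_) j
  · simp [WB]
  · simp [WB, WA, Fin.init]
end

section
def DnS (N : ℕ) {n : ℕ} (ξ : Fin n → ℝ) : Matrix (Fin N) (Fin N) ℝ :=
  Dn N (fun j => if h : j < n then Real.sqrt (ξ ⟨j, h⟩) else 0)

lemma det_DnS {N n : ℕ} (hn : N / 2 = n) {ξ : Fin n → ℝ} (hξ : ∀ j, 0 ≤ ξ j) (t : ℝ) :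
    (t • (1 : Matrix (Fin N) (Fin N) ℝ) + DnS N ξ).det = t ^ (N % 2) * ∏ j, (t ^ 2 + ξ j) := by
  unfold DnS
  rw [det_Dn, hn, Finset.prod_range]
  congr 1
  refine Finset.prod_congr rfl fun j _ => ?_
  rw [dif_pos j.isLt, Real.sq_sqrt (hξ _)]

lemma Dn_corner_anti {N : ℕ} (k : Matrix (Fin (N+1)) (Fin (N+1)) ℝ) (a : ℕ → ℝ) :
    ((k * Dn (N + 1) a * kᵀ).submatrix Fin.castSucc Fin.castSucc)ᵀ =
      - (k * Dn (N + 1) a * kᵀ).submatrix Fin.castSucc Fin.castSucc := by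
  rw [transpose_submatrix, transpose_mul, transpose_mul, transpose_transpose, Dn_tr]
  ext i j
  simp [Matrix.mul_assoc]

section
variable {N n : ℕ} (b : Fin (N+1) → Fin (n+1))

def bS (u : Fin (N+1) → ℝ) (j : Fin (n+1)) : ℝ := ∑ i with b i = j, u i ^ 2

lemma bS_sum (u : Fin (N+1) → ℝ) (c : Fin (n+1) → ℝ) : ∑ i, u i ^ 2 * c (b i) = ∑ j, bS b u j * c j := by
  unfold bS
  rw [← Finset.sum_fiberwise (s := Finset.univ) (g := b)]
  refine Finset.sum_congr rfl fun j _ => ?_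
  rw [Finset.sum_mul]
  refine Finset.sum_congr rfl fun i hi => ?_
  rw [(Finset.mem_filter.1 hi).2]

lemma corner_bS (a : ℕ → ℝ) (x : Fin (n+1) → ℝ) (hx : ∀ i : Fin (N+1), dd (N+1) a i = x (b i)) (k : OG (N+1)) (t : ℝ) (ht : 0 < t) :
    (t • (1 : Matrix (Fin N) (Fin N) ℝ) +
      (k.1 * Dn (N + 1) a * k.1ᵀ).submatrix Fin.castSucc Fin.castSucc).det =
    ((t • (1 : Matrix (Fin (N + 1)) (Fin (N + 1)) ℝ) + Dn (N + 1) a).det * t) *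
      ∑ j, bS b (k.1 (Fin.last N)) j / (t ^ 2 + x j) := by
  rw [corner_det k a t ht]
  simp only [hx, div_eq_mul_inv]
  rw [bS_sum b (k.1 (Fin.last N)) (fun j => (t ^ 2 + x j)⁻¹)]
  ring

lemma psi_bS (e : ℕ → ℕ) (a : ℕ → ℝ) (x : Fin (n+1) → ℝ) (hx : ∀ i : Fin (N+1), dd (N+1) a i = x (b i)) (k k' : OG (N+1))
    (h : ∀ j, bS b (k.1 (Fin.last N)) j = bS b (k'.1 (Fin.last N)) j) :
    psi e (Dn (N+1) a) k.1 = psi e (Dn (N+1) a) k'.1 := by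
  refine sph_of_det e _ _ (Dn_corner_anti _ _) (Dn_corner_anti _ _) fun t ht => ?_
  rw [corner_bS b a x hx k t ht, corner_bS b a x hx k' t ht]
  simp only [h]

lemma bS_nrm (u : Fin (N+1) → ℝ) : ∑ j, bS b u j = nrm u ^ 2 := by
  have := bS_sum b u (fun _ => 1)
  simp only [mul_one] at this
  rw [← this, nrm_sq, dotProduct]
  simp only [pow_two]

lemma bS_HH {u : Fin (N+1) → ℝ} (hu : u ≠ 0) (j : Fin (n+1)) :
    bS b (HH (Fin.last N) u (Fin.last N)) j = bS b u j / ∑ i, bS b u i := by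
  rw [bS_nrm]
  unfold bS
  rw [Finset.sum_div]
  refine Finset.sum_congr rfl fun i _ => ?_
  rw [HH_row _ hu, div_pow]

variable (s : Fin (n+1) → Fin (N+1))
def lft (w : Fin (n+1) → ℝ) (i : Fin (N+1)) : ℝ := if i = s (b i) then Real.sqrt (w (b i)) else 0

lemma bS_lft (hbs : ∀ j, b (s j) = j) {w : Fin (n+1) → ℝ} (hw : ∀ j, 0 ≤ w j) (j : Fin (n+1)) : bS b (lft b s w) j = w j := by
  unfold bS
  rw [Finset.sum_eq_single (s j)]
  · simp only [lft, hbs, if_true, Real.sq_sqrt (hw j)]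
  · intro i hi hne
    have := (Finset.mem_filter.1 hi).2
    subst this
    simp [lft, hne]
  · intro h; exact absurd (Finset.mem_filter.2 ⟨Finset.mem_univ (s j), hbs j⟩) h

lemma lft_ne (hbs : ∀ j, b (s j) = j) {w : Fin (n+1) → ℝ} (hw : ∀ j, 0 ≤ w j) (hs : 0 < ∑ j, w j) : lft b s w ≠ 0 := by
  intro h
  have h1 : ∑ j, bS b (lft b s w) j = ∑ j, w j := Finset.sum_congr rfl fun j _ => bS_lft b s hbs hw j
  rw [← h1, h] at hs
  simp [bS] at hs

lemma gauss_red (hbs : ∀ j, b (s j) = j) (e : ℕ → ℕ) (a : ℕ → ℝ) {x : Fin (n+1) → ℝ} (hx : ∀ i : Fin (N+1), dd (N+1) a i = x (b i))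
    (hxs : StrictMono x) (hx0 : 0 ≤ x 0) {θ K : ℝ} (hθ : -1 < θ) (hor : θ = 0 ∨ x 0 = 0) (hK : 0 ≤ K)
    {W : (Fin (N+1) → ℝ) → Fin (n+1) → ℝ} (hW : ∀ u j, W u j = Real.pi * bS b u j)
    (law : MeasurePreserving W volume ((volume.restrict {w | ∀ j, 0 < w j}).withDensity
      fun w => ENNReal.ofReal (K * w 0 ^ θ)))
    (hdet : ∀ t : ℝ, 0 < t → (t • (1 : Matrix (Fin (N + 1)) (Fin (N + 1)) ℝ) + Dn (N + 1) a).det * t =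
      t ^ (N % 2) * ∏ j, (t ^ 2 + x j)) (hn : N / 2 = n) (l : Fin n → ℕ) (C : ℝ)
    (hC : ∀ ξ : Fin n → ℝ, (∀ j, 0 < ξ j) → StrictMono ξ →
      sph e (DnS N ξ) * vdm ξ = C * (Matrix.of fun j k : Fin n => ξ j ^ l k).det) :
    sph e (Dn (N+1) a) * vdm x = (Dn (N+1) a).det ^ e N * K * (C * Real.Gamma (n + θ + 1) * (∏ k : Fin n, x k.succ ^ (-θ)) *
        (Matrix.of fun j k : Fin n =>
        (x j.succ ^ (l k + θ + 1) - x j.castSucc ^ (l k + θ + 1)) / (l k + θ + 1)).det) := by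
  set p := Fin.last N
  set D := Dn (N+1) a
  set h : (Fin (n+1) → ℝ) → ℝ := fun w => psi e D (HH p (lft b s w)) with hh
  have hmeas : Measurable h := by
    refine (continuous_psi e D).measurable.comp ((measurable_HH p).comp ?_)
    refine measurable_pi_lambda _ fun i => ?_
    unfold lft
    split_ifs
    · exact (measurable_pi_apply _).sqrt
    · exact measurable_const
  have hint := interlace hxs hx0 hθ hor l h C (fun v hv => by
    have hw := fun j => (Phi_pos hxs hv j).le
    have hξ := dom_mono hxs hv
    have hξ0 : ∀ k : Fin n, 0 < v k.succ := fun k => by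
      have h1 := (hv.2 k).1
      have h2 : x 0 ≤ x k.castSucc := hxs.monotone (Fin.zero_le _)
      linarith
    rw [← hC _ hξ0 hξ]
    congr 1
    have hs : 0 < ∑ j, Phi x v j := by rw [Phi_sum hxs]; exact hv.1
    refine sph_of_det e _ _ (Dn_corner_anti _ _) (Dn_tr _ _) fun t ht => ?_
    change _ = (t • (1 : Matrix (Fin N) (Fin N) ℝ) + DnS N (fun k : Fin n => v k.succ)).det
    rw [det_DnS hn (fun k => (hξ0 k).le)]
    have := corner_bS b a x hx (HG p (lft b s (Phi x v))) t ht
    refine this.trans ?_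
    rw [hdet t ht, mul_assoc]
    congr 1
    have h1 : ∀ j, bS b ((HG p (lft b s (Phi x v))).1 (Fin.last N)) j = Phi x v j / v 0 := fun j => by
      change bS b (HH p (lft b s (Phi x v)) p) j = _
      rw [bS_HH b (lft_ne b s hbs hw hs), bS_lft b s hbs hw]
      simp only [bS_lft b s hbs hw, Phi_sum hxs]
    simp only [h1]
    have h2 := congrArg (Polynomial.eval (-t^2)) (wP_Phi hxs v)
    rw [wP, Polynomial.eval_finsetSum] at h2
    simp only [Polynomial.eval_mul, Polynomial.eval_C, nodeP_eval] at h2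
    have e1 : ∀ z : Fin n → ℝ, ∏ k, (-t^2 - z k) = (-1)^n * ∏ k, (t^2 + z k) := by
      intro z
      rw [show ((-1:ℝ))^n = ∏ k : Fin n, (-1:ℝ) by simp, ← Finset.prod_mul_distrib]
      exact Finset.prod_congr rfl fun k _ => by ring
    simp only [e1] at h2
    have hv0 := hv.1
    have hxp : ∀ j, t^2 + x j ≠ 0 := fun j => by
      have h2 : x 0 ≤ x j := hxs.monotone (Fin.zero_le _)
      have : 0 < t^2 + x j := by have := sq_pos_of_pos ht; linarith
      exact this.ne'
    rw [Finset.mul_sum]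
    have h3 : ∀ j, (∏ j, (t ^ 2 + x j)) * (Phi x v j / v 0 / (t ^ 2 + x j)) =
        (v 0)⁻¹ * (-1)^n * (Phi x v j * ((-1)^n * ∏ k : Fin n, (t^2 + x (j.succAbove k)))) := by
      intro j
      rw [Fin.prod_univ_succAbove _ j]
      have h4 : ((-1:ℝ)^n) * (-1)^n = 1 := by rw [← mul_pow]; simp
      have := hxp j
      field_simp
      linear_combination (- Phi x v j * ∏ k : Fin n, (t^2 + x (j.succAbove k))) * h4
    simp only [h3]
    rw [← Finset.mul_sum, h2]
    have h4 : ((-1:ℝ)^n) * (-1)^n = 1 := by rw [← mul_pow]; simp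
    field_simp
    linear_combination (∏ k : Fin n, (t^2 + v k.succ)) * h4)
  rw [← hint, sph_succ, haar_gauss (psi e D) (continuous_psi e D) (fun k k' hkk => psi_bS b e a x hx k k' fun j => by
    rw [show k.1 (Fin.last N) = k'.1 (Fin.last N) from funext hkk])]
  have hae : ∀ᵐ u : Fin (N+1) → ℝ, gam u * psi e D (HH p u) = h (W u) * Real.exp (-∑ j, W u j) := by
    have h0 : ∀ᵐ u : Fin (N+1) → ℝ, u ≠ 0 := by simp [ae_iff]
    refine h0.mono fun u hu => ?_
    have hWs : ∑ j, W u j = Real.pi * (u ⬝ᵥ u) := by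
      simp only [hW]
      rw [← Finset.mul_sum, bS_nrm, nrm_sq]
    have hWn : ∀ j, 0 ≤ W u j := fun j => by
      rw [hW]
      exact mul_nonneg Real.pi_pos.le (Finset.sum_nonneg fun i _ => sq_nonneg _)
    have hWp : 0 < ∑ j, W u j := by rw [hWs]; exact mul_pos Real.pi_pos (dot_pos hu)
    have hpsi : psi e D (HH p u) = h (W u) := ?_
    · rw [hpsi, hWs, mul_comm, gam]
    refine psi_bS b e a x hx (HG p u) (HG p (lft b s (W u))) fun j => ?_
    change bS b (HH p u p) j = bS b (HH p (lft b s (W u)) p) j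
    rw [bS_HH b hu, bS_HH b (lft_ne b s hbs hWn hWp), bS_lft b s hbs hWn]
    simp only [bS_lft b s hbs hWn]
    simp only [hW]
    rw [← Finset.mul_sum, mul_div_mul_left _ _ Real.pi_pos.ne']
  have hI := integral_map (μ := (volume : Measure (Fin (N+1) → ℝ))) law.measurable.aemeasurable
    (f := fun w => h w * Real.exp (-∑ j, w j)) (by
      have : Measurable fun w : Fin (n+1) → ℝ => h w * Real.exp (-∑ j, w j) := hmeas.mul (by fun_prop)
      exact this.aestronglyMeasurable)
  rw [law.map_eq] at hI
  rw [integral_congr_ae hae, ← hI]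
  rw [integral_withDensity_eq_integral_toReal_smul (by fun_prop) (by simp)]
  have hS : MeasurableSet {w : Fin (n+1) → ℝ | ∀ j, 0 < w j} := by
    rw [pos_set]; exact MeasurableSet.univ_pi fun _ => measurableSet_Ioi
  have key : (∫ w in {w : Fin (n+1) → ℝ | ∀ j, 0 < w j}, (ENNReal.ofReal (K * w 0 ^ θ)).toReal • (h w * Real.exp (-∑ j, w j))) =
      K * ∫ w in {w : Fin (n+1) → ℝ | ∀ j, 0 < w j}, h w * (w 0 ^ θ * Real.exp (-∑ j, w j)) := by
    rw [← integral_const_mul]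
    refine setIntegral_congr_fun hS fun w hw => ?_
    have hw0 : 0 < w 0 := hw 0
    rw [ENNReal.toReal_ofReal (by positivity), smul_eq_mul]; ring
  rw [key]; ring
end
end

section
def lE (e : ℕ → ℕ) : (n : ℕ) → Fin n → ℕ
  | 0 => Fin.elim0
  | n + 1 => Fin.cons (e (2 * n + 1)) (fun k => lE e n k + 1 + e (2 * n + 1))

lemma exists_e : ∀ (n : ℕ) (l : Fin n → ℕ), StrictMono l → ∃ e : ℕ → ℕ, (∀ j, e (2 * j) = 0) ∧ lE e n = l := by
  intro n
  induction n with
  | zero => intro l _; exact ⟨fun _ => 0, fun _ => rfl, Subsingleton.elim _ _⟩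
  | succ n ih =>
    intro l hl
    have hlt : ∀ k : Fin n, l 0 < l k.succ := fun k => hl (Fin.succ_pos k)
    obtain ⟨e, he, hle⟩ := ih (fun k => l k.succ - 1 - l 0) (fun i j hij => by
      have h1 := hl (Fin.succ_lt_succ_iff.2 hij)
      have := hlt i
      dsimp only; omega)
    have hcongr : ∀ m, ∀ e e' : ℕ → ℕ, (∀ j < 2 * m, e j = e' j) → lE e m = lE e' m := by
      intro m
      induction m with
      | zero => intros; exact Subsingleton.elim _ _
      | succ m ihm =>
        intro e e' h
        simp only [lE]
        rw [ihm e e' (fun j hj => h j (by omega)), h _ (by omega)]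
    refine ⟨Function.update e (2 * n + 1) (l 0), fun j => ?_, ?_⟩
    · rw [Function.update_of_ne (by omega)]; exact he j
    · funext k
      refine Fin.cases ?_ (fun k => ?_) k
      · simp [lE]
      · simp only [lE, Fin.cons_succ]
        rw [hcongr n _ e (fun j hj => Function.update_of_ne (by omega) _ _), hle]
        have := hlt k
        simp; omega

lemma det_scale_rows {n : ℕ} (c : Fin n → ℝ) (M : Fin n → Fin n → ℝ) :
    (Matrix.of fun j k => c j * M j k).det = (∏ j, c j) * (Matrix.of M).det := by
  have := Matrix.det_mul_column c (Matrix.of M)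
  simpa using this

lemma det_scale_cols {n : ℕ} (c : Fin n → ℝ) (M : Fin n → Fin n → ℝ) :
    (Matrix.of fun j k => M j k * c k).det = (∏ j, c j) * (Matrix.of M).det := by
  have := Matrix.det_mul_row c (Matrix.of M)
  simp only [Matrix.of_apply] at this
  rw [← this]
  congr 1; ext i j; simp [mul_comm]

def Pe (e : ℕ → ℕ) (N n : ℕ) (l : Fin n → ℕ) : Prop :=
  ∃ C : ℝ, C ≠ 0 ∧ ∀ ξ : Fin n → ℝ, (∀ j, 0 < ξ j) → StrictMono ξ →
      sph e (DnS N ξ) * vdm ξ = C * (Matrix.of fun j k : Fin n => ξ j ^ l k).det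

lemma step_odd (e : ℕ → ℕ) (n : ℕ) (l : Fin n → ℕ) (he : e (2 * n) = 0) (h : Pe e (2 * n) n l) : Pe e (2 * n + 1) n l := by
  obtain ⟨C, hC0, hC⟩ := h
  refine ⟨(Real.sqrt Real.pi)⁻¹ * C * Real.Gamma (n + (-(1/2)) + 1) * ∏ k, (l k + (-(1/2)) + 1 : ℝ)⁻¹, ?_, fun ξ hξ0 hξ => ?_⟩
  · have h1 : (0:ℝ) < n + (-(1/2)) + 1 := by have : (0:ℝ) ≤ n := Nat.cast_nonneg n; linarith
    have h2 := Real.Gamma_pos_of_pos h1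
    have h3 : ∏ k, (l k + (-(1/2)) + 1 : ℝ)⁻¹ ≠ 0 := Finset.prod_ne_zero_iff.2 fun k _ => by
      have : (0:ℝ) ≤ l k := Nat.cast_nonneg _
      have : (0:ℝ) < l k + (-(1/2)) + 1 := by linarith
      positivity
    have h4 := Real.sqrt_pos.2 Real.pi_pos
    have h5 := h2.ne'
    have h6 := (inv_pos.2 h4).ne'
    exact mul_ne_zero (mul_ne_zero (mul_ne_zero h6 hC0) h5) h3
  · let b : Fin (2 * n + 1) → Fin (n + 1) := fun i => if h : i.1 < 2 * n then ⟨i.1 / 2 + 1, by omega⟩ else 0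
    let s : Fin (n + 1) → Fin (2 * n + 1) := Fin.cons (Fin.last _) (fun k => ⟨2 * k.1, by omega⟩)
    have hbs : ∀ j, b (s j) = j := by
      intro j
      refine Fin.cases ?_ (fun k => ?_) j
      · simp [b, s]
      · simp only [b, s, Fin.cons_succ]
        rw [dif_pos (by omega)]
        ext; simp
    set a : ℕ → ℝ := fun j => if h : j < n then Real.sqrt (ξ ⟨j, h⟩) else 0 with ha
    have hx : ∀ i : Fin (2 * n + 1), dd (2 * n + 1) a i = (Fin.cons 0 ξ : Fin (n+1) → ℝ) (b i) := by
      intro i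
      unfold dd
      by_cases hi : i.1 < 2 * n
      · rw [if_pos (by omega)]
        simp only [b, ha, dif_pos hi]
        rw [dif_pos (by omega), Real.sq_sqrt (hξ0 _).le]
        exact (Fin.cons_succ (α := fun _ => ℝ) 0 ξ ⟨i.1 / 2, by omega⟩).symm
      · rw [if_neg (by omega)]
        simp only [b, dif_neg hi, Fin.cons_zero]
    have hxs : StrictMono (Fin.cons 0 ξ : Fin (n+1) → ℝ) := by
      intro i j hij
      induction j using Fin.cases with
      | zero => exact absurd hij (Fin.not_lt_zero _)
      | succ j =>
        induction i using Fin.cases with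
        | zero => simpa using hξ0 j
        | succ i => simpa using hξ (Fin.succ_lt_succ_iff.1 hij)
    have hW : ∀ u j, WB n u j = Real.pi * bS b u j := by
      intro u j
      refine Fin.cases ?_ (fun k => ?_) j
      · simp only [WB, Fin.cons_zero, bS]
        rw [Finset.sum_eq_single (Fin.last (2 * n))]
        · intro i hi hne
          exfalso
          have h1 := (Finset.mem_filter.1 hi).2
          have h2 : i.1 < 2 * n := by
            have := Fin.val_lt_last hne; simpa using this
          simp only [b, dif_pos h2] at h1
          have := congrArg Fin.val h1
          simp at this
        · intro h; exact absurd (Finset.mem_filter.2 ⟨Finset.mem_univ _, by simp [b]⟩) h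
      · simp only [WB, Fin.cons_succ, bS, WA]
        congr 1
        have : Finset.univ.filter (fun i => b i = k.succ) = {(⟨2 * k.1, by omega⟩ : Fin (2 * n + 1)), ⟨2 * k.1 + 1, by omega⟩} := by
          ext i
          simp only [Finset.mem_filter, Finset.mem_univ, true_and, Finset.mem_insert, Finset.mem_singleton, Fin.ext_iff, Fin.val_succ]
          by_cases hi : i.1 < 2 * n
          · simp only [b, dif_pos hi]; omega
          · simp only [b, dif_neg hi]; simp; omega
        rw [this, Finset.sum_pair (by simp [Fin.ext_iff])]
        rfl
    have hdet : ∀ t : ℝ, 0 < t → (t • (1 : Matrix (Fin (2 * n + 1)) (Fin (2 * n + 1)) ℝ) + Dn (2 * n + 1) a).det * t =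
        t ^ (2 * n % 2) * ∏ j, (t ^ 2 + (Fin.cons 0 ξ : Fin (n+1) → ℝ) j) := by
      intro t ht
      have := det_DnS (N := 2 * n + 1) (n := n) (by omega) (fun j => (hξ0 j).le) t
      rw [DnS] at this
      rw [this, Fin.prod_univ_succ]
      have e1 : (2 * n + 1) % 2 = 1 := by omega
      have e2 : (2 * n) % 2 = 0 := by omega
      rw [e1, e2]; simp; ring
    have key := gauss_red b s hbs e a hx hxs (by simp) (θ := -(1/2)) (by norm_num) (Or.inr (by simp)) (by positivity) hW (lawB n) hdet
      (by omega) l C hC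
    rw [he, pow_zero, one_mul] at key
    have hd : (Matrix.of fun j k : Fin n =>
        ((Fin.cons 0 ξ : Fin (n+1) → ℝ) j.succ ^ (l k + (-(1/2)) + 1 : ℝ) - (Fin.cons 0 ξ : Fin (n+1) → ℝ) j.castSucc ^ (l k + (-(1/2)) + 1 : ℝ)) / (l k + (-(1/2)) + 1 : ℝ)).det =
        (∏ k, (l k + (-(1/2)) + 1 : ℝ)⁻¹) * ((∏ j, ξ j ^ (1/2 : ℝ)) * (Matrix.of fun j k : Fin n => ξ j ^ l k).det) := by
      simp only [div_eq_mul_inv _ (_ + _ + (1:ℝ))]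
      rw [det_scale_cols (fun k => (l k + (-(1/2)) + 1 : ℝ)⁻¹),
        det_diff (fun j k => (Fin.cons 0 ξ : Fin (n+1) → ℝ) j ^ (l k + (-(1/2)) + 1 : ℝ))]
      congr 1
      rw [Matrix.det_succ_row_zero, Fin.sum_univ_succ, ← det_scale_rows]
      have hz : ∀ k : Fin n, (0:ℝ) ^ (l k + (-(1/2)) + 1 : ℝ) = 0 := fun k => by
        rw [Real.zero_rpow]
        have : (0:ℝ) ≤ l k := Nat.cast_nonneg _
        linarith
      simp only [of_apply, Fin.cons_zero, Fin.cons_succ, hz, mul_zero, zero_mul, Finset.sum_const_zero, add_zero]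
      simp only [Fin.val_zero, pow_zero, one_mul]
      congr 1
      ext j k
      simp only [submatrix_apply, of_apply, Fin.zero_succAbove, Fin.cons_succ]
      rw [← Real.rpow_natCast, ← Real.rpow_add (hξ0 j)]
      congr 1; ring
    rw [hd, vdm_cons] at key
    simp only [Fin.cons_succ, Fin.cons_zero, sub_zero, neg_neg] at key
    have hp : (∏ j, ξ j ^ (1/2 : ℝ)) * (∏ j, ξ j ^ (1/2 : ℝ)) = ∏ j, ξ j := by
      rw [← Finset.prod_mul_distrib]
      refine Finset.prod_congr rfl fun j _ => ?_
      rw [← Real.sqrt_eq_rpow, Real.mul_self_sqrt (hξ0 j).le]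
    have hne : ∏ j, ξ j ≠ 0 := Finset.prod_ne_zero_iff.2 fun j _ => (hξ0 j).ne'
    apply mul_left_cancel₀ hne
    rw [DnS, ← ha]
    rw [← hp] at key ⊢
    linear_combination key

lemma step_even (e : ℕ → ℕ) (n : ℕ) (l : Fin n → ℕ) (h : Pe e (2 * n + 1) n l) :
    Pe e (2 * (n + 1)) (n + 1) (Fin.cons (e (2 * n + 1)) (fun k => l k + 1 + e (2 * n + 1))) := by
  obtain ⟨C, hC0, hC⟩ := h
  refine ⟨C * Real.Gamma (n + 0 + 1) * ∏ k, (l k + 0 + 1 : ℝ)⁻¹, ?_, fun ξ hξ0 hξ => ?_⟩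
  · have h1 : (0:ℝ) < n + 0 + 1 := by have : (0:ℝ) ≤ n := Nat.cast_nonneg n; linarith
    have h2 := Real.Gamma_pos_of_pos h1
    have h3 : ∏ k, (l k + 0 + 1 : ℝ)⁻¹ ≠ 0 := Finset.prod_ne_zero_iff.2 fun k _ => by positivity
    exact mul_ne_zero (mul_ne_zero hC0 h2.ne') h3
  · let b : Fin (2 * n + 1 + 1) → Fin (n + 1) := fun i => ⟨i.1 / 2, by omega⟩
    let s : Fin (n + 1) → Fin (2 * n + 1 + 1) := fun k => ⟨2 * k.1, by omega⟩
    have hbs : ∀ j, b (s j) = j := by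
      intro j; ext; simp [b, s]
    set a : ℕ → ℝ := fun j => if h : j < n + 1 then Real.sqrt (ξ ⟨j, h⟩) else 0 with ha
    have hx : ∀ i : Fin (2 * n + 1 + 1), dd (2 * n + 1 + 1) a i = ξ (b i) := by
      intro i
      unfold dd
      rw [if_pos (by omega)]
      simp only [b, ha]
      rw [dif_pos (by omega), Real.sq_sqrt (hξ0 _).le]
    have hW : ∀ u j, WA (n+1) u j = Real.pi * bS b u j := by
      intro u k
      simp only [bS, WA]
      congr 1
      have : Finset.univ.filter (fun i => b i = k) = {(⟨2 * k.1, by omega⟩ : Fin (2 * n + 1 + 1)), ⟨2 * k.1 + 1, by omega⟩} := by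
        ext i
        simp only [Finset.mem_filter, Finset.mem_univ, true_and, Finset.mem_insert, Finset.mem_singleton, Fin.ext_iff, b]
        omega
      rw [this, Finset.sum_pair (by simp [Fin.ext_iff])]
    have hdet0 : ∀ t : ℝ, (t • (1 : Matrix (Fin (2 * n + 1 + 1)) (Fin (2 * n + 1 + 1)) ℝ) + Dn (2 * n + 1 + 1) a).det =
        ∏ j, (t ^ 2 + ξ j) := by
      intro t
      have := det_DnS (N := 2 * n + 1 + 1) (n := n + 1) (by omega) (fun j => (hξ0 j).le) t
      rw [DnS] at this
      rw [this]
      have e1 : (2 * n + 1 + 1) % 2 = 0 := by omega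
      rw [e1]; simp
    have hdet : ∀ t : ℝ, 0 < t → (t • (1 : Matrix (Fin (2 * n + 1 + 1)) (Fin (2 * n + 1 + 1)) ℝ) + Dn (2 * n + 1 + 1) a).det * t =
        t ^ ((2 * n + 1) % 2) * ∏ j, (t ^ 2 + ξ j) := by
      intro t ht
      have e1 : (2 * n + 1) % 2 = 1 := by omega
      rw [hdet0, e1]; ring
    have hlaw := lawA (n+1)
    have hlaw2 : MeasurePreserving (WA (n+1)) volume ((volume.restrict {w | ∀ j, 0 < w j}).withDensity
      fun w => ENNReal.ofReal (1 * w 0 ^ (0:ℝ))) := by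
      simpa using hlaw
    have key := gauss_red b s hbs e a hx hξ (hξ0 0).le (θ := 0) (by norm_num) (Or.inl rfl) zero_le_one hW hlaw2 hdet
      (by omega) l C hC
    have hD : (Dn (2 * n + 1 + 1) a).det = ∏ j, ξ j := by
      have := hdet0 0
      simpa using this
    have hd : (Matrix.of fun j k : Fin n =>
        (ξ j.succ ^ (l k + 0 + 1 : ℝ) - ξ j.castSucc ^ (l k + 0 + 1 : ℝ)) / (l k + 0 + 1 : ℝ)).det =
        (∏ k, (l k + 0 + 1 : ℝ)⁻¹) * (Matrix.of fun j : Fin (n + 1) => (Fin.cons 1 (fun k => ξ j ^ (l k + 0 + 1 : ℝ)) : Fin (n + 1) → ℝ)).det := by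
      simp only [div_eq_mul_inv]
      rw [det_scale_cols (fun k => (l k + 0 + 1 : ℝ)⁻¹),
        det_diff (fun j k => ξ j ^ (l k + 0 + 1 : ℝ))]
    rw [hd, hD, ← Finset.prod_pow] at key
    have hfin := det_scale_rows (fun j => ξ j ^ e (2 * n + 1)) (fun j : Fin (n + 1) => (Fin.cons 1 (fun k => ξ j ^ (l k + 0 + 1 : ℝ)) : Fin (n + 1) → ℝ))
    have hfin2 : (Matrix.of fun j k : Fin (n+1) => ξ j ^ (Fin.cons (e (2 * n + 1)) (fun k => l k + 1 + e (2 * n + 1)) : Fin (n+1) → ℕ) k) =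
        Matrix.of fun j k => ξ j ^ e (2 * n + 1) * (Fin.cons 1 (fun k => ξ j ^ (l k + 0 + 1 : ℝ)) : Fin (n + 1) → ℝ) k := by
      ext j k
      refine Fin.cases ?_ (fun k => ?_) k
      · simp
      · simp only [of_apply, Fin.cons_succ, add_zero]
        rw [pow_add, mul_comm]
        congr 1
        exact_mod_cast (Real.rpow_natCast (ξ j) (l k + 1)).symm
    rw [hfin2, hfin, DnS]
    refine Eq.trans key ?_
    simp only [neg_zero, Real.rpow_zero, Finset.prod_const_one]
    ring

lemma sph_zero (e : ℕ → ℕ) (X : Matrix (Fin 0) (Fin 0) ℝ) : sph e X = 1 := by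
  simp [sph, pw]

theorem sph_formula (e : ℕ → ℕ) (he : ∀ j, e (2 * j) = 0) (n : ℕ) : Pe e (2 * n) n (lE e n) := by
  induction n with
  | zero =>
    refine ⟨1, one_ne_zero, fun ξ _ _ => ?_⟩
    rw [sph_zero]
    simp [vdm_eq_det]
  | succ n ih => exact step_even e n _ (step_odd e n _ (he n) ih)
end

section
lemma lint_beta {α β : ℝ} (hα : 0 < α) (hβ : 0 < β) :
    ∫⁻ x in Set.Ioo (0:ℝ) 1, ENNReal.ofReal (x ^ (α - 1) * (1 - x) ^ (β - 1)) =
      ENNReal.ofReal (ProbabilityTheory.beta α β) := by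
  have h := ProbabilityTheory.lintegral_betaPDF_eq_one hα hβ
  have hb := ProbabilityTheory.beta_pos hα hβ
  rw [ProbabilityTheory.lintegral_betaPDF] at h
  have h2 : ∀ x : ℝ, ENNReal.ofReal (1 / ProbabilityTheory.beta α β * x ^ (α - 1) * (1 - x) ^ (β - 1)) =
      ENNReal.ofReal (1 / ProbabilityTheory.beta α β) * ENNReal.ofReal (x ^ (α - 1) * (1 - x) ^ (β - 1)) := by
    intro x
    rw [← ENNReal.ofReal_mul (by positivity), mul_assoc]
  simp_rw [h2] at h
  rw [lintegral_const_mul _ (by fun_prop)] at h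
  have h3 := congrArg (fun z => ENNReal.ofReal (ProbabilityTheory.beta α β) * z) h
  rw [← mul_assoc, ← ENNReal.ofReal_mul hb.le, mul_one_div_cancel hb.ne'] at h3
  simpa using h3

lemma radial0 {E : Type*} [NormedAddCommGroup E] [NormedSpace ℝ E] [MeasurableSpace E]
    [Nontrivial E] (μ : Measure E) [FiniteDimensional ℝ E] [BorelSpace E] [μ.IsAddHaarMeasure]
    (f : ℝ → ENNReal) (hf : Measurable f) :
    ∫⁻ x, f ‖x‖ ∂μ = μ.toSphere Set.univ * ∫⁻ y in Set.Ioi (0:ℝ), ENNReal.ofReal (y ^ (Module.finrank ℝ E - 1)) * f y := by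
  calc ∫⁻ x, f ‖x‖ ∂μ = ∫⁻ x : ({(0)}ᶜ : Set E), f (‖x.1‖) ∂(μ.comap (↑)) := by
        rw [lintegral_subtype_comap (measurableSet_singleton _).compl (fun x => f ‖x‖),
          restrict_compl_singleton]
    _ = ∫⁻ x, f x.2 ∂μ.toSphere.prod (.volumeIoiPow (Module.finrank ℝ E - 1)) := by
        simpa using μ.measurePreserving_homeomorphUnitSphereProd.lintegral_comp_emb
          (Homeomorph.measurableEmbedding _) (f ∘ Subtype.val ∘ Prod.snd)
    _ = _ := by
        rw [lintegral_prod _ (by fun_prop)]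
        simp only [lintegral_const]
        rw [mul_comm]
        congr 1
        rw [Measure.volumeIoiPow, lintegral_withDensity_eq_lintegral_mul _ (by fun_prop) (by fun_prop)]
        simp only [Pi.mul_apply]
        exact lintegral_subtype_comap measurableSet_Ioi (fun y => ENNReal.ofReal (y ^ (Module.finrank ℝ E - 1)) * f y)

lemma sq_cov (g : ℝ → ENNReal) :
    ∫⁻ w in Set.Ioi (0:ℝ), g w = ∫⁻ y in Set.Ioi (0:ℝ), ENNReal.ofReal (2 * y) * g (y ^ 2) := by
  have him : (fun s : ℝ => s ^ 2) '' Set.Ioi 0 = Set.Ioi 0 := by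
    ext w
    simp only [Set.mem_image, Set.mem_Ioi]
    exact ⟨fun ⟨s, hs, h⟩ => h ▸ by positivity, fun hw => ⟨√w, Real.sqrt_pos.2 hw, Real.sq_sqrt hw.le⟩⟩
  conv_lhs => rw [← him]
  rw [lintegral_image_eq_lintegral_abs_deriv_mul measurableSet_Ioi (f' := fun s => 2 * s)]
  · refine setLIntegral_congr_fun measurableSet_Ioi fun y hy => ?_
    rw [abs_of_pos (by have : 0 < y := hy; positivity)]
  · intro x _
    simpa using (hasDerivAt_pow 2 x).hasDerivWithinAt (s := Set.Ioi 0)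
  · intro x hx y hy h
    exact (pow_left_inj₀ (le_of_lt hx) (le_of_lt hy) two_ne_zero).1 h

lemma radial (d : ℕ) (hd : 0 < d) : ∃ c : ENNReal, c ≠ 0 ∧ c ≠ ⊤ ∧ ∀ f : ℝ → ENNReal, Measurable f →
    ∫⁻ x : Fin d → ℝ, f (x ⬝ᵥ x) = c * ∫⁻ w in Set.Ioi (0:ℝ), ENNReal.ofReal (w ^ ((d:ℝ) / 2 - 1)) * f w := by
  have : Nonempty (Fin d) := ⟨⟨0, hd⟩⟩
  let μ : Measure (EuclideanSpace ℝ (Fin d)) := volume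
  refine ⟨μ.toSphere Set.univ * ENNReal.ofReal (1 / 2), ?_, ?_, fun f hf => ?_⟩
  · refine mul_ne_zero ?_ (by simp)
    rw [Ne, Measure.measure_univ_eq_zero]
    exact μ.toSphere_ne_zero
  · exact ENNReal.mul_ne_top (measure_ne_top _ _) ENNReal.ofReal_ne_top
  · have h1 := (EuclideanSpace.volume_preserving_symm_measurableEquiv_toLp (Fin d)).symm
    have h2 := h1.lintegral_comp_emb (MeasurableEquiv.measurableEmbedding _) (fun x : EuclideanSpace ℝ (Fin d) => f (‖x‖ ^ 2))
    have h3 := radial0 μ (fun y => f (y ^ 2)) (by fun_prop)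
    have h4 : ∀ x : Fin d → ℝ, ‖(WithLp.toLp 2 x : EuclideanSpace ℝ (Fin d))‖ ^ 2 = x ⬝ᵥ x := by
      intro x
      rw [EuclideanSpace.norm_sq_eq]
      simp [dotProduct, sq]
    have h5 : ∫⁻ x : Fin d → ℝ, f (x ⬝ᵥ x) = ∫⁻ x : EuclideanSpace ℝ (Fin d), f (‖x‖ ^ 2) := by
      rw [← h2]
      refine lintegral_congr fun x => ?_
      rw [← h4 x]
      rfl
    rw [h5, h3, sq_cov (fun w => ENNReal.ofReal (w ^ ((d:ℝ) / 2 - 1)) * f w), mul_assoc, ← lintegral_const_mul' _ _ ENNReal.ofReal_ne_top]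
    congr 1
    refine setLIntegral_congr_fun measurableSet_Ioi fun y hy => ?_
    have hy' : 0 < y := hy
    simp only [← mul_assoc]
    rw [← ENNReal.ofReal_mul (by norm_num), ← ENNReal.ofReal_mul (by positivity)]
    congr 2
    rw [finrank_euclideanSpace_fin, ← Real.rpow_natCast y 2, ← Real.rpow_mul hy'.le, ← Real.rpow_natCast, Nat.cast_pred hd]
    have : ((2:ℕ):ℝ) * ((d:ℝ) / 2 - 1) = ((d:ℝ) - 1) - 1 := by push_cast; ring
    rw [this, Real.rpow_sub_one hy'.ne' ((d:ℝ) - 1)]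
    generalize y ^ ((d:ℝ) - 1) = z
    field_simp

def rad (d : ℕ) (s q : ℝ) : ENNReal :=
  ∫⁻ x : Fin d → ℝ, if x ⬝ᵥ x < 1 then ENNReal.ofReal ((x ⬝ᵥ x) ^ s * (1 - x ⬝ᵥ x) ^ q) else 0

lemma rad_beta (d : ℕ) (hd : 0 < d) : ∃ c : ENNReal, c ≠ 0 ∧ c ≠ ⊤ ∧ ∀ s q : ℝ, 0 < (d:ℝ) / 2 + s → -1 < q →
    rad d s q = c * ENNReal.ofReal (ProbabilityTheory.beta ((d:ℝ) / 2 + s) (q + 1)) := by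
  obtain ⟨c, h0, ht, h⟩ := radial d hd
  refine ⟨c, h0, ht, fun s q hs hq => ?_⟩
  have hm : Measurable fun w : ℝ => if w < 1 then ENNReal.ofReal (w ^ s * (1 - w) ^ q) else 0 :=
    Measurable.ite measurableSet_Iio (by fun_prop) measurable_const
  rw [rad, h _ hm, ← lint_beta hs (by linarith)]
  congr 1
  rw [← Set.Ioi_inter_Iio, Set.inter_comm, ← Measure.restrict_restrict measurableSet_Iio, ← lintegral_indicator measurableSet_Iio]
  refine setLIntegral_congr_fun measurableSet_Ioi fun w hw => ?_
  have hw' : 0 < w := hw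
  simp only [Set.indicator, Set.mem_Iio]
  split_ifs with h1
  · rw [← ENNReal.ofReal_mul (by positivity), ← mul_assoc, ← Real.rpow_add hw']
    congr 3 <;> ring_nf
  · simp

lemma rad_const (d : ℕ) (q : ℝ) (hq : -1 < q) : rad d 0 q ≠ 0 ∧ rad d 0 q ≠ ⊤ := by
  rcases Nat.eq_zero_or_pos d with rfl | hd
  · simp [rad, volume_pi]
  · obtain ⟨c, h0, ht, h⟩ := rad_beta d hd
    rw [h 0 q (by positivity) hq]
    have := ProbabilityTheory.beta_pos (α := (d:ℝ) / 2 + 0) (β := q + 1) (by positivity) (by linarith)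
    exact ⟨mul_ne_zero h0 (by simpa using this), ENNReal.mul_ne_top ht ENNReal.ofReal_ne_top⟩
end

section
def bd {N : ℕ} (α : ℝ) (b : Fin N → ℝ) (C : Matrix (Fin N) (Fin N) ℝ) : Matrix (Fin (N + 1)) (Fin (N + 1)) ℝ :=
  Matrix.of (Fin.cons (Fin.cons α b : Fin (N + 1) → ℝ) (fun i => (Fin.cons (b i) (C i) : Fin (N + 1) → ℝ)) : Fin (N + 1) → Fin (N + 1) → ℝ)

lemma bd_split {N : ℕ} (X : Matrix (Fin (N + 1)) (Fin (N + 1)) ℝ) (hX : Xᵀ = X) :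
    X = bd (X 0 0) (fun i => X 0 i.succ) (X.submatrix Fin.succ Fin.succ) := by
  ext i j
  refine Fin.cases ?_ (fun i => ?_) i <;> refine Fin.cases ?_ (fun j => ?_) j <;> simp [bd]
  have := congrFun (congrFun hX 0) i.succ
  simpa using this

lemma bd_det {N : ℕ} (α : ℝ) (hα : α ≠ 0) (b : Fin N → ℝ) (C : Matrix (Fin N) (Fin N) ℝ) :
    (bd α b C).det = α * (C - α⁻¹ • vecMulVec b b).det := by
  let B : Matrix (Fin (N + 1)) (Fin (N + 1)) ℝ :=
    Matrix.of (Fin.cons (Fin.cons α b : Fin (N + 1) → ℝ) (fun i => (Fin.cons 0 ((C - α⁻¹ • vecMulVec b b) i) : Fin (N + 1) → ℝ)) : Fin (N + 1) → Fin (N + 1) → ℝ)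
  have h1 : (bd α b C).det = B.det := by
    refine Matrix.det_eq_of_forall_row_eq_smul_add_const (Fin.cons 0 (fun i => α⁻¹ * b i) : Fin (N + 1) → ℝ) 0 (by simp) ?_
    intro i j
    refine Fin.cases ?_ (fun i => ?_) i <;> refine Fin.cases ?_ (fun j => ?_) j <;> simp [bd, B, vecMulVec_apply]
    · field_simp
    · ring
  rw [h1, Matrix.det_succ_column_zero, Fin.sum_univ_succ]
  have h2 : B.submatrix (Fin.succAbove 0) Fin.succ = C - α⁻¹ • vecMulVec b b := by
    ext i j; simp [B]
  simp only [h2]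
  simp [B]

lemma bd_corner {N : ℕ} (α : ℝ) (b : Fin N → ℝ) (C : Matrix (Fin N) (Fin N) ℝ) (m : ℕ) (h : m ≤ N) :
    (bd α b C).submatrix (Fin.castLE (Nat.succ_le_succ h)) (Fin.castLE (Nat.succ_le_succ h)) =
      bd α (fun i => b (Fin.castLE h i)) (C.submatrix (Fin.castLE h) (Fin.castLE h)) := by
  ext i j
  refine Fin.cases ?_ (fun i => ?_) i <;> refine Fin.cases ?_ (fun j => ?_) j <;> simp [bd]

lemma bd_lm_zero {N : ℕ} (α : ℝ) (b : Fin N → ℝ) (C : Matrix (Fin N) (Fin N) ℝ) :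
    lm (bd α b C) 0 = α := by
  have : lm (bd α b C) 0 = (bd α b C) 0 0 := by
    unfold lm
    exact Matrix.det_fin_one _
  rw [this]; simp [bd]

lemma bd_lm_succ {N : ℕ} (α : ℝ) (hα : α ≠ 0) (b : Fin N → ℝ) (C : Matrix (Fin N) (Fin N) ℝ) (j : Fin N) :
    lm (bd α b C) j.succ = α * lm (C - α⁻¹ • vecMulVec b b) j := by
  unfold lm
  have h := bd_corner α b C (j.1 + 1) j.isLt
  have h2 : (bd α b C).submatrix (Fin.castLE j.succ.isLt) (Fin.castLE j.succ.isLt) =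
    bd α (fun i => b (Fin.castLE j.isLt i)) (C.submatrix (Fin.castLE j.isLt) (Fin.castLE j.isLt)) := h
  rw [h2]
  refine (bd_det α hα _ _).trans ?_
  rfl

lemma posDef_real_iff {N : ℕ} (X : Matrix (Fin N) (Fin N) ℝ) :
    X.PosDef ↔ Xᵀ = X ∧ ∀ x : Fin N → ℝ, x ≠ 0 → 0 < x ⬝ᵥ (X *ᵥ x) := by
  constructor
  · intro h
    refine ⟨by simpa using h.isHermitian.eq, fun x hx => ?_⟩
    simpa using h.dotProduct_mulVec_pos hx
  · rintro ⟨h1, h2⟩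
    refine Matrix.PosDef.of_dotProduct_mulVec_pos (by simpa [Matrix.IsHermitian] using h1) ?_
    intro x hx
    simpa using h2 x hx

lemma bd_quad {N : ℕ} (α : ℝ) (hα : α ≠ 0) (b : Fin N → ℝ) (C : Matrix (Fin N) (Fin N) ℝ) (x0 : ℝ) (y : Fin N → ℝ) :
    (Fin.cons x0 y : Fin (N + 1) → ℝ) ⬝ᵥ (bd α b C *ᵥ (Fin.cons x0 y : Fin (N + 1) → ℝ)) =
      α * (x0 + α⁻¹ * (b ⬝ᵥ y)) ^ 2 + y ⬝ᵥ ((C - α⁻¹ • vecMulVec b b) *ᵥ y) := by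
  have h1 : bd α b C *ᵥ (Fin.cons x0 y : Fin (N + 1) → ℝ) = (Fin.cons (α * x0 + b ⬝ᵥ y) (x0 • b + C *ᵥ y) : Fin (N + 1) → ℝ) := by
    ext i
    refine Fin.cases ?_ (fun i => ?_) i
    · simp [Matrix.mulVec, dotProduct, Fin.sum_univ_succ, bd]
    · simp [Matrix.mulVec, dotProduct, Fin.sum_univ_succ, bd, mul_comm]
  have h2 : ∀ (p : ℝ) (q : Fin N → ℝ), (Fin.cons x0 y : Fin (N + 1) → ℝ) ⬝ᵥ (Fin.cons p q : Fin (N + 1) → ℝ) = x0 * p + y ⬝ᵥ q := by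
    intro p q; simp [dotProduct, Fin.sum_univ_succ]
  rw [h1, h2, Matrix.sub_mulVec, Matrix.smul_mulVec, Matrix.vecMulVec_mulVec]
  simp only [dotProduct_add, dotProduct_sub, dotProduct_smul, smul_eq_mul, MulOpposite.smul_eq_mul_unop, MulOpposite.unop_op]
  rw [dotProduct_comm y b]
  field_simp
  ring

lemma bd_posDef {N : ℕ} (α : ℝ) (b : Fin N → ℝ) (C : Matrix (Fin N) (Fin N) ℝ) (hC : Cᵀ = C) :
    (bd α b C).PosDef ↔ 0 < α ∧ (C - α⁻¹ • vecMulVec b b).PosDef := by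
  have hs : (bd α b C)ᵀ = bd α b C := by
    ext i j
    have := fun i j => congrFun (congrFun hC i) j
    refine Fin.cases ?_ (fun i => ?_) i <;> refine Fin.cases ?_ (fun j => ?_) j <;> simp [bd]
    exact this _ _
  have hs2 : (C - α⁻¹ • vecMulVec b b)ᵀ = C - α⁻¹ • vecMulVec b b := by
    rw [Matrix.transpose_sub, hC, Matrix.transpose_smul, Matrix.transpose_vecMulVec]
  rw [posDef_real_iff, posDef_real_iff]
  constructor
  · rintro ⟨-, h⟩
    have hα : 0 < α := by
      have := h (Fin.cons 1 0) (by intro h; simpa using congrFun h 0)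
      simpa [Matrix.mulVec, dotProduct, Fin.sum_univ_succ, bd] using this
    refine ⟨hα, hs2, fun y hy => ?_⟩
    have := h (Fin.cons (-(α⁻¹ * (b ⬝ᵥ y))) y) (by
      intro h; apply hy; ext i; simpa using congrFun h i.succ)
    rw [bd_quad α hα.ne'] at this
    simpa using this
  · rintro ⟨hα, -, h⟩
    refine ⟨hs, fun x hx => ?_⟩
    obtain ⟨x0, y, rfl⟩ : ∃ x0 y, x = Fin.cons x0 y := ⟨x 0, Fin.tail x, (Fin.cons_self_tail x).symm⟩
    rw [bd_quad α hα.ne']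
    by_cases hy : y = 0
    · subst hy
      have : x0 ≠ 0 := by
        rintro rfl; apply hx; ext i; refine Fin.cases ?_ (fun i => ?_) i <;> simp
      simp only [dotProduct_zero, Matrix.mulVec_zero, mul_zero, add_zero]
      positivity
    · have := h y hy
      positivity

lemma sylv : ∀ {N : ℕ} (X : Matrix (Fin N) (Fin N) ℝ), Xᵀ = X → (X.PosDef ↔ ∀ j, 0 < lm X j)
  | 0, X, hX => by
    rw [posDef_real_iff]
    refine ⟨fun _ j => j.elim0, fun _ => ⟨hX, fun x hx => (hx (Subsingleton.elim _ _)).elim⟩⟩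
  | N + 1, X, hX => by
    rw [bd_split X hX]
    have hC : (X.submatrix Fin.succ Fin.succ)ᵀ = X.submatrix Fin.succ Fin.succ := by
      rw [Matrix.transpose_submatrix, hX]
    generalize X.submatrix Fin.succ Fin.succ = C at *
    generalize X 0 0 = α at *
    generalize (fun i : Fin N => X 0 i.succ) = b at *
    have hs2 : (C - α⁻¹ • vecMulVec b b)ᵀ = C - α⁻¹ • vecMulVec b b := by
      rw [Matrix.transpose_sub, hC, Matrix.transpose_smul, Matrix.transpose_vecMulVec]
    rw [bd_posDef _ _ _ hC, sylv _ hs2, Fin.forall_fin_succ, bd_lm_zero]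
    refine and_congr_right fun hα => forall_congr' fun j => ?_
    rw [bd_lm_succ _ hα.ne']
    exact (mul_pos_iff_of_pos_left hα).symm

lemma rk1_det {N : ℕ} (y : Fin N → ℝ) : (1 - vecMulVec y y).det = 1 - y ⬝ᵥ y := by
  have := Matrix.det_one_sub_mul_comm (replicateCol Unit y) (replicateRow Unit y)
  rw [Matrix.vecMulVec_eq Unit, this, Matrix.det_unique]
  simp [Matrix.mul_apply, dotProduct]

lemma rk1_posDef {N : ℕ} (y : Fin N → ℝ) : (1 - vecMulVec y y).PosDef ↔ y ⬝ᵥ y < 1 := by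
  have hq : ∀ x : Fin N → ℝ, x ⬝ᵥ ((1 - vecMulVec y y) *ᵥ x) = x ⬝ᵥ x - (x ⬝ᵥ y) ^ 2 := by
    intro x
    rw [Matrix.sub_mulVec, Matrix.vecMulVec_mulVec, Matrix.one_mulVec, dotProduct_sub]
    simp only [dotProduct_smul, MulOpposite.smul_eq_mul_unop, MulOpposite.unop_op]
    rw [dotProduct_comm y x]; ring
  have hnn : ∀ x : Fin N → ℝ, 0 ≤ x ⬝ᵥ x := fun x => by
    simp only [dotProduct, ← sq]; positivity
  rw [posDef_real_iff]
  constructor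
  · rintro ⟨-, h⟩
    by_contra hc
    push Not at hc
    have hy : y ≠ 0 := by rintro rfl; simp at hc; linarith
    have := h y hy
    rw [hq] at this
    nlinarith
  · intro h
    refine ⟨by rw [Matrix.transpose_sub, Matrix.transpose_vecMulVec, Matrix.transpose_one], fun x hx => ?_⟩
    rw [hq]
    have h1 : (x ⬝ᵥ y) ^ 2 ≤ (x ⬝ᵥ x) * (y ⬝ᵥ y) := by
      have := Finset.sum_mul_sq_le_sq_mul_sq Finset.univ x y
      simpa [dotProduct, sq] using this
    have h2 : 0 < x ⬝ᵥ x := dot_pos hx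
    nlinarith
end

section
open Classical in
def Fj {N : ℕ} (t : ℕ → ℝ) (μ : ℝ) (G : Matrix (Fin N) (Fin N) ℝ) : ENNReal :=
  if (1 - G).PosDef then ENNReal.ofReal ((∏ j : Fin N, lm G j ^ t j) * (1 - G).det ^ μ) else 0

def grm {N : ℕ} (u : Fin N → Fin N → ℝ) : Matrix (Fin N) (Fin N) ℝ := Matrix.of u * (Matrix.of u)ᵀ

def JI (N : ℕ) (t : ℕ → ℝ) (μ : ℝ) : ENNReal := ∫⁻ u : Fin N → Fin N → ℝ, Fj t μ (grm u)

lemma gram_tr {N : ℕ} (u : Fin N → Fin N → ℝ) : (grm u)ᵀ = grm u := by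
  simp [grm, Matrix.transpose_mul]

lemma continuous_gram {N : ℕ} : Continuous (grm (N := N)) := by
  unfold grm
  exact Continuous.matrix_mul (continuous_id (X := Fin N → Fin N → ℝ)) (Continuous.matrix_transpose (continuous_id (X := Fin N → Fin N → ℝ)))

lemma posDef_meas {N : ℕ} : MeasurableSet {u : Fin N → Fin N → ℝ | (1 - grm u).PosDef} := by
  have : {u : Fin N → Fin N → ℝ | (1 - grm u).PosDef} = ⋂ j, {u | 0 < lm (1 - grm u) j} := by
    ext u
    simp only [Set.mem_ofPred_eq, Set.mem_iInter]
    exact sylv _ (by rw [Matrix.transpose_sub, gram_tr, Matrix.transpose_one])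
  rw [this]
  refine MeasurableSet.iInter fun j => (isOpen_lt continuous_const ?_).measurableSet
  exact (continuous_lm j).comp (continuous_const.sub continuous_gram)

lemma Fj_meas {N : ℕ} (t : ℕ → ℝ) (μ : ℝ) : Measurable fun u : Fin N → Fin N → ℝ => Fj t μ (grm u) := by
  classical
  have h1 : ∀ j : Fin N, Measurable fun u : Fin N → Fin N → ℝ => lm (grm u) j := fun j =>
    ((continuous_lm j).comp continuous_gram).measurable
  have h2 : Measurable fun u : Fin N → Fin N → ℝ => (1 - grm u).det :=
    (Continuous.matrix_det (continuous_const.sub continuous_gram)).measurable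
  unfold Fj
  refine Measurable.ite posDef_meas ?_ measurable_const
  have h3 : Measurable fun u : Fin N → Fin N → ℝ => ∏ j : Fin N, lm (grm u) j ^ t j :=
    Finset.measurable_prod _ fun j _ => (h1 j).pow_const _
  exact (h3.mul (h2.pow_const _)).ennreal_ofReal

lemma lm_gram_nonneg {N : ℕ} (u : Fin N → Fin N → ℝ) (j : Fin N) : 0 ≤ lm (grm u) j := by
  unfold lm
  have h := Matrix.posSemidef_self_mul_conjTranspose (Matrix.of u)
  simp only [Matrix.conjTranspose_eq_transpose_of_trivial] at h
  exact (h.submatrix _).det_nonneg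

lemma lin_cov {N : ℕ} (A : Matrix (Fin N) (Fin N) ℝ) (hA : A.det ≠ 0) (g : (Fin N → ℝ) → ENNReal) :
    ∫⁻ c, g c = ENNReal.ofReal |A.det| * ∫⁻ y, g (A *ᵥ y) := by
  have h := Real.map_matrix_volume_pi_eq_smul_volume_pi hA
  have hemb : MeasurableEmbedding (fun y : Fin N → ℝ => A *ᵥ y) := by
    have hu : IsUnit A := (Matrix.isUnit_iff_isUnit_det A).2 (isUnit_iff_ne_zero.2 hA)
    exact (Continuous.matrix_mulVec continuous_const continuous_id).measurableEmbedding
      (Matrix.mulVec_injective_of_isUnit hu)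
  have h2 := hemb.lintegral_map (μ := volume) g
  have h3 : Measure.map (fun y : Fin N → ℝ => A *ᵥ y) volume = ENNReal.ofReal |A.det⁻¹| • volume := h
  rw [← h2, h3, lintegral_smul_measure, smul_eq_mul, ← mul_assoc, ← ENNReal.ofReal_mul (abs_nonneg _), abs_inv,
    mul_inv_cancel₀ (abs_ne_zero.2 hA)]
  simp

open scoped MatrixOrder in
lemma exists_root {N : ℕ} (M : Matrix (Fin N) (Fin N) ℝ) (hM : M.PosDef) :
    ∃ B : Matrix (Fin N) (Fin N) ℝ, M = B * Bᵀ := by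
  obtain ⟨B, hB⟩ := CStarAlgebra.nonneg_iff_eq_star_mul_self.mp hM.posSemidef.nonneg
  refine ⟨Bᵀ, ?_⟩
  rw [hB, Matrix.transpose_transpose, Matrix.star_eq_conjTranspose, Matrix.conjTranspose_eq_transpose_of_trivial]

open Classical in
lemma inner_c {N : ℕ} (M : Matrix (Fin N) (Fin N) ℝ) (δ μ : ℝ) (hδ : 0 < δ) :
    ∫⁻ c : Fin N → ℝ, (if (M - δ⁻¹ • vecMulVec c c).PosDef then
      ENNReal.ofReal ((M - δ⁻¹ • vecMulVec c c).det ^ μ) else 0) =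
    if M.PosDef then ENNReal.ofReal (δ ^ ((N:ℝ) / 2) * M.det ^ (μ + 1 / 2)) * rad N 0 μ else 0 := by
  split_ifs with hM
  · obtain ⟨B, hB⟩ := exists_root M hM
    have hMd := hM.det_pos
    have hdB : M.det = B.det ^ 2 := by rw [hB, Matrix.det_mul, Matrix.det_transpose, sq]
    have hB0 : B.det ≠ 0 := fun h => by rw [hdB, h] at hMd; simp at hMd
    have hs : 0 < √δ := Real.sqrt_pos.2 hδ
    have hA : (√δ • B).det ≠ 0 := by
      rw [Matrix.det_smul]; exact mul_ne_zero (by positivity) hB0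
    rw [lin_cov _ hA]
    have hdA : |(√δ • B).det| = δ ^ ((N:ℝ) / 2) * M.det ^ ((1:ℝ) / 2) := by
      rw [Matrix.det_smul, abs_mul, hdB, ← Real.sqrt_eq_rpow, Real.sqrt_sq_eq_abs, abs_of_pos (by positivity)]
      congr 1
      rw [Fintype.card_fin, ← Real.rpow_natCast, Real.sqrt_eq_rpow, ← Real.rpow_mul hδ.le]
      congr 1; ring
    have hy : ∀ y : Fin N → ℝ, M - δ⁻¹ • vecMulVec ((√δ • B) *ᵥ y) ((√δ • B) *ᵥ y) =
        B * (1 - vecMulVec y y) * Bᵀ := by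
      intro y
      rw [Matrix.mul_sub, Matrix.sub_mul, mul_one, ← hB, Matrix.mul_vecMulVec, Matrix.vecMulVec_mul,
        Matrix.vecMul_transpose, Matrix.smul_mulVec, Matrix.vecMulVec_smul, Matrix.smul_vecMulVec]
      congr 1
      rw [smul_smul, smul_smul, mul_assoc, Real.mul_self_sqrt hδ.le, inv_mul_cancel₀ hδ.ne', one_smul]
    have hu : IsUnit B := (Matrix.isUnit_iff_isUnit_det B).2 (isUnit_iff_ne_zero.2 hB0)
    have hpd : ∀ y : Fin N → ℝ, (B * (1 - vecMulVec y y) * Bᵀ).PosDef ↔ y ⬝ᵥ y < 1 := by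
      intro y
      rw [← rk1_posDef, ← Matrix.IsUnit.posDef_star_right_conjugate_iff (x := 1 - vecMulVec y y) hu, Matrix.star_eq_conjTranspose,
        Matrix.conjTranspose_eq_transpose_of_trivial]
    simp only [hy, hpd]
    rw [hdA, rad, ← lintegral_const_mul' _ _ ENNReal.ofReal_ne_top, ← lintegral_const_mul' _ _ ENNReal.ofReal_ne_top]
    refine lintegral_congr fun y => ?_
    split_ifs with h
    · rw [← ENNReal.ofReal_mul (by positivity), ← ENNReal.ofReal_mul (by positivity)]
      congr 1
      rw [Matrix.det_mul, Matrix.det_mul, Matrix.det_transpose, rk1_det, Real.rpow_zero, one_mul, Real.rpow_add hMd]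
      have : B.det * (1 - y ⬝ᵥ y) * B.det = M.det * (1 - y ⬝ᵥ y) := by rw [hdB]; ring
      rw [this, Real.mul_rpow hMd.le (by linarith)]
      ring
    · simp
  · rw [lintegral_eq_zero_of_ae_eq_zero (Filter.Eventually.of_forall fun c => ?_)]
    refine if_neg fun h => hM ?_
    have h2 : (δ⁻¹ • vecMulVec c c).PosSemidef := by
      have := Matrix.posSemidef_vecMulVec_self_star c
      simp only [star_trivial] at this
      exact this.smul (by positivity)
    have := h.add_posSemidef h2
    simpa using this

lemma mp_rows {N : ℕ} : MeasurePreserving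
    (fun (p : (Fin N → ℝ) × (Fin N → Fin N → ℝ)) (i : Fin N) => (Fin.cons (p.1 i) (p.2 i) : Fin (N + 1) → ℝ)) volume volume := by
  have h1 := (volume_measurePreserving_arrowProdEquivProdArrow ℝ (Fin N → ℝ) (Fin N)).symm
  have h2 := volume_preserving_pi (ι := Fin N) (f := fun _ => (MeasurableEquiv.piFinSuccAbove (fun _ : Fin (N + 1) => ℝ) 0).symm)
    fun _ => (volume_preserving_piFinSuccAbove (fun _ : Fin (N + 1) => ℝ) 0).symm
  have h3 := h2.comp h1
  have h4 : (fun (p : (Fin N → ℝ) × (Fin N → Fin N → ℝ)) (i : Fin N) => (Fin.cons (p.1 i) (p.2 i) : Fin (N + 1) → ℝ)) =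
      (fun a i => (MeasurableEquiv.piFinSuccAbove (fun _ : Fin (N + 1) => ℝ) 0).symm (a i)) ∘
        (MeasurableEquiv.arrowProdEquivProdArrow ℝ (Fin N → ℝ) (Fin N)).symm := by
    funext p i j
    refine Fin.cases ?_ (fun j => ?_) j <;> simp [MeasurableEquiv.arrowProdEquivProdArrow, MeasurableEquiv.piFinSuccAbove, Equiv.arrowProdEquivProdArrow, Fin.insertNthEquiv]
  rw [h4]
  exact h3

lemma mp_cons {N : ℕ} {E : Type*} [MeasureSpace E] [SigmaFinite (volume : Measure E)] : MeasurePreserving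
    (fun (p : E × (Fin N → E)) => (Fin.cons p.1 p.2 : Fin (N + 1) → E)) volume volume := by
  have h1 := (volume_preserving_piFinSuccAbove (fun _ : Fin (N + 1) => E) 0).symm
  have h4 : (fun (p : E × (Fin N → E)) => (Fin.cons p.1 p.2 : Fin (N + 1) → E)) =
      (MeasurableEquiv.piFinSuccAbove (fun _ : Fin (N + 1) => E) 0).symm := by
    funext p j
    simp [MeasurableEquiv.piFinSuccAbove, Fin.insertNthEquiv]
  rw [h4]
  exact h1

lemma gram_bd {N : ℕ} (ρ : ℝ) (c : Fin N → ℝ) (w : Fin N → Fin N → ℝ) :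
    grm (Fin.cons (Fin.cons ρ 0 : Fin (N + 1) → ℝ) (fun i => (Fin.cons (c i) (w i) : Fin (N + 1) → ℝ)) : Fin (N + 1) → Fin (N + 1) → ℝ)
      = bd (ρ ^ 2) (ρ • c) (vecMulVec c c + grm w) := by
  ext i j
  refine Fin.cases ?_ (fun i => ?_) i <;> refine Fin.cases ?_ (fun j => ?_) j <;>
    simp [grm, bd, Matrix.mul_apply, Fin.sum_univ_succ, vecMulVec_apply] <;> try ring

lemma one_sub_bd {N : ℕ} (α : ℝ) (b : Fin N → ℝ) (C : Matrix (Fin N) (Fin N) ℝ) :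
    1 - bd α b C = bd (1 - α) (-b) (1 - C) := by
  ext i j
  refine Fin.cases ?_ (fun i => ?_) i <;> refine Fin.cases ?_ (fun j => ?_) j <;>
    simp [bd, Matrix.one_apply, Fin.ext_iff]

lemma gram_rot {N : ℕ} (r : Fin (N + 1) → ℝ) (hr : r ≠ 0) (v : Fin N → Fin (N + 1) → ℝ) :
    grm (Fin.cons r v : Fin (N + 1) → Fin (N + 1) → ℝ) =
      grm (Fin.cons (Fin.cons (nrm r) 0 : Fin (N + 1) → ℝ) (fun i => HH 0 r *ᵥ v i) : Fin (N + 1) → Fin (N + 1) → ℝ) := by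
  have h1 : Matrix.of (Fin.cons (Fin.cons (nrm r) 0 : Fin (N + 1) → ℝ) (fun i => HH 0 r *ᵥ v i) : Fin (N + 1) → Fin (N + 1) → ℝ) =
      Matrix.of (Fin.cons r v : Fin (N + 1) → Fin (N + 1) → ℝ) * (HH 0 r)ᵀ := by
    have hrow : (HH 0 r) *ᵥ r = (Fin.cons (nrm r) 0 : Fin (N + 1) → ℝ) := by
      have hn := nrm_pos hr
      have : r = nrm r • HH 0 r *ᵥ (Pi.single 0 1) := by
        ext i
        rw [Pi.smul_apply, Matrix.mulVec_single_one, Matrix.col_apply]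
        have := congrFun (congrFun (HH_tr 0 r) 0) i
        rw [Matrix.transpose_apply] at this
        rw [this, HH_row 0 hr, smul_eq_mul]
        field_simp
      conv_lhs => enter [2]; rw [this]
      have h2 := HH_orth 0 r
      rw [HH_tr] at h2
      rw [Matrix.mulVec_smul, Matrix.mulVec_mulVec, h2, Matrix.one_mulVec]
      ext i
      refine Fin.cases ?_ (fun i => ?_) i <;> simp
    ext i j
    rw [Matrix.mul_apply]
    refine Fin.cases ?_ (fun i => ?_) i
    · have := congrFun hrow j
      simp only [Matrix.of_apply, Fin.cons_zero, Matrix.transpose_apply]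
      rw [← this]
      simp [Matrix.mulVec, dotProduct, mul_comm]
    · simp [Matrix.mulVec, dotProduct, mul_comm]
  have h2 := HH_orth 0 r
  rw [HH_tr] at h2
  unfold grm
  rw [h1, Matrix.transpose_mul, Matrix.transpose_transpose, Matrix.mul_assoc, ← Matrix.mul_assoc (HH 0 r)ᵀ, HH_tr, h2, Matrix.one_mul]
end

section
open Classical in
lemma Fj_bd {N : ℕ} (t : ℕ → ℝ) (μ ρ : ℝ) (hρ : 0 < ρ) (c : Fin N → ℝ) (w : Fin N → Fin N → ℝ) :
    Fj t μ (grm (Fin.cons (Fin.cons ρ 0 : Fin (N + 1) → ℝ) (fun i => (Fin.cons (c i) (w i) : Fin (N + 1) → ℝ)) : Fin (N + 1) → Fin (N + 1) → ℝ))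
      = if ρ ^ 2 < 1 then ENNReal.ofReal ((ρ ^ 2) ^ (∑ j : Fin (N + 1), t j) * (1 - ρ ^ 2) ^ μ * ∏ j : Fin N, lm (grm w) j ^ t (j + 1)) *
        (if ((1 - grm w) - (1 - ρ ^ 2)⁻¹ • vecMulVec c c).PosDef then
      ENNReal.ofReal (((1 - grm w) - (1 - ρ ^ 2)⁻¹ • vecMulVec c c).det ^ μ) else 0) else 0 := by
  have hρ2 : 0 < ρ ^ 2 := by positivity
  have hC : (1 - (vecMulVec c c + grm w))ᵀ = 1 - (vecMulVec c c + grm w) := by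
    rw [Matrix.transpose_sub, Matrix.transpose_add, gram_tr, Matrix.transpose_vecMulVec, Matrix.transpose_one]
  unfold Fj
  rw [gram_bd, one_sub_bd, bd_posDef _ _ _ hC, sub_pos]
  by_cases h1 : ρ ^ 2 < 1
  swap
  · simp [h1]
  have hδ : 0 < 1 - ρ ^ 2 := by linarith
  have hS : 1 - (vecMulVec c c + grm w) - (1 - ρ ^ 2)⁻¹ • vecMulVec (-(ρ • c)) (-(ρ • c)) =
      (1 - grm w) - (1 - ρ ^ 2)⁻¹ • vecMulVec c c := by
    ext i j
    simp [vecMulVec_apply]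
    field_simp
    ring
  have hS2 : vecMulVec c c + grm w - (ρ ^ 2)⁻¹ • vecMulVec (ρ • c) (ρ • c) = grm w := by
    ext i j
    simp [vecMulVec_apply]
    field_simp
    ring
  rw [hS, bd_det _ hδ.ne', hS]
  simp only [h1, true_and, if_true]
  split_ifs with h2
  · have hd := h2.det_pos
    have hl : ∏ j : Fin (N + 1), lm (bd (ρ ^ 2) (ρ • c) (vecMulVec c c + grm w)) j ^ t j =
        (ρ ^ 2) ^ (∑ j : Fin (N + 1), t j) * ∏ j : Fin N, lm (grm w) j ^ t (j + 1) := by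
      rw [Fin.prod_univ_succ, bd_lm_zero]
      simp only [bd_lm_succ _ hρ2.ne', hS2, Fin.sum_univ_succ, Fin.val_zero, Fin.val_succ]
      rw [Real.rpow_add hρ2, Real.rpow_sum_of_pos hρ2, mul_assoc, ← Finset.prod_mul_distrib]
      congr 1
      exact Finset.prod_congr rfl fun j _ => Real.mul_rpow hρ2.le (lm_gram_nonneg _ _)
    have hp : 0 ≤ ∏ j : Fin N, lm (grm w) j ^ t (j + 1) := Finset.prod_nonneg fun j _ => Real.rpow_nonneg (lm_gram_nonneg _ _) _
    rw [hl, Real.mul_rpow hδ.le hd.le, ← ENNReal.ofReal_mul (by positivity)]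
    congr 1
    ring
  · simp

lemma JI_succ (N : ℕ) (t : ℕ → ℝ) (μ : ℝ) :
    JI (N + 1) t μ = rad (N + 1) (∑ j : Fin (N + 1), t j) (μ + (N:ℝ) / 2) * (rad N 0 μ * JI N (fun j => t (j + 1)) (μ + 1 / 2)) := by
  classical
  have h1 : JI (N + 1) t μ = ∫⁻ r : Fin (N + 1) → ℝ, ∫⁻ v : Fin N → Fin (N + 1) → ℝ,
      Fj t μ (grm (Fin.cons r v : Fin (N + 1) → Fin (N + 1) → ℝ)) := by
    have hm : MeasurePreserving (fun (p : (Fin (N + 1) → ℝ) × (Fin N → Fin (N + 1) → ℝ)) =>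
      (Fin.cons p.1 p.2 : Fin (N + 1) → Fin (N + 1) → ℝ)) volume volume := mp_cons
    rw [JI, ← hm.lintegral_comp (Fj_meas t μ), Measure.volume_eq_prod, lintegral_prod]
    exact ((Fj_meas t μ).comp hm.measurable).aemeasurable
  rw [h1, rad, ← lintegral_mul_const'' _ (by
    refine Measurable.aemeasurable (Measurable.ite ?_ ?_ measurable_const)
    · exact (isOpen_lt (by unfold dotProduct; fun_prop) continuous_const).measurableSet
    · unfold dotProduct; fun_prop)]
  refine lintegral_congr_ae ?_
  filter_upwards [(measure_eq_zero_iff_ae_notMem).1 (measure_singleton (μ := volume) (0 : Fin (N + 1) → ℝ))] with r hr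
  have hr0 : r ≠ 0 := hr
  have hρ := nrm_pos hr0
  simp only [gram_rot r hr0]
  have hmp := volume_preserving_pi (ι := Fin N) (f := fun _ v => HH 0 r *ᵥ v) fun _ => og_mp (HG 0 r)
  have hmg : Measurable fun v : Fin N → Fin (N + 1) → ℝ =>
      Fj t μ (grm (Fin.cons (Fin.cons (nrm r) 0 : Fin (N + 1) → ℝ) v : Fin (N + 1) → Fin (N + 1) → ℝ)) := by
    refine (Fj_meas t μ).comp ?_
    refine measurable_pi_iff.2 fun i => ?_
    refine Fin.cases ?_ (fun i => ?_) i
    · exact measurable_const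
    · exact measurable_pi_apply i
  rw [hmp.lintegral_comp hmg, ← mp_rows.lintegral_comp hmg, Measure.volume_eq_prod, lintegral_prod_symm]
  swap
  · exact (hmg.comp mp_rows.measurable).aemeasurable
  simp only [Fj_bd t μ _ hρ, nrm_sq]
  split_ifs with h
  swap
  · simp
  have hδ : 0 < 1 - r ⬝ᵥ r := by linarith
  simp only [lintegral_const_mul' _ _ ENNReal.ofReal_ne_top, inner_c _ _ _ hδ]
  rw [JI, ← lintegral_const_mul _ (Fj_meas _ _), ← lintegral_const_mul' _ _ ENNReal.ofReal_ne_top]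
  refine lintegral_congr fun w => ?_
  unfold Fj
  split_ifs with h2
  · have hp : 0 ≤ ∏ j : Fin N, lm (grm w) j ^ t (j + 1) := Finset.prod_nonneg fun j _ => Real.rpow_nonneg (lm_gram_nonneg _ _) _
    have := h2.det_pos
    have hrr := dot_pos hr0
    generalize rad N 0 μ = R
    rw [← mul_assoc, mul_left_comm _ R, mul_comm _ R,
      ← ENNReal.ofReal_mul (by positivity), ← ENNReal.ofReal_mul (by positivity)]
    congr 2
    rw [Real.rpow_add hδ]
    ring
  · simp

def gprod (N : ℕ) (t : ℕ → ℝ) (μ : ℝ) : ℝ := ∏ i ∈ Finset.range N,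
  Real.Gamma (((N:ℝ) - i) / 2 + ∑ j ∈ Finset.Ico i N, t j) /
    Real.Gamma ((N:ℝ) - i / 2 + 1 / 2 + (∑ j ∈ Finset.Ico i N, t j) + μ)

lemma gprod_nonneg (N : ℕ) (t : ℕ → ℝ) (μ : ℝ) (hμ : -1 < μ)
    (ht : ∀ i < N, 0 < ((N:ℝ) - i) / 2 + ∑ j ∈ Finset.Ico i N, t j) : 0 < gprod N t μ := by
  refine Finset.prod_pos fun i hi => ?_
  have hi' := Finset.mem_range.1 hi
  have h := ht i hi'
  refine div_pos (Real.Gamma_pos_of_pos h) (Real.Gamma_pos_of_pos ?_)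
  have : (i:ℝ) + 1 ≤ N := by exact_mod_cast hi'
  have : (0:ℝ) ≤ i := by positivity
  linarith

lemma JI_formula : ∀ (N : ℕ) (μ : ℝ), -1 < μ → ∃ K : ENNReal, K ≠ 0 ∧ K ≠ ⊤ ∧ ∀ t : ℕ → ℝ,
    (∀ i < N, 0 < ((N:ℝ) - i) / 2 + ∑ j ∈ Finset.Ico i N, t j) → JI N t μ = K * ENNReal.ofReal (gprod N t μ) := by
  intro N
  induction N with
  | zero =>
    intro μ _
    refine ⟨JI 0 0 μ, ?_, ?_, fun t _ => ?_⟩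
    · have h : (1 - grm (fun i => i.elim0 : Fin 0 → Fin 0 → ℝ)).PosDef := by
        rw [sylv _ (Subsingleton.elim _ _)]; exact fun j => j.elim0
      have h2 : ∀ u : Fin 0 → Fin 0 → ℝ, Fj 0 μ (grm u) = 1 := by
        intro u
        have : u = fun i => i.elim0 := Subsingleton.elim _ _
        subst this
        rw [Fj, if_pos h]; simp
      simp [JI, h2, volume_pi]
    · have h2 : ∀ u : Fin 0 → Fin 0 → ℝ, Fj 0 μ (grm u) ≠ ⊤ := by
        intro u
        unfold Fj
        split_ifs <;> simp
      rw [JI, lintegral_unique]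
      exact ENNReal.mul_ne_top (h2 _) (by simp [volume_pi])
    · simp [gprod, JI, Fj]
  | succ N ih =>
    intro μ hμ
    obtain ⟨K, hK0, hKt, hK⟩ := ih (μ + 1 / 2) (by linarith)
    obtain ⟨c, hc0, hct, hc⟩ := rad_beta (N + 1) (Nat.succ_pos N)
    obtain ⟨hr0, hrt⟩ := rad_const N μ hμ
    have hN : (0:ℝ) ≤ N := by positivity
    have hG : 0 < Real.Gamma (μ + (N:ℝ) / 2 + 1) := Real.Gamma_pos_of_pos (by linarith)
    refine ⟨c * ENNReal.ofReal (Real.Gamma (μ + (N:ℝ) / 2 + 1)) * (rad N 0 μ * K), ?_, ?_, fun t ht => ?_⟩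
    · exact mul_ne_zero (mul_ne_zero hc0 (by simpa using hG)) (mul_ne_zero hr0 hK0)
    · exact ENNReal.mul_ne_top (ENNReal.mul_ne_top hct ENNReal.ofReal_ne_top) (ENNReal.mul_ne_top hrt hKt)
    · have hs : ∀ i, ∑ j ∈ Finset.Ico i N, t (j + 1) = ∑ j ∈ Finset.Ico (i + 1) (N + 1), t j := fun i =>
        Finset.sum_Ico_add' t i N 1
      have ht' : ∀ i < N, 0 < ((N:ℝ) - i) / 2 + ∑ j ∈ Finset.Ico i N, t (j + 1) := by
        intro i hi
        have := ht (i + 1) (by omega)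
        rw [hs]
        push_cast at this
        convert this using 2
        ring
      have hS : ∑ j : Fin (N + 1), t j = ∑ j ∈ Finset.Ico 0 (N + 1), t j := by
        rw [Fin.sum_univ_eq_sum_range, Finset.range_eq_Ico]
      have h0 := ht 0 (by omega)
      rw [Nat.cast_zero, sub_zero] at h0
      rw [JI_succ, hK _ ht', hS, hc _ _ h0 (by linarith)]
      have hg : gprod (N + 1) t μ = Real.Gamma (((N + 1 : ℕ) : ℝ) / 2 + ∑ j ∈ Finset.Ico 0 (N + 1), t j) /
          Real.Gamma (((N + 1 : ℕ) : ℝ) / 2 + (∑ j ∈ Finset.Ico 0 (N + 1), t j) + (μ + (N:ℝ) / 2 + 1)) * gprod N (fun j => t (j + 1)) (μ + 1 / 2) := by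
        unfold gprod
        rw [Finset.prod_range_succ', mul_comm]
        congr 1
        · congr 2 <;> push_cast <;> ring
        · refine Finset.prod_congr rfl fun i _ => ?_
          rw [hs]
          congr 2 <;> push_cast <;> ring
      have hgp := gprod_nonneg N (fun j => t (j + 1)) (μ + 1 / 2) (by linarith) ht'
      have hG2 : 0 < Real.Gamma (((N + 1 : ℕ) : ℝ) / 2 + ∑ j ∈ Finset.Ico 0 (N + 1), t j) := Real.Gamma_pos_of_pos h0
      have hG3 : 0 < Real.Gamma (((N + 1 : ℕ) : ℝ) / 2 + (∑ j ∈ Finset.Ico 0 (N + 1), t j) + (μ + (N:ℝ) / 2 + 1)) :=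
        Real.Gamma_pos_of_pos (by linarith)
      rw [hg, ENNReal.ofReal_mul (by positivity), ProbabilityTheory.beta, mul_div_right_comm, ENNReal.ofReal_mul (by positivity)]
      ring
end

section
lemma sph_LQ_all {N : ℕ} (e : ℕ → ℕ) (g X : Matrix (Fin N) (Fin N) ℝ) :
    ∫ k : OG N, pw e ((g * k.1) * X * (g * k.1)ᵀ) ∂hm N = pw e (g * gᵀ) * sph e X := by
  have hc1 : Continuous fun g : Matrix (Fin N) (Fin N) ℝ => ∫ k : OG N, pw e ((g * k.1) * X * (g * k.1)ᵀ) ∂hm N := by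
    have hc : Continuous (Function.uncurry fun (g : Matrix (Fin N) (Fin N) ℝ) (k : OG N) => pw e ((g * k.1) * X * (g * k.1)ᵀ)) := by
      refine (continuous_pw e).comp ?_
      have h1 : Continuous fun p : Matrix (Fin N) (Fin N) ℝ × OG N => p.1 * p.2.1 :=
        continuous_fst.matrix_mul (continuous_subtype_val.comp continuous_snd)
      exact (h1.matrix_mul continuous_const).matrix_mul h1.matrix_transpose
    have := continuous_parametric_integral_of_continuous (μ := hm N) hc (s := Set.univ) isCompact_univ
    simpa only [Measure.restrict_univ] using this
  have hc2 : Continuous fun g : Matrix (Fin N) (Fin N) ℝ => pw e (g * gᵀ) * sph e X :=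
    ((continuous_pw e).comp (continuous_id.matrix_mul continuous_id.matrix_transpose)).mul continuous_const
  have hd : Dense {g : Matrix (Fin N) (Fin N) ℝ | g.det ≠ 0} := by
    intro g
    have hf : ({ε : ℝ | (-g).charpoly.eval ε = 0}).Finite := by
      have := (-g).charpoly.rootSet_finite ℝ
      refine this.subset fun ε hε => ?_
      rw [Polynomial.mem_rootSet]
      exact ⟨(Matrix.charpoly_monic _).ne_zero, by simpa using hε⟩
    have hd0 : Dense ({ε : ℝ | (-g).charpoly.eval ε = 0})ᶜ := hf.countable.dense_compl ℝ
    have hcont : Continuous fun ε : ℝ => ε • (1 : Matrix (Fin N) (Fin N) ℝ) + g := by fun_prop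
    have := map_mem_closure (t := {g : Matrix (Fin N) (Fin N) ℝ | g.det ≠ 0}) hcont (hd0 0) (fun ε hε => ?_)
    · simpa using this
    · simp only [Set.mem_ofPred_eq, Set.mem_compl_iff] at hε ⊢
      rw [Matrix.eval_charpoly] at hε
      convert hε using 3
      rw [sub_neg_eq_add, Matrix.scalar_apply, Matrix.smul_one_eq_diagonal]
  exact congrFun (hc1.ext_on hd hc2 fun g hg => sph_LQ e g X hg) g

lemma mp_transpose {N : ℕ} : MeasurePreserving (fun (u : Fin N → Fin N → ℝ) (i j : Fin N) => u j i) volume volume := by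
  let T : (Fin N → Fin N → ℝ) →ₗ[ℝ] (Fin N → Fin N → ℝ) :=
    { toFun := fun u i j => u j i, map_add' := fun _ _ => rfl, map_smul' := fun _ _ => rfl }
  have hTT : T * T = 1 := rfl
  have hdet : LinearMap.det T * LinearMap.det T = 1 := by rw [← map_mul, hTT, map_one]
  have h0 : LinearMap.det T ≠ 0 := fun h => by rw [h] at hdet; simp at hdet
  have h := Measure.map_linearMap_addHaar_eq_smul_addHaar (volume : Measure (Fin N → Fin N → ℝ)) h0
  have habs : |(LinearMap.det T)⁻¹| = 1 := by
    rw [abs_inv, inv_eq_one, ← abs_one, ← sq_eq_sq_iff_abs_eq_abs, sq, hdet, one_pow]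
  rw [habs, ENNReal.ofReal_one, one_smul] at h
  refine ⟨?_, h⟩
  fun_prop

lemma mp_right {N : ℕ} (k : OG N) : MeasurePreserving
    (fun (u : Fin N → Fin N → ℝ) => (Matrix.of u * k.1 : Matrix (Fin N) (Fin N) ℝ)) (volume : Measure (Fin N → Fin N → ℝ)) (volume : Measure (Fin N → Fin N → ℝ)) := by
  have := volume_preserving_pi (ι := Fin N) (f := fun _ v => (k⁻¹).1 *ᵥ v) fun _ => og_mp k⁻¹
  have h2 : (fun (u : Fin N → Fin N → ℝ) => (Matrix.of u * k.1 : Matrix (Fin N) (Fin N) ℝ)) =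
      fun (u : Fin N → Fin N → ℝ) i => (k⁻¹).1 *ᵥ u i := by
    funext u i j
    rw [og_inv_coe]
    simp [Matrix.mul_apply, Matrix.mulVec, dotProduct, mul_comm]
  rw [h2]
  exact this

lemma mp_left {N : ℕ} (k : OG N) : MeasurePreserving
    (fun (u : Fin N → Fin N → ℝ) => (k.1 * Matrix.of u : Matrix (Fin N) (Fin N) ℝ)) (volume : Measure (Fin N → Fin N → ℝ)) (volume : Measure (Fin N → Fin N → ℝ)) := by
  have := (mp_transpose.comp (mp_right k⁻¹)).comp (mp_transpose (N := N))
  have h2 : (fun (u : Fin N → Fin N → ℝ) => (k.1 * Matrix.of u : Matrix (Fin N) (Fin N) ℝ)) =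
      ((fun (u : Fin N → Fin N → ℝ) (i j : Fin N) => u j i) ∘ (fun (u : Fin N → Fin N → ℝ) => (Matrix.of u * (k⁻¹).1 : Matrix (Fin N) (Fin N) ℝ))) ∘
      (fun (u : Fin N → Fin N → ℝ) (i j : Fin N) => u j i) := by
    funext u i j
    simp only [Function.comp]
    rw [og_inv_coe]
    simp [Matrix.mul_apply, mul_comm]
  rw [h2]
  exact this

def dJ {N : ℕ} (ν μ : ℝ) (u : Fin N → Fin N → ℝ) : ℝ := (grm u).det ^ ν * (1 - grm u).det ^ μ

def sJ (N : ℕ) : Set (Fin N → Fin N → ℝ) := {u | (1 - grm u).PosDef}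

def mJ (N : ℕ) (ν μ : ℝ) : Measure (Fin N → Fin N → ℝ) :=
  (volume.restrict (sJ N)).withDensity fun u => ENNReal.ofReal (dJ ν μ u)

lemma dJ_meas {N : ℕ} (ν μ : ℝ) : Measurable (dJ (N := N) ν μ) := by
  have h1 : Measurable fun u : Fin N → Fin N → ℝ => (grm u).det := (Continuous.matrix_det continuous_gram).measurable
  have h2 : Measurable fun u : Fin N → Fin N → ℝ => (1 - grm u).det :=
    (Continuous.matrix_det (continuous_const.sub continuous_gram)).measurable
  exact (h1.pow_const _).mul (h2.pow_const _)

lemma dJ_nonneg {N : ℕ} (ν μ : ℝ) {u : Fin N → Fin N → ℝ} (hu : u ∈ sJ N) : 0 ≤ dJ ν μ u := by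
  have h := Matrix.posSemidef_self_mul_conjTranspose (Matrix.of u)
  simp only [Matrix.conjTranspose_eq_transpose_of_trivial] at h
  exact mul_nonneg (Real.rpow_nonneg h.det_nonneg _) (Real.rpow_nonneg (Matrix.PosDef.det_pos hu).le _)

lemma mJ_lint (N : ℕ) (ν μ : ℝ) (f : (Fin N → Fin N → ℝ) → ENNReal) (hf : Measurable f) :
    ∫⁻ u, f u ∂mJ N ν μ = ∫⁻ u, (sJ N).indicator (fun u => ENNReal.ofReal (dJ ν μ u)) u * f u := by
  have hs : MeasurableSet (sJ N) := posDef_meas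
  rw [mJ, lintegral_withDensity_eq_lintegral_mul _ (dJ_meas ν μ).ennreal_ofReal hf, ← lintegral_indicator hs]
  refine lintegral_congr fun u => ?_
  by_cases h : u ∈ sJ N <;> simp [h]

lemma mJ_mp {N : ℕ} (ν μ : ℝ) (T : (Fin N → Fin N → ℝ) → (Fin N → Fin N → ℝ)) (hT : MeasurePreserving T volume volume)
    (hT2 : ∀ u, u ∈ sJ N ↔ T u ∈ sJ N) (hT3 : ∀ u, dJ ν μ (T u) = dJ ν μ u) : MeasurePreserving T (mJ N ν μ) (mJ N ν μ) := by
  refine mp_of_lintegral hT.measurable fun f hf => ?_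
  rw [mJ_lint _ _ _ f hf, ← hT.lintegral_comp, mJ_lint N ν μ (fun u => f (T u)) (hf.comp hT.measurable)]
  · refine lintegral_congr fun u => ?_
    by_cases h : u ∈ sJ N
    · simp [h, (hT2 u).1 h, hT3]
    · have h2 : T u ∉ sJ N := fun h' => h ((hT2 u).2 h')
      simp [h, h2]
  · exact ((dJ_meas ν μ).ennreal_ofReal.indicator posDef_meas).mul hf

lemma mJ_right {N : ℕ} (ν μ : ℝ) (k : OG N) : MeasurePreserving
    (fun (u : Fin N → Fin N → ℝ) => (Matrix.of u * k.1 : Matrix (Fin N) (Fin N) ℝ)) (mJ N ν μ) (mJ N ν μ) := by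
  have h : ∀ u : Fin N → Fin N → ℝ, grm (Matrix.of u * k.1 : Matrix (Fin N) (Fin N) ℝ) = grm u := by
    intro u
    have : grm (Matrix.of u * k.1 : Matrix (Fin N) (Fin N) ℝ) = (Matrix.of u * k.1) * (Matrix.of u * k.1)ᵀ := rfl
    rw [this, Matrix.transpose_mul, Matrix.mul_assoc, ← Matrix.mul_assoc k.1, og_mul_tr, Matrix.one_mul]; rfl
  refine mJ_mp ν μ _ (mp_right k) (fun u => ?_) (fun u => ?_)
  · change (1 - grm u).PosDef ↔ (1 - grm (Matrix.of u * k.1 : Matrix (Fin N) (Fin N) ℝ)).PosDef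
    rw [h]
  · unfold dJ; rw [h]

lemma mJ_left {N : ℕ} (ν μ : ℝ) (k : OG N) : MeasurePreserving
    (fun (u : Fin N → Fin N → ℝ) => (k.1 * Matrix.of u : Matrix (Fin N) (Fin N) ℝ)) (mJ N ν μ) (mJ N ν μ) := by
  have h : ∀ u : Fin N → Fin N → ℝ, grm (k.1 * Matrix.of u : Matrix (Fin N) (Fin N) ℝ) = k.1 * grm u * k.1ᵀ := by
    intro u
    have : grm (k.1 * Matrix.of u : Matrix (Fin N) (Fin N) ℝ) = (k.1 * Matrix.of u) * (k.1 * Matrix.of u)ᵀ := rfl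
    rw [this, Matrix.transpose_mul]; simp only [grm, Matrix.mul_assoc]
  have h' : ∀ u : Fin N → Fin N → ℝ, 1 - k.1 * grm u * k.1ᵀ = k.1 * (1 - grm u) * k.1ᵀ := by
    intro u
    rw [Matrix.mul_sub, Matrix.sub_mul, Matrix.mul_one, og_mul_tr]
  have hdet : ∀ X : Matrix (Fin N) (Fin N) ℝ, (k.1 * X * k.1ᵀ).det = X.det := by
    intro X
    rw [Matrix.det_mul, Matrix.det_mul, Matrix.det_transpose]
    linear_combination X.det * og_det_sq k
  have hu : IsUnit k.1 := by
    rw [Matrix.isUnit_iff_isUnit_det]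
    exact IsUnit.of_mul_eq_one _ (og_det_sq k)
  refine mJ_mp ν μ _ (mp_left k) (fun u => ?_) (fun u => ?_)
  · change (1 - grm u).PosDef ↔ (1 - grm (k.1 * Matrix.of u : Matrix (Fin N) (Fin N) ℝ)).PosDef
    rw [h, h', ← Matrix.IsUnit.posDef_star_right_conjugate_iff (x := 1 - grm u) hu, Matrix.star_eq_conjTranspose,
        Matrix.conjTranspose_eq_transpose_of_trivial]
  · unfold dJ; rw [h, h', hdet, hdet]

lemma sJ_bdd {N : ℕ} : sJ N ⊆ Metric.closedBall 0 1 := by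
  intro u hu
  have hu' : (1 - grm u).PosDef := hu
  rw [mem_closedBall_zero_iff, pi_norm_le_iff_of_nonneg zero_le_one]
  intro i
  rw [pi_norm_le_iff_of_nonneg zero_le_one]
  intro j
  have h := hu'.diag_pos (i := i)
  have h2 : grm u i i = ∑ j, u i j ^ 2 := by simp [grm, Matrix.mul_apply, sq]
  rw [Matrix.sub_apply, Matrix.one_apply_eq, h2] at h
  have h3 : u i j ^ 2 ≤ ∑ j, u i j ^ 2 := Finset.single_le_sum (f := fun j => u i j ^ 2) (fun _ _ => sq_nonneg _) (Finset.mem_univ j)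
  rw [Real.norm_eq_abs]
  exact abs_le_one_iff_mul_self_le_one.2 (by nlinarith)

lemma mJ_ae {N : ℕ} (ν μ : ℝ) : ∀ᵐ u ∂mJ N ν μ, u ∈ sJ N :=
  (withDensity_absolutelyContinuous _ _).ae_le (ae_restrict_mem posDef_meas)
end

section
lemma lE_closed (e : ℕ → ℕ) : ∀ (n : ℕ) (p : ℕ) (hp : p < n),
    lE e n ⟨n - 1 - p, by omega⟩ = (∑ j ∈ Finset.Ico p n, e (2 * j + 1)) + (n - 1 - p) := by
  intro n
  induction n with
  | zero => intro p hp; omega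
  | succ n ih =>
    intro p hp
    rw [Finset.sum_Ico_succ_top (by omega)]
    rcases Nat.lt_or_ge p n with h | h
    · have h1 : (⟨n + 1 - 1 - p, by omega⟩ : Fin (n + 1)) = Fin.succ ⟨n - 1 - p, by omega⟩ := by
        ext; simp; omega
      rw [h1, lE, Fin.cons_succ, ih p h]
      omega
    · have h2 : p = n := by omega
      subst h2
      have h1 : (⟨p + 1 - 1 - p, by omega⟩ : Fin (p + 1)) = 0 := by ext; simp
      rw [h1, lE, Fin.cons_zero]; simp

lemma sum_even (e : ℕ → ℕ) (he : ∀ j, e (2 * j) = 0) (p n : ℕ) (hp : p ≤ n) :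
    ∑ j ∈ Finset.Ico (2 * p) (2 * n), e j = ∑ j ∈ Finset.Ico p n, e (2 * j + 1) := by
  induction n, hp using Nat.le_induction with
  | base => simp
  | succ n hn ih =>
    rw [Finset.sum_Ico_succ_top (by omega), show 2 * (n + 1) = 2 * n + 1 + 1 by ring,
      Finset.sum_Ico_succ_top (by omega), Finset.sum_Ico_succ_top (by omega), ih, he]
    ring

lemma prod_pair (f : ℕ → ℝ) (n : ℕ) : ∏ i ∈ Finset.range (2 * n), f i = ∏ p ∈ Finset.range n, (f (2 * p) * f (2 * p + 1)) := by
  induction n with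
  | zero => simp
  | succ n ih =>
    rw [show 2 * (n + 1) = 2 * n + 1 + 1 by ring, Finset.prod_range_succ, Finset.prod_range_succ, Finset.prod_range_succ, ih]
    ring

def tE (n : ℕ) (ν : ℝ) (e : ℕ → ℕ) (j : ℕ) : ℝ := e j + if j = 2 * n - 1 then ν else 0

def Gf (n : ℕ) (ν μ : ℝ) (l : ℕ) : ℝ := Real.Gamma (2 * ν + 2 * l + 1) / Real.Gamma (2 * ν + 2 * l + 2 * μ + 2 * n + 2)

lemma tE_sum (n : ℕ) (ν : ℝ) (e : ℕ → ℕ) (i : ℕ) (hi : i < 2 * n) :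
    ∑ j ∈ Finset.Ico i (2 * n), tE n ν e j = ((∑ j ∈ Finset.Ico i (2 * n), e j : ℕ) : ℝ) + ν := by
  unfold tE
  rw [Finset.sum_add_distrib, Finset.sum_ite_eq' , if_pos (by simp; omega)]
  push_cast; rfl

lemma tE_pos (n : ℕ) (ν : ℝ) (hν : -(1/2) < ν) (e : ℕ → ℕ) (i : ℕ) (hi : i < 2 * n) :
    0 < (((2 * n : ℕ) : ℝ) - i) / 2 + ∑ j ∈ Finset.Ico i (2 * n), tE n ν e j := by
  rw [tE_sum n ν e i hi]
  have h1 : (i : ℝ) + 1 ≤ ((2 * n : ℕ) : ℝ) := by exact_mod_cast hi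
  have h2 : (0:ℝ) ≤ ((∑ j ∈ Finset.Ico i (2 * n), e j : ℕ) : ℝ) := Nat.cast_nonneg _
  linarith

lemma dupl {x y : ℝ} (hx : 0 < x) (hy : 0 < y) :
    Real.Gamma (x + 1/2) / Real.Gamma (y + 1/2) * (Real.Gamma x / Real.Gamma y) =
      2 ^ (2 * y - 2 * x) * (Real.Gamma (2 * x) / Real.Gamma (2 * y)) := by
  have h1 := Real.Gamma_mul_Gamma_add_half x
  have h2 := Real.Gamma_mul_Gamma_add_half y
  have h3 : (2:ℝ) ^ (1 - 2 * x) = 2 ^ (2 * y - 2 * x) * 2 ^ (1 - 2 * y) := by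
    rw [← Real.rpow_add (by norm_num)]; congr 1; ring
  have h4 : (0:ℝ) < 2 ^ (1 - 2 * y) := by positivity
  have h5 := Real.Gamma_pos_of_pos (show 0 < 2 * y by linarith)
  have h6 : 0 < Real.sqrt Real.pi := Real.sqrt_pos.2 Real.pi_pos
  rw [div_mul_div_comm, mul_comm (Real.Gamma (x + 1/2)), mul_comm (Real.Gamma (y + 1/2)), h1, h2, h3]
  field_simp

lemma gprod_eq (n : ℕ) (ν μ : ℝ) (hν : -(1/2) < ν) (hμ : -(1/2) < μ) (e : ℕ → ℕ) (he : ∀ j, e (2 * j) = 0) :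
    gprod (2 * n) (tE n ν e) μ = ((2:ℝ) ^ (2 * n + 1 + 2 * μ)) ^ n * ∏ k : Fin n, Gf n ν μ (lE e n k) := by
  have key : ∀ p ∈ Finset.range n, Real.Gamma ((((2 * n : ℕ):ℝ) - (2 * p : ℕ)) / 2 + ∑ j ∈ Finset.Ico (2 * p) (2 * n), tE n ν e j) /
    Real.Gamma (((2 * n : ℕ):ℝ) - (2 * p : ℕ) / 2 + 1 / 2 + (∑ j ∈ Finset.Ico (2 * p) (2 * n), tE n ν e j) + μ) *
     (Real.Gamma ((((2 * n : ℕ):ℝ) - (2 * p + 1 : ℕ)) / 2 + ∑ j ∈ Finset.Ico (2 * p + 1) (2 * n), tE n ν e j) /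
    Real.Gamma (((2 * n : ℕ):ℝ) - (2 * p + 1 : ℕ) / 2 + 1 / 2 + (∑ j ∈ Finset.Ico (2 * p + 1) (2 * n), tE n ν e j) + μ)) =
     (2:ℝ) ^ (2 * n + 1 + 2 * μ) * Gf n ν μ ((∑ j ∈ Finset.Ico p n, e (2 * j + 1)) + (n - 1 - p)) := by
    intro p hp
    have hp := Finset.mem_range.1 hp
    rw [tE_sum n ν e _ (by omega), tE_sum n ν e _ (by omega)]
    have h0 : ∑ j ∈ Finset.Ico (2 * p + 1) (2 * n), e j = ∑ j ∈ Finset.Ico (2 * p) (2 * n), e j := by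
      rw [Finset.sum_eq_sum_Ico_succ_bot (show 2 * p < 2 * n by omega), he, zero_add]
    rw [h0, sum_even e he p n hp.le]
    set S := ∑ j ∈ Finset.Ico p n, e (2 * j + 1) with hS
    have hS0 : (0:ℝ) ≤ S := Nat.cast_nonneg _
    have hp1 : (p:ℝ) + 1 ≤ n := by exact_mod_cast hp
    have hp0 : (0:ℝ) ≤ p := Nat.cast_nonneg _
    have hc : ((n - 1 - p : ℕ) : ℝ) = n - 1 - p := by
      rw [Nat.cast_sub (by omega), Nat.cast_sub (by omega)]; simp
    have h := dupl (x := (n:ℝ) - p - 1/2 + S + ν) (y := 2 * n - p + S + ν + μ) (by linarith) (by linarith)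
    rw [Gf]
    convert h using 2
    · congr 2 <;> push_cast <;> ring
    · congr 2 <;> push_cast <;> ring
    · congr 1; ring
    · rw [Nat.cast_add, hc]
      congr 2 <;> ring
  unfold gprod
  rw [prod_pair, Finset.prod_congr rfl key, Finset.prod_mul_distrib, Finset.prod_const, Finset.card_range]
  congr 1
  rw [← Finset.prod_range_reflect, Finset.prod_range]
  refine Finset.prod_congr rfl fun k _ => ?_
  have hk := k.2
  rw [← lE_closed e n (n - 1 - k) (by omega)]
  congr 2
  ext; simp; omega

/-- moment of mJ -/
lemma mJ_pw (n : ℕ) (hn : 1 ≤ n) (ν μ : ℝ) (hν : -(1/2) < ν) (e : ℕ → ℕ) :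
    ∫⁻ u, ENNReal.ofReal (pw e (grm u)) ∂mJ (2 * n) ν μ = JI (2 * n) (tE n ν e) μ := by
  have hm : Measurable fun u : Fin (2*n) → Fin (2*n) → ℝ => ENNReal.ofReal (pw e (grm u)) :=
    ((continuous_pw e).comp continuous_gram).measurable.ennreal_ofReal
  rw [mJ_lint _ _ _ _ hm, JI]
  refine lintegral_congr fun u => ?_
  unfold Fj
  by_cases h : u ∈ sJ (2 * n)
  · have h' : (1 - grm u).PosDef := h
    rw [Set.indicator_of_mem h, if_pos h', ← ENNReal.ofReal_mul (dJ_nonneg ν μ h)]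
    congr 1
    unfold dJ pw
    have hl : (grm u).det ^ ν = ∏ j : Fin (2 * n), lm (grm u) j ^ (if (j:ℕ) = 2 * n - 1 then ν else 0) := by
      rw [Finset.prod_eq_single (⟨2 * n - 1, by omega⟩ : Fin (2 * n))]
      · simp only [if_true, lm]
        congr 1
        symm
        have hh : 2 * n - 1 + 1 = 2 * n := by omega
        have := Matrix.det_submatrix_equiv_self (finCongr hh) (grm u)
        rw [← this]
        rfl
      · intro b _ hb
        rw [if_neg (fun h => hb (Fin.ext h)), Real.rpow_zero]
      · simp
    rw [hl, mul_right_comm, ← Finset.prod_mul_distrib]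
    congr 1
    refine Finset.prod_congr rfl fun j _ => ?_
    unfold tE
    have h0 := lm_gram_nonneg u j
    rcases Nat.eq_zero_or_pos (e j) with hz | hz
    · rw [hz]; simp
    · have hz1 : (1:ℝ) ≤ e j := by exact_mod_cast hz
      rw [Real.rpow_add' h0, Real.rpow_natCast, mul_comm]
      split_ifs <;> linarith
  · have h' : ¬ (1 - grm u).PosDef := h
    rw [Set.indicator_of_notMem h, if_neg h', zero_mul]
end

section
lemma mJ_K (n : ℕ) (hn : 1 ≤ n) (ν μ : ℝ) (hν : -(1/2) < ν) (hμ : -(1/2) < μ) : ∃ K : ℝ, 0 < K ∧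
    ∀ e : ℕ → ℕ, (∀ j, e (2 * j) = 0) →
      ∫⁻ u, ENNReal.ofReal (pw e (grm u)) ∂mJ (2 * n) ν μ = ENNReal.ofReal (K * ∏ k : Fin n, Gf n ν μ (lE e n k)) := by
  obtain ⟨K, h0, ht, hK⟩ := JI_formula (2 * n) μ (by linarith)
  refine ⟨K.toReal * ((2:ℝ) ^ (2 * n + 1 + 2 * μ)) ^ n, mul_pos (ENNReal.toReal_pos h0 ht) (by positivity), fun e he => ?_⟩
  rw [mJ_pw n hn ν μ hν e, hK _ (fun i hi => tE_pos n ν hν e i hi), gprod_eq n ν μ hν hμ e he, mul_assoc,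
    ENNReal.ofReal_mul ENNReal.toReal_nonneg, ENNReal.ofReal_toReal ht]

lemma Gf_pos (n : ℕ) (ν μ : ℝ) (hν : -(1/2) < ν) (hμ : -(1/2) < μ) (hn : 1 ≤ n) (l : ℕ) : 0 < Gf n ν μ l := by
  have h1 : (1:ℝ) ≤ n := by exact_mod_cast hn
  have h2 : (0:ℝ) ≤ l := Nat.cast_nonneg _
  exact div_pos (Real.Gamma_pos_of_pos (by linarith)) (Real.Gamma_pos_of_pos (by linarith))

lemma lE_zero (n : ℕ) (k : Fin n) : lE 0 n k = k := by
  have hk := k.2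
  have h := lE_closed 0 n (n - 1 - k) (by omega)
  have h2 : (⟨n - 1 - (n - 1 - k), by omega⟩ : Fin n) = k := by ext; simp; omega
  rw [h2] at h
  rw [h]; simp; omega

lemma mJ_univ (n : ℕ) (hn : 1 ≤ n) (ν μ : ℝ) (hν : -(1/2) < ν) (hμ : -(1/2) < μ) :
    mJ (2 * n) ν μ Set.univ ≠ 0 ∧ mJ (2 * n) ν μ Set.univ ≠ ⊤ := by
  obtain ⟨K, hK0, hK⟩ := mJ_K n hn ν μ hν hμ
  have h := hK 0 (fun _ => rfl)
  have : mJ (2 * n) ν μ Set.univ = ENNReal.ofReal (K * ∏ k : Fin n, Gf n ν μ (lE 0 n k)) := by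
    rw [← h]; simp [pw]
  rw [this]
  have hp : 0 < K * ∏ k : Fin n, Gf n ν μ (lE 0 n k) := mul_pos hK0 (Finset.prod_pos fun k _ => Gf_pos n ν μ hν hμ hn _)
  exact ⟨by simpa using hp, ENNReal.ofReal_ne_top⟩

lemma mJ_int {N : ℕ} (ν μ : ℝ) [IsFiniteMeasure (mJ N ν μ)] (f : (Fin N → Fin N → ℝ) → ℝ) (hf : Continuous f) :
    Integrable f (mJ N ν μ) := by
  obtain ⟨C, hC⟩ := (isCompact_closedBall (0 : Fin N → Fin N → ℝ) 1).exists_bound_of_continuousOn hf.continuousOn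
  refine Integrable.of_bound hf.aestronglyMeasurable C ?_
  filter_upwards [mJ_ae ν μ] with u hu using hC u (sJ_bdd hu)

lemma mJ_int2 {N : ℕ} (ν μ : ℝ) [IsFiniteMeasure (mJ N ν μ)] (f : (Fin N → Fin N → ℝ) × OG N → ℝ) (hf : Continuous f) :
    Integrable f ((mJ N ν μ).prod (hm N)) := by
  obtain ⟨C, hC⟩ := ((isCompact_closedBall (0 : Fin N → Fin N → ℝ) 1).prod (isCompact_univ (X := OG N))).exists_bound_of_continuousOn hf.continuousOn
  refine Integrable.of_bound hf.aestronglyMeasurable C ?_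
  have h : ∀ᵐ p ∂(mJ N ν μ).prod (hm N), p.1 ∈ sJ N :=
    Measure.quasiMeasurePreserving_fst.ae (mJ_ae ν μ)
  filter_upwards [h] with p hp using hC p ⟨sJ_bdd hp, trivial⟩

lemma mJ_comp {N : ℕ} (ν μ : ℝ) {T : (Fin N → Fin N → ℝ) → (Fin N → Fin N → ℝ)} (hT : MeasurePreserving T (mJ N ν μ) (mJ N ν μ))
    (f : (Fin N → Fin N → ℝ) → ℝ) (hf : Continuous f) : ∫ u, f (T u) ∂mJ N ν μ = ∫ u, f u ∂mJ N ν μ := by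
  rw [← integral_map hT.measurable.aemeasurable hf.aestronglyMeasurable, hT.map_eq]

lemma mJ_eigen {N : ℕ} (ν μ : ℝ) [IsFiniteMeasure (mJ N ν μ)] (e : ℕ → ℕ) (X : Matrix (Fin N) (Fin N) ℝ) :
    ∫ u, sph e (Matrix.of u * X * (Matrix.of u)ᵀ) ∂mJ N ν μ = (∫ u, pw e (grm u) ∂mJ N ν μ) * sph e X := by
  have hof : Continuous fun u : Fin N → Fin N → ℝ => (Matrix.of u : Matrix (Fin N) (Fin N) ℝ) := continuous_id
  have hof1 : Continuous fun p : (Fin N → Fin N → ℝ) × OG N => (Matrix.of p.1 : Matrix (Fin N) (Fin N) ℝ) :=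
    hof.comp continuous_fst
  have hk : Continuous fun p : (Fin N → Fin N → ℝ) × OG N => p.2.1 := continuous_subtype_val.comp continuous_snd
  set f : (Fin N → Fin N → ℝ) → ℝ := fun u => pw e (Matrix.of u * X * (Matrix.of u)ᵀ) with hf
  have hfc : Continuous f := (continuous_pw e).comp ((hof.matrix_mul continuous_const).matrix_mul hof.matrix_transpose)
  have h1 : ∫ u, sph e (Matrix.of u * X * (Matrix.of u)ᵀ) ∂mJ N ν μ = ∫ u, f u ∂mJ N ν μ := by
    have e1 : ∀ u : Fin N → Fin N → ℝ, sph e (Matrix.of u * X * (Matrix.of u)ᵀ) =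
        ∫ k : OG N, f (k.1 * Matrix.of u : Matrix (Fin N) (Fin N) ℝ) ∂hm N := by
      intro u
      unfold sph
      refine integral_congr_ae (Filter.Eventually.of_forall fun k => ?_)
      change pw e (k.1 * (Matrix.of u * X * (Matrix.of u)ᵀ) * k.1ᵀ) = pw e ((k.1 * Matrix.of u) * X * (k.1 * Matrix.of u)ᵀ)
      rw [Matrix.transpose_mul]; simp only [Matrix.mul_assoc]
    simp_rw [e1]
    rw [integral_integral_swap]
    · have : ∀ k : OG N, ∫ u, f (k.1 * Matrix.of u : Matrix (Fin N) (Fin N) ℝ) ∂mJ N ν μ = ∫ u, f u ∂mJ N ν μ :=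
        fun k => mJ_comp ν μ (mJ_left ν μ k) f hfc
      simp [this]
    · exact mJ_int2 ν μ _ (hfc.comp (hk.matrix_mul hof1))
  have h2 : ∫ u, f u ∂mJ N ν μ = ∫ u, ∫ k : OG N, f (Matrix.of u * k.1 : Matrix (Fin N) (Fin N) ℝ) ∂hm N ∂mJ N ν μ := by
    rw [integral_integral_swap]
    · have : ∀ k : OG N, ∫ u, f (Matrix.of u * k.1 : Matrix (Fin N) (Fin N) ℝ) ∂mJ N ν μ = ∫ u, f u ∂mJ N ν μ :=
        fun k => mJ_comp ν μ (mJ_right ν μ k) f hfc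
      simp [this]
    · exact mJ_int2 ν μ _ (hfc.comp (hof1.matrix_mul hk))
  rw [h1, h2, ← integral_mul_const]
  refine integral_congr_ae (Filter.Eventually.of_forall fun u => ?_)
  exact sph_LQ_all e (Matrix.of u) X

/-- main output of Step 3 -/
lemma step3 (n : ℕ) (hn : 1 ≤ n) (ν μ : ℝ) (hν : -(1/2) < ν) (hμ : -(1/2) < μ) : ∃ K : ℝ, 0 < K ∧
    IsFiniteMeasure (mJ (2 * n) ν μ) ∧ (mJ (2 * n) ν μ).real Set.univ = K * ∏ k : Fin n, Gf n ν μ k ∧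
    ∀ (e : ℕ → ℕ), (∀ j, e (2 * j) = 0) → ∀ X : Matrix (Fin (2 * n)) (Fin (2 * n)) ℝ,
      ∫ u, sph e (Matrix.of u * X * (Matrix.of u)ᵀ) ∂mJ (2 * n) ν μ = K * (∏ k : Fin n, Gf n ν μ (lE e n k)) * sph e X := by
  obtain ⟨K, hK0, hK⟩ := mJ_K n hn ν μ hν hμ
  have hfin : IsFiniteMeasure (mJ (2 * n) ν μ) := ⟨lt_top_iff_ne_top.2 (mJ_univ n hn ν μ hν hμ).2⟩
  have key : ∀ (e : ℕ → ℕ), (∀ j, e (2 * j) = 0) → ∫ u, pw e (grm u) ∂mJ (2 * n) ν μ = K * (∏ k : Fin n, Gf n ν μ (lE e n k)) := by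
    intro e he
    rw [integral_eq_lintegral_of_nonneg_ae, hK e he, ENNReal.toReal_ofReal]
    · exact (mul_pos hK0 (Finset.prod_pos fun k _ => Gf_pos n ν μ hν hμ hn _)).le
    · exact Filter.Eventually.of_forall fun u => Finset.prod_nonneg fun j _ => pow_nonneg (lm_gram_nonneg u j) _
    · exact ((continuous_pw e).comp continuous_gram).aestronglyMeasurable
  refine ⟨K, hK0, hfin, ?_, fun e he X => ?_⟩
  · have := key 0 (fun _ => rfl)
    simp only [lE_zero] at this
    rw [← this]
    simp [pw]
  · rw [mJ_eigen, key e he]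
end

section
lemma andreief {n : ℕ} (m : Measure ℝ) [SigmaFinite m] (f g : Fin n → ℝ → ℝ) (h : ∀ k l, Integrable (fun x => f k x * g l x) m) :
    Integrable (fun a : Fin n → ℝ => (Matrix.of fun j k => f k (a j)).det * (Matrix.of fun j k => g k (a j)).det) (Measure.pi fun _ => m) ∧
    ∫ a : Fin n → ℝ, (Matrix.of fun j k => f k (a j)).det * (Matrix.of fun j k => g k (a j)).det ∂(Measure.pi fun _ => m) =
      n.factorial * (Matrix.of fun k l => ∫ x, f k x * g l x ∂m).det := by
  have hd : ∀ M : Matrix (Fin n) (Fin n) ℝ, M.det = ∑ σ : Equiv.Perm (Fin n), (Equiv.Perm.sign σ : ℝ) * ∏ i, M i (σ i) := by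
    intro M
    rw [← Matrix.det_transpose, Matrix.det_apply']; rfl
  have hexp : (fun a : Fin n → ℝ => (Matrix.of fun j k => f k (a j)).det * (Matrix.of fun j k => g k (a j)).det) =
      fun a => ∑ σ : Equiv.Perm (Fin n), ∑ τ : Equiv.Perm (Fin n), ((Equiv.Perm.sign σ : ℝ) * (Equiv.Perm.sign τ : ℝ)) *
        ∏ i, (f (σ i) (a i) * g (τ i) (a i)) := by
    funext a
    rw [hd, hd, Finset.sum_mul_sum]
    refine Finset.sum_congr rfl fun σ _ => Finset.sum_congr rfl fun τ _ => ?_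
    simp only [Matrix.of_apply, Finset.prod_mul_distrib]
    ring
  have hint : ∀ σ τ : Equiv.Perm (Fin n), Integrable (fun a : Fin n → ℝ => ((Equiv.Perm.sign σ : ℝ) * (Equiv.Perm.sign τ : ℝ)) *
        ∏ i, (f (σ i) (a i) * g (τ i) (a i))) (Measure.pi fun _ => m) := fun σ τ =>
    (Integrable.fintype_prod (f := fun i x => f (σ i) x * g (τ i) x) (fun i => h (σ i) (τ i))).const_mul _
  have hi2 := fun σ => integrable_finsetSum Finset.univ fun τ _ => hint σ τ
  rw [hexp]
  refine ⟨integrable_finsetSum _ fun σ _ => hi2 σ, ?_⟩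
  rw [integral_finsetSum _ fun σ _ => hi2 σ]
  have h3 : ∀ σ : Equiv.Perm (Fin n), ∫ a : Fin n → ℝ, ∑ τ : Equiv.Perm (Fin n), ((Equiv.Perm.sign σ : ℝ) * (Equiv.Perm.sign τ : ℝ)) *
        ∏ i, (f (σ i) (a i) * g (τ i) (a i)) ∂(Measure.pi fun _ => m) = (Matrix.of fun k l => ∫ x, f k x * g l x ∂m).det := by
    intro σ
    rw [integral_finsetSum _ fun τ _ => hint σ τ]
    have h4 : ∀ τ : Equiv.Perm (Fin n), ∫ a : Fin n → ℝ, ((Equiv.Perm.sign σ : ℝ) * (Equiv.Perm.sign τ : ℝ)) *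
        ∏ i, (f (σ i) (a i) * g (τ i) (a i)) ∂(Measure.pi fun _ => m) = (Equiv.Perm.sign σ : ℝ) * ((Equiv.Perm.sign τ : ℝ) *
          ∏ i, ((Matrix.of fun k l => ∫ x, f k x * g l x ∂m).submatrix σ id) i (τ i)) := by
      intro τ
      rw [integral_const_mul, integral_fintype_prod_eq_prod (fun i x => f (σ i) x * g (τ i) x), mul_assoc]
      rfl
    simp_rw [h4]
    rw [← Finset.mul_sum, ← hd, Matrix.det_permute, ← mul_assoc, ← Int.cast_mul, ← Units.val_mul, Int.units_mul_self]
    simp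
  simp_rw [h3]
  simp [Fintype.card_perm]

def kap (n : ℕ) (μ a b : ℝ) : ℝ := if a ≤ b then (1 - a / b) ^ (2 * (μ + (n : ℝ))) else 0

lemma kap_meas (n : ℕ) (μ b : ℝ) : Measurable fun a => kap n μ a b := by
  unfold kap
  exact Measurable.ite measurableSet_Iic (by fun_prop) measurable_const

lemma beta1 (n : ℕ) (hn : 1 ≤ n) (ν μ : ℝ) (hν : -(1/2) < ν) (hμ : -(1/2) < μ) (l : ℕ) {b : ℝ} (hb : 0 < b) :
    Integrable (fun a => a ^ (2 * l) * a ^ (2 * ν) * kap n μ a b) (volume.restrict (Set.Ioi 0)) ∧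
    ∫ a in Set.Ioi 0, a ^ (2 * l) * a ^ (2 * ν) * kap n μ a b =
      b ^ (2 * l) * b ^ (2 * ν + 1) * (Gf n ν μ l * Real.Gamma (2 * μ + 2 * n + 1)) := by
  have hn1 : (1:ℝ) ≤ n := by exact_mod_cast hn
  have hl0 : (0:ℝ) ≤ l := Nat.cast_nonneg l
  have hα : 0 < 2 * ν + 2 * l + 1 := by linarith
  have hβ : 0 < 2 * μ + 2 * n + 1 := by linarith
  have hL := lint_beta hα hβ
  have hB : ProbabilityTheory.beta (2 * ν + 2 * l + 1) (2 * μ + 2 * n + 1) = Gf n ν μ l * Real.Gamma (2 * μ + 2 * n + 1) := by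
    rw [ProbabilityTheory.beta, Gf, div_mul_eq_mul_div]; congr 2; ring
  -- unit integral
  have hF : ∀ x : ℝ, 0 < x → (b * x) ^ (2 * l) * (b * x) ^ (2 * ν) * kap n μ (b * x) b =
      (Set.Ioo (0:ℝ) 1).indicator (fun x => b ^ (2 * l) * b ^ (2 * ν) * (x ^ (2 * ν + 2 * l + 1 - 1) * (1 - x) ^ (2 * μ + 2 * n + 1 - 1))) x := by
    intro x hx
    unfold kap
    by_cases h1 : x < 1
    · rw [if_pos (by nlinarith), Set.indicator_of_mem (show x ∈ Set.Ioo (0:ℝ) 1 from ⟨hx, h1⟩), mul_div_cancel_left₀ _ hb.ne', mul_pow, Real.mul_rpow hb.le hx.le,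
        show 2 * ν + 2 * (l:ℝ) + 1 - 1 = 2 * ν + ((2 * l : ℕ) : ℝ) by push_cast; ring, Real.rpow_add hx, Real.rpow_natCast,
        show 2 * μ + 2 * (n:ℝ) + 1 - 1 = 2 * (μ + n) by ring]
      ring
    · rw [Set.indicator_of_notMem (fun h => h1 h.2)]
      rcases eq_or_lt_of_le (not_lt.1 h1) with h | h
      · rw [← h, mul_one, div_self hb.ne', sub_self, Real.zero_rpow (by linarith)]; simp
      · rw [if_neg (by nlinarith), mul_zero]
  have hn0 : ∀ x ∈ Set.Ioo (0:ℝ) 1, 0 ≤ x ^ (2 * ν + 2 * l + 1 - 1) * (1 - x) ^ (2 * μ + 2 * n + 1 - 1) := fun x hx =>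
    mul_nonneg (Real.rpow_nonneg hx.1.le _) (Real.rpow_nonneg (by linarith [hx.2]) _)
  have hI : IntegrableOn (fun x : ℝ => x ^ (2 * ν + 2 * l + 1 - 1) * (1 - x) ^ (2 * μ + 2 * n + 1 - 1)) (Set.Ioo 0 1) := by
    refine ⟨by fun_prop, ?_⟩
    rw [hasFiniteIntegral_iff_ofReal ((ae_restrict_mem measurableSet_Ioo).mono hn0), hL]
    exact ENNReal.ofReal_lt_top
  have hV : ∫ x in Set.Ioo (0:ℝ) 1, x ^ (2 * ν + 2 * l + 1 - 1) * (1 - x) ^ (2 * μ + 2 * n + 1 - 1) = Gf n ν μ l * Real.Gamma (2 * μ + 2 * n + 1) := by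
    rw [integral_eq_lintegral_of_nonneg_ae ((ae_restrict_mem measurableSet_Ioo).mono hn0) (by fun_prop), hL, hB, ENNReal.toReal_ofReal]
    exact mul_nonneg (Gf_pos n ν μ hν hμ hn l).le (Real.Gamma_pos_of_pos hβ).le
  have hI2 : IntegrableOn (fun x => (b * x) ^ (2 * l) * (b * x) ^ (2 * ν) * kap n μ (b * x) b) (Set.Ioi 0) := by
    have : IntegrableOn ((Set.Ioo (0:ℝ) 1).indicator (fun x => b ^ (2 * l) * b ^ (2 * ν) * (x ^ (2 * ν + 2 * l + 1 - 1) * (1 - x) ^ (2 * μ + 2 * n + 1 - 1)))) (Set.Ioi 0) :=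
      ((integrable_indicator_iff measurableSet_Ioo).2 (hI.const_mul _)).integrableOn
    exact this.congr_fun (fun x hx => (hF x hx).symm) measurableSet_Ioi
  constructor
  · have := (integrableOn_Ioi_comp_mul_left_iff (fun a => a ^ (2 * l) * a ^ (2 * ν) * kap n μ a b) 0 hb).1 hI2
    rw [mul_zero] at this
    exact this
  · have h5 := integral_comp_mul_left_Ioi (fun a => a ^ (2 * l) * a ^ (2 * ν) * kap n μ a b) 0 hb
    rw [mul_zero] at h5
    have h6 : ∫ x in Set.Ioi (0:ℝ), (b * x) ^ (2 * l) * (b * x) ^ (2 * ν) * kap n μ (b * x) b =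
        b ^ (2 * l) * b ^ (2 * ν) * (Gf n ν μ l * Real.Gamma (2 * μ + 2 * n + 1)) := by
      rw [setIntegral_congr_fun measurableSet_Ioi (fun x hx => hF x hx), setIntegral_indicator measurableSet_Ioo, ← hV, ← integral_const_mul]
      congr 2
      ext x; simp +contextual
    rw [h6] at h5
    rw [Real.rpow_add_one hb.ne']
    rw [smul_eq_mul, eq_comm, inv_mul_eq_iff_eq_mul₀ hb.ne'] at h5
    rw [h5]; ring
end

section
lemma Dmat_eq {n : ℕ} (a : Fin n → ℝ) : Dmat a = Dn (2 * n) (fun j => if h : j < n then a ⟨j, h⟩ else 0) := by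
  ext i j
  have := i.isLt
  simp only [Dmat, Dn, Matrix.of_apply]
  rw [dif_pos (show i.val / 2 < n by omega)]

lemma Dmat_tr {n : ℕ} (a : Fin n → ℝ) : (Dmat a)ᵀ = - Dmat a := by rw [Dmat_eq, Dn_tr]

lemma Dmat_det {n : ℕ} (a : Fin n → ℝ) (t : ℝ) :
    (t • (1 : Matrix (Fin (2 * n)) (Fin (2 * n)) ℝ) + Dmat a).det = ∏ j, (t ^ 2 + a j ^ 2) := by
  rw [Dmat_eq, det_Dn, show 2 * n / 2 = n by omega, Finset.prod_range]
  simp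

lemma DnS_Dmat {n : ℕ} (a : Fin n → ℝ) (ha : ∀ j, 0 ≤ a j) : DnS (2 * n) (fun j => a j ^ 2) = Dmat a := by
  rw [Dmat_eq, DnS]
  refine Dn_congr fun j hj => ?_
  have : j < n := by omega
  rw [dif_pos this, dif_pos this, Real.sqrt_sq (ha _)]

lemma continuous_Dmat {n : ℕ} : Continuous (Dmat (n := n)) := by
  refine continuous_matrix fun i j => ?_
  simp only [Dmat, Matrix.of_apply]
  split_ifs <;> fun_prop

lemma sph_Dmat {n : ℕ} (e : ℕ → ℕ) (he : ∀ j, e (2 * j) = 0) : ∃ C : ℝ, C ≠ 0 ∧ ∀ a : Fin n → ℝ, (∀ j, 0 < a j) →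
    sph e (Dmat a) * vdm (fun j => a j ^ 2) = C * (Matrix.of fun j k : Fin n => a j ^ (2 * lE e n k)).det := by
  obtain ⟨C, hC, h⟩ := sph_formula e he n
  refine ⟨C, hC, fun a ha => ?_⟩
  by_cases hi : Function.Injective a
  · set σ := Tuple.sort a with hσ
    have hm : StrictMono (a ∘ σ) := (Tuple.monotone_sort a).strictMono_of_injective (hi.comp σ.injective)
    have h1 := h (fun j => (a (σ j)) ^ 2) (fun j => pow_pos (ha _) _)
      (fun i j hij => pow_lt_pow_left₀ (hm hij) (ha _).le (by norm_num))
    rw [DnS_Dmat (fun j => a (σ j)) (fun j => (ha _).le)] at h1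
    have h2 : sph e (Dmat fun j => a (σ j)) = sph e (Dmat a) := by
      refine sph_of_det e _ _ (Dmat_tr _) (Dmat_tr _) fun t _ => ?_
      rw [Dmat_det, Dmat_det]
      exact Equiv.prod_comp σ (fun j => t ^ 2 + a j ^ 2)
    have h3 : vdm (fun j => a (σ j) ^ 2) = Equiv.Perm.sign σ * vdm (fun j => a j ^ 2) := by
      rw [vdm_eq_det, vdm_eq_det, ← Matrix.det_permute]; rfl
    have h4 : (Matrix.of fun j k : Fin n => (a (σ j) ^ 2) ^ lE e n k).det =
        Equiv.Perm.sign σ * (Matrix.of fun j k : Fin n => a j ^ (2 * lE e n k)).det := by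
      rw [← Matrix.det_permute]
      simp only [← pow_mul]; rfl
    rw [h2, h3, h4] at h1
    have hs : ((Equiv.Perm.sign σ : ℤ) : ℝ) ≠ 0 := by
      exact_mod_cast (Equiv.Perm.sign σ).ne_zero
    refine mul_left_cancel₀ hs ?_
    linear_combination h1
  · unfold Function.Injective at hi
    push Not at hi
    obtain ⟨i, j, hij, hne⟩ := hi
    rw [vdm_eq_det, Matrix.det_zero_of_row_eq hne, Matrix.det_zero_of_row_eq hne, mul_zero, mul_zero]
    · funext k; simp [hij]
    · funext k; simp [Matrix.vandermonde, hij]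

def pD (n : ℕ) (ν μ : ℝ) (ta a : Fin n → ℝ) : ℝ :=
            ((1 / (Nat.factorial n : ℝ)) *
              (∏ j ∈ Finset.range n,
                Real.Gamma (2 * ν + 2 * μ + 2 * n + 2 * ((j : ℝ) + 1)) /
                  (Real.Gamma (2 * ν + 2 * ((j : ℝ) + 1) - 1) *
                    Real.Gamma (2 * μ + 2 * n + 1))) *
              ((vdm fun j => (a j) ^ 2) / (vdm fun j => (ta j) ^ 2)) *
              ((∏ j, (a j) ^ (2 * ν)) / (∏ j, (ta j) ^ (2 * ν + 1))) *
              (Matrix.of fun j k : Fin n =>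
                if a j ≤ ta k then (1 - a j / ta k) ^ (2 * (μ + (n : ℝ))) else 0).det)

lemma restrict_pos (n : ℕ) : (volume : Measure (Fin n → ℝ)).restrict {a | ∀ j, 0 < a j} =
    Measure.pi fun _ => volume.restrict (Set.Ioi 0) := by
  rw [← Measure.restrict_pi_pi]
  congr 1
  ext a; simp

lemma pos_meas (n : ℕ) : MeasurableSet {a : Fin n → ℝ | ∀ j, 0 < a j} := by
  have : {a : Fin n → ℝ | ∀ j, 0 < a j} = Set.univ.pi fun _ => Set.Ioi 0 := by ext a; simp
  rw [this]; exact MeasurableSet.univ_pi fun _ => measurableSet_Ioi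

lemma vdm_ne {n : ℕ} (ta : Fin n → ℝ) (hta : ∀ j, 0 < ta j) (hta' : Function.Injective ta) : vdm (fun j => ta j ^ 2) ≠ 0 := by
  unfold vdm
  refine Finset.prod_ne_zero_iff.2 fun p hp => ?_
  have := (Finset.mem_filter.1 hp).2
  rw [sub_ne_zero]
  intro h
  have := hta' ((pow_left_inj₀ (hta _).le (hta _).le two_ne_zero).1 h)
  omega

lemma rhs_moment (n : ℕ) (hn : 1 ≤ n) (ν μ : ℝ) (hν : -(1/2) < ν) (hμ : -(1/2) < μ) (ta : Fin n → ℝ) (hta : ∀ j, 0 < ta j)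
    (hta' : Function.Injective ta) (e : ℕ → ℕ) (he : ∀ j, e (2 * j) = 0) :
    Integrable (fun a => sph e (Dmat a) * pD n ν μ ta a) (volume.restrict {a : Fin n → ℝ | ∀ j, 0 < a j}) ∧
    ∫ a in {a : Fin n → ℝ | ∀ j, 0 < a j}, sph e (Dmat a) * pD n ν μ ta a =
      (∏ k : Fin n, Gf n ν μ (lE e n k)) / (∏ k : Fin n, Gf n ν μ k) * sph e (Dmat ta) := by
  obtain ⟨C, hC0, hC⟩ := sph_Dmat (n := n) e he
  have hA := andreief (n := n) (volume.restrict (Set.Ioi 0)) (fun k x => x ^ (2 * lE e n k) * x ^ (2 * ν)) (fun k x => kap n μ x (ta k))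
    (fun k l => (beta1 n hn ν μ hν hμ _ (hta l)).1)
  rw [← restrict_pos] at hA
  set c0 := (1 / (Nat.factorial n : ℝ)) *
              (∏ j ∈ Finset.range n,
                Real.Gamma (2 * ν + 2 * μ + 2 * n + 2 * ((j : ℝ) + 1)) /
                  (Real.Gamma (2 * ν + 2 * ((j : ℝ) + 1) - 1) *
                    Real.Gamma (2 * μ + 2 * n + 1))) / (vdm fun j => (ta j) ^ 2) / (∏ j, (ta j) ^ (2 * ν + 1)) with hc0
  have hEq : ∀ a ∈ {a : Fin n → ℝ | ∀ j, 0 < a j}, (c0 * C) * ((Matrix.of fun j k => (a j) ^ (2 * lE e n k) * (a j) ^ (2 * ν)).det *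
      (Matrix.of fun j k => kap n μ (a j) (ta k)).det) = sph e (Dmat a) * pD n ν μ ta a := by
    intro a ha
    have h1 : (Matrix.of fun j k => (a j) ^ (2 * lE e n k) * (a j) ^ (2 * ν)).det =
        (∏ j, (a j) ^ (2 * ν)) * (Matrix.of fun j k : Fin n => a j ^ (2 * lE e n k)).det := by
      rw [← det_scale_rows]; simp only [mul_comm]
    have h2 := hC a ha
    have h3 : (Matrix.of fun j k : Fin n =>
                if a j ≤ ta k then (1 - a j / ta k) ^ (2 * (μ + (n : ℝ))) else 0).det = (Matrix.of fun j k => kap n μ (a j) (ta k)).det := rfl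
    rw [h1, pD, h3, hc0]
    simp only [div_eq_mul_inv]
    linear_combination (-1) * (1 * (Nat.factorial n : ℝ)⁻¹) * (∏ j ∈ Finset.range n,
                Real.Gamma (2 * ν + 2 * μ + 2 * n + 2 * ((j : ℝ) + 1)) *
                  (Real.Gamma (2 * ν + 2 * ((j : ℝ) + 1) - 1) *
                    Real.Gamma (2 * μ + 2 * n + 1))⁻¹) * (vdm fun j => (ta j) ^ 2)⁻¹ * (∏ j, (ta j) ^ (2 * ν + 1))⁻¹ * (∏ j, (a j) ^ (2 * ν)) * 
                    (Matrix.of fun j k => kap n μ (a j) (ta k)).det * h2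
  constructor
  · refine (hA.1.const_mul (c0 * C)).congr ?_
    filter_upwards [ae_restrict_mem (pos_meas n)] with a ha using hEq a ha
  · rw [← setIntegral_congr_fun (pos_meas n) hEq, integral_const_mul, hA.2]
    simp_rw [fun k l => (beta1 n hn ν μ hν hμ (lE e n k) (hta l)).2]
    have hd : (Matrix.of fun k l => ta l ^ (2 * lE e n k) * ta l ^ (2 * ν + 1) * (Gf n ν μ (lE e n k) * Real.Gamma (2 * μ + 2 * n + 1))).det =
        (∏ k, (Gf n ν μ (lE e n k) * Real.Gamma (2 * μ + 2 * n + 1))) * ((∏ l, ta l ^ (2 * ν + 1)) * (Matrix.of fun j k : Fin n => ta j ^ (2 * lE e n k)).det) := by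
      rw [← Matrix.det_transpose (Matrix.of fun j k : Fin n => ta j ^ (2 * lE e n k))]
      have h5 := det_scale_cols (fun l => ta l ^ (2 * ν + 1)) (fun k l => ta l ^ (2 * lE e n k))
      have h6 := det_scale_rows (fun k => Gf n ν μ (lE e n k) * Real.Gamma (2 * μ + 2 * n + 1)) (fun k l => ta l ^ (2 * lE e n k) * ta l ^ (2 * ν + 1))
      have h7 : (Matrix.of fun j k : Fin n => ta j ^ (2 * lE e n k))ᵀ = Matrix.of fun k l => ta l ^ (2 * lE e n k) := by ext; simp
      rw [h7, ← h5, ← h6]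
      simp only [mul_comm]
    rw [hd]
    have hv := vdm_ne ta hta hta'
    have hp : ∏ l, ta l ^ (2 * ν + 1) ≠ 0 := Finset.prod_ne_zero_iff.2 fun l _ => (Real.rpow_pos_of_pos (hta l) _).ne'
    have hf : (n.factorial : ℝ) ≠ 0 := by positivity
    have hG : Real.Gamma (2 * μ + 2 * n + 1) ≠ 0 := by
      have : (1:ℝ) ≤ n := by exact_mod_cast hn
      exact (Real.Gamma_pos_of_pos (by linarith)).ne'
    have hc : (∏ j ∈ Finset.range n,
                Real.Gamma (2 * ν + 2 * μ + 2 * n + 2 * ((j : ℝ) + 1)) /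
                  (Real.Gamma (2 * ν + 2 * ((j : ℝ) + 1) - 1) *
                    Real.Gamma (2 * μ + 2 * n + 1))) = (∏ k : Fin n, Gf n ν μ k)⁻¹ * (Real.Gamma (2 * μ + 2 * n + 1) ^ n)⁻¹ := by
      rw [Finset.prod_range, ← Finset.prod_inv_distrib]
      have : (Real.Gamma (2 * μ + 2 * n + 1) ^ n)⁻¹ = ∏ k : Fin n, (Real.Gamma (2 * μ + 2 * n + 1))⁻¹ := by simp
      rw [this, ← Finset.prod_mul_distrib]
      refine Finset.prod_congr rfl fun k _ => ?_
      rw [Gf, inv_div, div_mul_eq_div_mul_one_div, one_div]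
      congr 3 <;> ring
    have hC2 : sph e (Dmat ta) = C * (Matrix.of fun j k : Fin n => ta j ^ (2 * lE e n k)).det / vdm (fun j => ta j ^ 2) := by
      rw [← hC ta hta, mul_div_cancel_right₀ _ hv]
    have hGn : (∏ k : Fin n, Gf n ν μ k) ≠ 0 := Finset.prod_ne_zero_iff.2 fun k _ => (Gf_pos n ν μ hν hμ hn _).ne'
    rw [hC2, hc0, hc, Finset.prod_mul_distrib]
    simp only [Finset.prod_const, Finset.card_univ, Fintype.card_fin]
    generalize Real.Gamma (2 * μ + 2 * n + 1) = g0 at hG ⊢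
    field_simp
end

section
open scoped BigOperators BoundedContinuousFunction

lemma box_ext {n : ℕ} {R : ℝ} {P P' : Measure (Fin n → Set.Icc (-R) R)} [IsFiniteMeasure P] [IsFiniteMeasure P']
    (h : ∀ Q : MvPolynomial (Fin n) ℝ, ∫ y, MvPolynomial.eval (fun i => (y i : ℝ)) Q ∂P = ∫ y, MvPolynomial.eval (fun i => (y i : ℝ)) Q ∂P') :
    P = P' := by
  let c : Fin n → ((Fin n → Set.Icc (-R) R) →ᵇ ℝ) := fun i =>
    BoundedContinuousFunction.mkOfCompact ⟨fun y => (y i : ℝ), by fun_prop⟩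
  have hc : ∀ i y, c i y = (y i : ℝ) := fun i y => rfl
  have hev : ∀ (Q : MvPolynomial (Fin n) ℝ) y, (MvPolynomial.aeval c Q) y = MvPolynomial.eval (fun i => (y i : ℝ)) Q := by
    intro Q y
    induction Q using MvPolynomial.induction_on with
    | C a => simp
    | add p q hp hq => simp [hp, hq]
    | mul_X p i hp => simp [hp, hc]
  have hstar : ∀ a : (Fin n → Set.Icc (-R) R) →ᵇ ℝ, star a = a := fun a => by ext y; simp
  let A : StarSubalgebra ℝ ((Fin n → Set.Icc (-R) R) →ᵇ ℝ) :=
    { (MvPolynomial.aeval (R := ℝ) c).range with star_mem' := fun {a} ha => (hstar a).symm ▸ ha }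
  have hA : ∀ g, g ∈ A ↔ ∃ Q, MvPolynomial.aeval (R := ℝ) c Q = g := fun g => Iff.rfl
  refine ext_of_forall_mem_subalgebra_integral_eq_of_polish (𝕜 := ℝ) (A := A) ?_ ?_
  · intro x y hxy
    obtain ⟨i, hi⟩ := Function.ne_iff.1 hxy
    refine ⟨_, ⟨_, ⟨c i, (hA _).2 ⟨MvPolynomial.X i, MvPolynomial.aeval_X _ _⟩, rfl⟩, rfl⟩, ?_⟩
    intro h'
    exact hi (Subtype.ext h')
  · intro g hg
    obtain ⟨Q, rfl⟩ := (hA g).1 hg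
    simp_rw [hev]
    exact h Q

lemma moment_det {n : ℕ} {α β : Type*} [MeasurableSpace α] [MeasurableSpace β] (m1 : Measure α) [IsFiniteMeasure m1]
    (m2 : Measure β) (p : β → ℝ) (hpm : Measurable p) (hp : Integrable p m2) (E1 : α → Fin n → ℝ) (hE1 : Measurable E1)
    (E2 : β → Fin n → ℝ) (hE2 : Measurable E2) (R : ℝ) (hR : 0 ≤ R) (h1 : ∀ᵐ x ∂m1, ∀ i, |E1 x i| ≤ R)
    (h2 : ∀ᵐ x ∂m2, p x = 0 ∨ ∀ i, |E2 x i| ≤ R)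
    (h : ∀ Q : MvPolynomial (Fin n) ℝ, ∫ x, MvPolynomial.eval (E1 x) Q ∂m1 = ∫ x, MvPolynomial.eval (E2 x) Q * p x ∂m2)
    (ψ : (Fin n → ℝ) → ℝ) (hψ : Measurable ψ) (C : ℝ) (hC : ∀ y, |ψ y| ≤ C) :
    ∫ x, ψ (E1 x) ∂m1 = ∫ x, ψ (E2 x) * p x ∂m2 := by
  have hRR : -R ≤ R := by linarith
  let r : (Fin n → ℝ) → (Fin n → Set.Icc (-R) R) := fun y i => Set.projIcc (-R) R hRR (y i)
  have hr : Measurable r := by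
    have : Continuous r := continuous_pi fun i => continuous_projIcc.comp (continuous_apply i)
    exact this.measurable
  have hrv : ∀ y : Fin n → ℝ, (∀ i, |y i| ≤ R) → (fun i => ((r y i : Set.Icc (-R) R) : ℝ)) = y := by
    intro y hy
    funext i
    simp only [r]
    rw [Set.projIcc_of_mem hRR (abs_le.1 (hy i))]
  have hfin : ∀ q : β → ℝ, Integrable q m2 → IsFiniteMeasure (m2.withDensity fun x => ENNReal.ofReal (q x)) := by
    intro q hq
    exact isFiniteMeasure_withDensity_ofReal hq.2
  have := hfin p hp
  have := hfin (fun x => - p x) hp.neg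
  set P1 : Measure (Fin n → Set.Icc (-R) R) := m1.map (fun x => r (E1 x)) +
    (m2.withDensity fun x => ENNReal.ofReal (- p x)).map (fun x => r (E2 x)) with hP1
  set P2 : Measure (Fin n → Set.Icc (-R) R) := (m2.withDensity fun x => ENNReal.ofReal (p x)).map (fun x => r (E2 x)) with hP2
  have hrE1 : Measurable fun x => r (E1 x) := hr.comp hE1
  have hrE2 : Measurable fun x => r (E2 x) := hr.comp hE2
  have key : ∀ f : (Fin n → Set.Icc (-R) R) → ℝ, Measurable f → (∃ C, ∀ y, |f y| ≤ C) →
      (∫ y, f y ∂P1 - ∫ y, f y ∂P2 = ∫ x, f (r (E1 x)) ∂m1 - ∫ x, f (r (E2 x)) * p x ∂m2) := by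
    rintro f hf ⟨C, hC⟩
    have hbd : ∀ (P : Measure (Fin n → Set.Icc (-R) R)) [IsFiniteMeasure P], Integrable f P := fun P _ =>
      Integrable.of_bound hf.aestronglyMeasurable C (Filter.Eventually.of_forall hC)
    have hi : ∀ q : β → ℝ, Integrable q m2 → Integrable (fun x => f (r (E2 x)) * q x) m2 := fun q hq =>
      hq.bdd_mul (hf.comp hrE2).aestronglyMeasurable (Filter.Eventually.of_forall fun x => hC _)
    have hd : ∀ q : β → ℝ, Measurable q → Integrable q m2 →
        ∫ y, f y ∂(m2.withDensity fun x => ENNReal.ofReal (q x)).map (fun x => r (E2 x)) = ∫ x, f (r (E2 x)) * max (q x) 0 ∂m2 := by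
      intro q hqm hq
      rw [integral_map hrE2.aemeasurable hf.aestronglyMeasurable,
        integral_withDensity_eq_integral_toReal_smul hqm.ennreal_ofReal (Filter.Eventually.of_forall fun x => ENNReal.ofReal_lt_top)]
      refine integral_congr_ae (Filter.Eventually.of_forall fun x => ?_)
      simp only [ENNReal.toReal_ofReal', smul_eq_mul, mul_comm]
    rw [hP1, hP2, integral_add_measure (hbd _) (hbd _), hd p hpm hp, hd (fun x => - p x) hpm.neg hp.neg,
      integral_map hrE1.aemeasurable hf.aestronglyMeasurable, add_sub_assoc, ← integral_sub (hi (fun x => max (- p x) 0) hp.neg.pos_part) (hi _ hp.pos_part), sub_eq_add_neg, ← integral_neg]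
    congr 1
    refine integral_congr_ae (Filter.Eventually.of_forall fun x => ?_)
    simp only
    have := max_zero_sub_max_neg_zero_eq_self (p x)
    rw [max_comm (p x), max_comm (-p x)]
    rw [max_comm, max_comm (-p x)] at this
    linear_combination (-f (r (E2 x))) * this
  have hcong : ∀ f : (Fin n → ℝ) → ℝ, ∫ x, f (fun i => (r (E1 x) i : ℝ)) ∂m1 - ∫ x, f (fun i => (r (E2 x) i : ℝ)) * p x ∂m2 =
      ∫ x, f (E1 x) ∂m1 - ∫ x, f (E2 x) * p x ∂m2 := by
    intro f
    congr 1
    · refine integral_congr_ae ?_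
      filter_upwards [h1] with x hx
      rw [hrv _ hx]
    · refine integral_congr_ae ?_
      filter_upwards [h2] with x hx
      rcases hx with hx | hx
      · simp [hx]
      · rw [hrv _ hx]
  have hv : Measurable fun y : Fin n → Set.Icc (-R) R => (fun i => (y i : ℝ)) := by fun_prop
  have hPP : P1 = P2 := by
    refine box_ext fun Q => ?_
    have hcont : Continuous fun y : Fin n → Set.Icc (-R) R => MvPolynomial.eval (fun i => (y i : ℝ)) Q :=
      (MvPolynomial.continuous_eval Q).comp (by fun_prop)
    have hb : ∃ C, ∀ y : Fin n → Set.Icc (-R) R, |MvPolynomial.eval (fun i => (y i : ℝ)) Q| ≤ C := by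
      obtain ⟨C, hC⟩ := isCompact_univ.exists_bound_of_continuousOn hcont.continuousOn
      exact ⟨C, fun y => hC y trivial⟩
    have h3 := key _ hcont.measurable hb
    rw [hcong (fun y => MvPolynomial.eval y Q), h Q, sub_self, sub_eq_zero] at h3
    exact h3
  have h4 := key _ (hψ.comp hv) ⟨C, fun y => hC _⟩
  simp only [Function.comp] at h4
  rw [hPP, sub_self, hcong ψ] at h4
  linarith
end

section
def Wsp (n : ℕ) : Submodule ℝ ((Fin n → ℝ) → ℝ) :=
  Submodule.span ℝ {f | ∃ l : Fin n → ℕ, StrictMono l ∧ f = fun x => (Matrix.of fun j k : Fin n => x j ^ l k).det}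

lemma alt_mem {n : ℕ} (m : Fin n → ℕ) : (fun x : Fin n → ℝ => (Matrix.of fun j k : Fin n => x j ^ m k).det) ∈ Wsp n := by
  by_cases hi : Function.Injective m
  · set σ := Tuple.sort m with hσ
    have hm : StrictMono (m ∘ σ) := (Tuple.monotone_sort m).strictMono_of_injective (hi.comp σ.injective)
    have h1 : (fun x : Fin n → ℝ => (Matrix.of fun j k : Fin n => x j ^ m k).det) =
        ((Equiv.Perm.sign σ : ℤ) : ℝ) • fun x : Fin n → ℝ => (Matrix.of fun j k : Fin n => x j ^ (m ∘ σ) k).det := by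
      funext x
      have h2 := Matrix.det_permute' σ (Matrix.of fun j k : Fin n => x j ^ m k)
      have h3 : (Matrix.of fun j k : Fin n => x j ^ (m ∘ σ) k) = (Matrix.of fun j k : Fin n => x j ^ m k).submatrix id σ := rfl
      simp only [Pi.smul_apply, smul_eq_mul]
      rw [h3, h2, ← mul_assoc, ← Int.cast_mul, ← Units.val_mul, Int.units_mul_self]
      simp
    rw [h1]
    exact Submodule.smul_mem _ _ (Submodule.subset_span ⟨_, hm, rfl⟩)
  · unfold Function.Injective at hi
    push Not at hi
    obtain ⟨i, j, hij, hne⟩ := hi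
    have : (fun x : Fin n → ℝ => (Matrix.of fun j k : Fin n => x j ^ m k).det) = 0 := by
      funext x
      exact Matrix.det_zero_of_column_eq hne fun k => by simp [hij]
    rw [this]; exact Submodule.zero_mem _

lemma sym_mem {n : ℕ} (P : MvPolynomial (Fin n) ℝ)
    (hP : ∀ (σ : Equiv.Perm (Fin n)) (x : Fin n → ℝ), MvPolynomial.eval (fun i => x (σ i)) P = MvPolynomial.eval x P) :
    (fun x : Fin n → ℝ => MvPolynomial.eval x P * vdm x) ∈ Wsp n := by
  set P' : MvPolynomial (Fin n) ℝ := P * ∏ i : Fin n, MvPolynomial.X i ^ (i : ℕ) with hP'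
  have h1 : (fun x : Fin n → ℝ => MvPolynomial.eval x P * vdm x) =
      ∑ m ∈ P'.support, P'.coeff m • fun x : Fin n → ℝ => (Matrix.of fun j k : Fin n => x j ^ m k).det := by
    funext x
    have h2 : ∀ σ : Equiv.Perm (Fin n), MvPolynomial.eval (fun i => x (σ i)) P' = MvPolynomial.eval x P * ∏ i : Fin n, x (σ i) ^ (i : ℕ) := by
      intro σ
      rw [hP', map_mul, hP σ x, map_prod]; simp
    rw [vdm_eq_det, Matrix.det_apply', Finset.mul_sum, Finset.sum_apply]
    simp only [Matrix.vandermonde_apply, Pi.smul_apply, smul_eq_mul]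
    have h3 : ∀ σ : Equiv.Perm (Fin n), MvPolynomial.eval x P * (((Equiv.Perm.sign σ : ℤ) : ℝ) * ∏ i : Fin n, x (σ i) ^ (i : ℕ)) =
        ∑ m ∈ P'.support, P'.coeff m * (((Equiv.Perm.sign σ : ℤ) : ℝ) * ∏ i : Fin n, x (σ i) ^ m i) := by
      intro σ
      rw [mul_left_comm, ← h2 σ, MvPolynomial.eval_eq', Finset.mul_sum]
      exact Finset.sum_congr rfl fun m _ => by ring
    simp_rw [h3]
    rw [Finset.sum_comm]
    refine Finset.sum_congr rfl fun m _ => ?_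
    rw [← Finset.mul_sum, Matrix.det_apply']
    rfl
  rw [h1]
  exact Submodule.sum_mem _ fun m _ => Submodule.smul_mem _ _ (alt_mem _)

def Hsp (n : ℕ) : Submodule ℝ (Matrix (Fin (2 * n)) (Fin (2 * n)) ℝ → ℝ) :=
  Submodule.span ℝ {f | ∃ e : ℕ → ℕ, (∀ j, e (2 * j) = 0) ∧ f = sph e}

lemma Hsp_cont {n : ℕ} {h : Matrix (Fin (2 * n)) (Fin (2 * n)) ℝ → ℝ} (hh : h ∈ Hsp n) : Continuous h := by
  induction hh using Submodule.span_induction with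
  | mem f hf => obtain ⟨e, _, rfl⟩ := hf; exact continuous_sph e
  | zero => exact continuous_const
  | add f g _ _ hf hg => exact hf.add hg
  | smul c f _ hf => exact hf.const_smul c

lemma Hsp_conj {n : ℕ} {h : Matrix (Fin (2 * n)) (Fin (2 * n)) ℝ → ℝ} (hh : h ∈ Hsp n) (q : OG (2 * n)) (X) :
    h (q.1 * X * q.1ᵀ) = h X := by
  induction hh using Submodule.span_induction with
  | mem f hf => obtain ⟨e, _, rfl⟩ := hf; exact sph_conj e X q
  | zero => rfl
  | add f g _ _ hf hg => simp [hf, hg]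
  | smul c f _ hf => simp [hf]

lemma W_to_H {n : ℕ} {f : (Fin n → ℝ) → ℝ} (hf : f ∈ Wsp n) : ∃ h ∈ Hsp n, ∀ a : Fin n → ℝ, (∀ j, 0 < a j) →
    h (Dmat a) * vdm (fun j => a j ^ 2) = f (fun j => a j ^ 2) := by
  induction hf using Submodule.span_induction with
  | mem f hf =>
    obtain ⟨l, hl, rfl⟩ := hf
    obtain ⟨e, he, hel⟩ := exists_e n l hl
    obtain ⟨C, hC0, hC⟩ := sph_Dmat (n := n) e he
    refine ⟨C⁻¹ • sph e, Submodule.smul_mem _ _ (Submodule.subset_span ⟨e, he, rfl⟩), fun a ha => ?_⟩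
    rw [Pi.smul_apply, smul_eq_mul, mul_assoc, hC a ha, ← mul_assoc, inv_mul_cancel₀ hC0, one_mul, hel]
    simp only [← pow_mul]
  | zero => exact ⟨0, Submodule.zero_mem _, fun a _ => by simp⟩
  | add f g _ _ hf hg =>
    obtain ⟨h, hh, h1⟩ := hf
    obtain ⟨k, hk, h2⟩ := hg
    refine ⟨h + k, Submodule.add_mem _ hh hk, fun a ha => ?_⟩
    rw [Pi.add_apply, Pi.add_apply, add_mul, h1 a ha, h2 a ha]
  | smul c f _ hf =>
    obtain ⟨h, hh, h1⟩ := hf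
    refine ⟨c • h, Submodule.smul_mem _ _ hh, fun a ha => ?_⟩
    rw [Pi.smul_apply, Pi.smul_apply, smul_eq_mul, smul_eq_mul, mul_assoc, h1 a ha]

/-- invariants -/
def eX {n : ℕ} (X : Matrix (Fin (2 * n)) (Fin (2 * n)) ℝ) (i : Fin n) : ℝ :=
  (((i : ℝ) + 1) • (1 : Matrix (Fin (2 * n)) (Fin (2 * n)) ℝ) + X).det

lemma continuous_eX {n : ℕ} : Continuous (eX (n := n)) :=
  continuous_pi fun _ => (continuous_const.add continuous_id).matrix_det

lemma eX_Dmat {n : ℕ} (a : Fin n → ℝ) (i : Fin n) : eX (Dmat a) i = ∏ j, (((i : ℝ) + 1) ^ 2 + a j ^ 2) := Dmat_det a _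

lemma eX_conj {n : ℕ} (q : OG (2 * n)) (X : Matrix (Fin (2 * n)) (Fin (2 * n)) ℝ) : eX (q.1 * X * q.1ᵀ) = eX X := by
  funext i; exact og_det_conj q _ X

lemma canonD {n : ℕ} (X : Matrix (Fin (2 * n)) (Fin (2 * n)) ℝ) (hX : Xᵀ = -X) :
    ∃ (k : OG (2 * n)) (a : Fin n → ℝ), (∀ j, 0 ≤ a j) ∧ Monotone a ∧ X = k.1 * Dmat a * k.1ᵀ := by
  obtain ⟨k, a, h0, hm, h⟩ := canon (2 * n) X hX
  refine ⟨k, fun j => a j, fun j => h0 _, fun i j hij => hm i j hij (by omega), ?_⟩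
  rw [h, Dmat_eq]
  congr 2
  exact Dn_congr fun j hj => by rw [dif_pos (show j < n by omega)]

lemma poly_H {n : ℕ} (Q : MvPolynomial (Fin n) ℝ) : ∃ h ∈ Hsp n, ∀ X : Matrix (Fin (2 * n)) (Fin (2 * n)) ℝ, Xᵀ = -X →
    MvPolynomial.eval (eX X) Q = h X := by
  set P : MvPolynomial (Fin n) ℝ := MvPolynomial.bind₁ (fun i : Fin n => ∏ j, (MvPolynomial.C (((i : ℝ) + 1) ^ 2) + MvPolynomial.X j)) Q with hP
  have hev : ∀ x : Fin n → ℝ, MvPolynomial.eval x P = MvPolynomial.eval (fun i : Fin n => ∏ j, (((i : ℝ) + 1) ^ 2 + x j)) Q := by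
    intro x
    rw [hP]
    have := MvPolynomial.eval₂Hom_bind₁ (RingHom.id ℝ) x (fun i : Fin n => ∏ j, (MvPolynomial.C (((i : ℝ) + 1) ^ 2) + MvPolynomial.X j)) Q
    refine this.trans ?_
    congr 1
    simp [MvPolynomial.eval, map_prod]
  obtain ⟨h, hh, h1⟩ := W_to_H (sym_mem P (fun σ x => by
    rw [hev, hev]
    congr 2
    funext i
    exact Equiv.prod_comp σ (fun j => ((i : ℝ) + 1) ^ 2 + x j)))
  have h2 : ∀ a : Fin n → ℝ, (∀ j, 0 < a j) → StrictMono a → MvPolynomial.eval (eX (Dmat a)) Q = h (Dmat a) := by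
    intro a ha hm
    have h3 := h1 a ha
    have hv := vdm_ne a ha hm.injective
    rw [mul_left_inj' hv, hev] at h3
    rw [h3]
    congr 2
    funext i; exact eX_Dmat a i
  refine ⟨h, hh, fun X hX => ?_⟩
  obtain ⟨k, a, ha, hm, rfl⟩ := canonD X hX
  rw [eX_conj, Hsp_conj hh]
  let b : ℝ → Fin n → ℝ := fun ε j => a j + ε * ((j : ℝ) + 1)
  have hb : Continuous fun ε => Dmat (b ε) := continuous_Dmat.comp (by fun_prop)
  have hc1 : Continuous fun ε => MvPolynomial.eval (eX (Dmat (b ε))) Q :=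
    (MvPolynomial.continuous_eval Q).comp (continuous_eX.comp hb)
  have hc2 : Continuous fun ε => h (Dmat (b ε)) := (Hsp_cont hh).comp hb
  have hb0 : b 0 = a := by funext j; simp [b]
  have t1 : Filter.Tendsto (fun ε => MvPolynomial.eval (eX (Dmat (b ε))) Q) (nhdsWithin 0 (Set.Ioi 0)) (nhds (MvPolynomial.eval (eX (Dmat a)) Q)) := by
    have := (hc1.tendsto 0).mono_left (nhdsWithin_le_nhds (s := Set.Ioi 0))
    rwa [hb0] at this
  have t2 : Filter.Tendsto (fun ε => h (Dmat (b ε))) (nhdsWithin 0 (Set.Ioi 0)) (nhds (h (Dmat a))) := by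
    have := (hc2.tendsto 0).mono_left (nhdsWithin_le_nhds (s := Set.Ioi 0))
    rwa [hb0] at this
  refine tendsto_nhds_unique (t1.congr' ?_) t2
  filter_upwards [self_mem_nhdsWithin] with ε hε
  have hε' : 0 < ε := hε
  refine h2 _ (fun j => ?_) (fun i j hij => ?_)
  · have := ha j
    have : 0 < ε * ((j : ℝ) + 1) := by positivity
    simp only [b]; linarith
  · have h4 : (i : ℝ) < j := by exact_mod_cast hij
    have h5 := hm hij.le
    simp only [b]
    nlinarith

lemma eX_inj {n : ℕ} (a b : Fin n → ℝ) (ha : ∀ j, 0 ≤ a j) (hb : ∀ j, 0 ≤ b j) (hma : Monotone a) (hmb : Monotone b)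
    (h : eX (Dmat a) = eX (Dmat b)) : a = b := by
  let p : (Fin n → ℝ) → Polynomial ℝ := fun a => ∏ j, (Polynomial.X - Polynomial.C (- (a j) ^ 2))
  have hmon : ∀ a, (p a).Monic := fun a => Polynomial.monic_prod_of_monic _ _ fun j _ => Polynomial.monic_X_sub_C _
  have hdeg : ∀ a, (p a).degree = n := by
    intro a
    rw [Polynomial.degree_eq_natDegree (hmon a).ne_zero, Polynomial.natDegree_prod_of_monic _ _ fun j _ => Polynomial.monic_X_sub_C _]
    simp only [Polynomial.natDegree_X_sub_C]
    simp
  have hpe : ∀ a t, (p a).eval t = ∏ j, (t + a j ^ 2) := by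
    intro a t
    simp [p, Polynomial.eval_prod]
  have hpp : p a = p b := by
    refine Polynomial.eq_of_degree_sub_lt_of_eval_index_eq (Finset.univ : Finset (Fin n)) (v := fun i : Fin n => ((i : ℝ) + 1) ^ 2) ?_ ?_ ?_
    · intro i _ j _ hij
      have : (i : ℝ) + 1 = j + 1 := (pow_left_inj₀ (by positivity) (by positivity) two_ne_zero).1 hij
      have : (i : ℝ) = j := by linarith
      exact Fin.ext (by exact_mod_cast this)
    · have := Polynomial.degree_sub_lt ((hdeg a).trans (hdeg b).symm) (hmon a).ne_zero ((hmon a).leadingCoeff.trans (hmon b).leadingCoeff.symm)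
      rw [hdeg] at this
      simpa using this
    · intro i _
      have := congrFun h i
      rw [eX_Dmat, eX_Dmat] at this
      rw [hpe, hpe, this]
  have hsq : (fun j => a j ^ 2) = fun j => b j ^ 2 := by
    refine sorted_unique _ _ (fun i j hij => pow_le_pow_left₀ (ha i) (hma hij) 2) (fun i j hij => pow_le_pow_left₀ (hb i) (hmb hij) 2)
      Set.univ Set.infinite_univ fun t _ => ?_
    have h6 := congrArg (Polynomial.eval (-t)) hpp
    rw [hpe, hpe] at h6
    have h7 : ∀ c : Fin n → ℝ, ∏ j, (t - c j ^ 2) = (-1) ^ n * ∏ j, (-t + c j ^ 2) := by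
      intro c
      have : ((-1 : ℝ)) ^ n = ∏ j : Fin n, (-1) := by simp
      rw [this, ← Finset.prod_mul_distrib]
      exact Finset.prod_congr rfl fun j _ => by ring
    rw [h7, h7, h6]
  funext j
  exact (pow_left_inj₀ (ha j) (hb j) two_ne_zero).1 (congrFun hsq j)

lemma exists_psi {n : ℕ} (φ : Matrix (Fin (2 * n)) (Fin (2 * n)) ℝ → ℝ) (hφ : IsInvTest (2 * n) φ) :
    ∃ ψ : (Fin n → ℝ) → ℝ, Measurable ψ ∧ (∃ C, ∀ y, |ψ y| ≤ C) ∧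
      ∀ X : Matrix (Fin (2 * n)) (Fin (2 * n)) ℝ, Xᵀ = -X → ψ (eX X) = φ X := by
  obtain ⟨hm, ⟨C, hC⟩, hinv⟩ := hφ
  let s : Set (Fin n → ℝ) := {a | ∀ j, 0 ≤ a j} ∩ {a | Monotone a}
  have hs : MeasurableSet s := by
    refine IsClosed.measurableSet (IsClosed.inter ?_ ?_)
    · have : {a : Fin n → ℝ | ∀ j, 0 ≤ a j} = Set.Ici 0 := by ext a; simp [Pi.le_def]
      rw [this]; exact isClosed_Ici
    · exact isClosed_monotone
  have hc : Continuous fun a : Fin n → ℝ => eX (Dmat a) := continuous_eX.comp continuous_Dmat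
  have hemb := ContinuousOn.measurableEmbedding hs hc.continuousOn
    (fun a ha b hb hab => eX_inj a b ha.1 hb.1 ha.2 hb.2 hab)
  obtain ⟨g, hg, hgs⟩ := hemb.exists_measurable_extend (g := fun a : s => φ (Dmat a.1))
    (hm.comp (continuous_Dmat.measurable.comp measurable_subtype_coe)) (fun _ => inferInstance)
  have hC0 : 0 ≤ C := (abs_nonneg _).trans (hC 0)
  refine ⟨fun y => max (-C) (min C (g y)), by fun_prop, ⟨C, fun y => ?_⟩, fun X hX => ?_⟩
  · rw [abs_le]
    exact ⟨le_max_left _ _, max_le (by linarith) (min_le_left _ _)⟩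
  · obtain ⟨k, a, ha, hma, rfl⟩ := canonD X hX
    have h1 : g (eX (Dmat a)) = φ (Dmat a) := congrFun hgs ⟨a, ha, hma⟩
    rw [hinv _ (Dmat_tr a) k.1 k.2, eX_conj]
    simp only
    rw [h1]
    have := abs_le.1 (hC (Dmat a))
    rw [min_eq_right this.2, max_eq_right this.1]
end

section
lemma pD_meas (n : ℕ) (ν μ : ℝ) (ta : Fin n → ℝ) : Measurable (pD n ν μ ta) := by
  unfold pD
  have h1 : Measurable fun a : Fin n → ℝ => vdm fun j => (a j) ^ 2 := by
    unfold vdm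
    fun_prop
  have h2 : Measurable fun a : Fin n → ℝ => ∏ j, (a j) ^ (2 * ν) := by fun_prop
  have h3 : Measurable fun a : Fin n → ℝ => (Matrix.of fun j k : Fin n =>
                if a j ≤ ta k then (1 - a j / ta k) ^ (2 * (μ + (n : ℝ))) else 0).det := by
    simp only [Matrix.det_apply]
    refine Finset.measurable_sum _ fun σ _ => Measurable.const_smul (Finset.measurable_prod _ fun i _ => ?_) _
    exact (kap_meas n μ (ta i)).comp (measurable_pi_apply (σ i))
  exact ((measurable_const.mul (h1.div_const _)).mul (h2.div_const _)).mul h3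

lemma pD_zero (n : ℕ) (ν μ : ℝ) (ta a : Fin n → ℝ) (M : ℝ) (hM : ∀ k, ta k ≤ M) (j : Fin n) (hj : M < a j) : pD n ν μ ta a = 0 := by
  unfold pD
  rw [Matrix.det_eq_zero_of_row_eq_zero j, mul_zero]
  intro k
  simp only [Matrix.of_apply]
  rw [if_neg]
  exact not_le.2 ((hM k).trans_lt hj)

lemma sphOne {N : ℕ} (X : Matrix (Fin N) (Fin N) ℝ) : sph 0 X = 1 := by
  simp [sph, pw]

lemma anti_conj {N : ℕ} (g X : Matrix (Fin N) (Fin N) ℝ) (hX : Xᵀ = -X) : (g * X * gᵀ)ᵀ = -(g * X * gᵀ) := by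
  simp [Matrix.transpose_mul, hX, Matrix.mul_assoc]

lemma mJ_set {n : ℕ} (ν μ : ℝ) (f : (Fin (2 * n) → Fin (2 * n) → ℝ) → ℝ) :
    ∫ u in jacDom n, f u * jacDens n ν μ u = ∫ u, f u ∂mJ (2 * n) ν μ := by
  have hs : MeasurableSet (sJ (2 * n)) := posDef_meas
  unfold mJ
  rw [integral_withDensity_eq_integral_toReal_smul (dJ_meas ν μ).ennreal_ofReal (Filter.Eventually.of_forall fun _ => ENNReal.ofReal_lt_top)]
  refine setIntegral_congr_fun hs fun u hu => ?_
  simp only [ENNReal.toReal_ofReal (dJ_nonneg ν μ hu), smul_eq_mul]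
  exact mul_comm _ _

lemma hsp_moment (n : ℕ) (hn : 1 ≤ n) (ν μ : ℝ) (hν : -(1/2) < ν) (hμ : -(1/2) < μ) (ta : Fin n → ℝ) (hta : ∀ j, 0 < ta j)
    (hta' : Function.Injective ta) {h : Matrix (Fin (2 * n)) (Fin (2 * n)) ℝ → ℝ} (hh : h ∈ Hsp n) :
    Integrable (fun a => h (Dmat a) * pD n ν μ ta a) (volume.restrict {a : Fin n → ℝ | ∀ j, 0 < a j}) ∧
    ∫ u, h (Matrix.of u * Dmat ta * (Matrix.of u)ᵀ) ∂mJ (2 * n) ν μ = (mJ (2 * n) ν μ).real Set.univ *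
      ∫ a in {a : Fin n → ℝ | ∀ j, 0 < a j}, h (Dmat a) * pD n ν μ ta a := by
  obtain ⟨K, hK0, hfin, hKu, hK⟩ := step3 n hn ν μ hν hμ
  have hc : Continuous fun u : Fin (2 * n) → Fin (2 * n) → ℝ => Matrix.of u * Dmat ta * (Matrix.of u)ᵀ := by
    have : Continuous fun u : Fin (2 * n) → Fin (2 * n) → ℝ => Matrix.of u := continuous_id
    exact (this.matrix_mul continuous_const).matrix_mul this.matrix_transpose
  have hI : ∀ f ∈ Hsp n, Integrable (fun u => f (Matrix.of u * Dmat ta * (Matrix.of u)ᵀ)) (mJ (2 * n) ν μ) :=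
    fun f hf => mJ_int ν μ _ ((Hsp_cont hf).comp hc)
  induction hh using Submodule.span_induction with
  | mem f hf =>
    obtain ⟨e, he, rfl⟩ := hf
    have h1 := rhs_moment n hn ν μ hν hμ ta hta hta' e he
    refine ⟨h1.1, ?_⟩
    rw [h1.2, hK e he, hKu]
    have : (∏ k : Fin n, Gf n ν μ k) ≠ 0 := Finset.prod_ne_zero_iff.2 fun k _ => (Gf_pos n ν μ hν hμ hn _).ne'
    field_simp
  | zero => simp
  | add f g hf' hg' hf hg =>
    simp only [Pi.add_apply, add_mul]
    refine ⟨hf.1.add hg.1, ?_⟩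
    rw [integral_add (hI f hf') (hI g hg'), integral_add hf.1 hg.1, hf.2, hg.2]
    ring
  | smul c f _ hf =>
    simp only [Pi.smul_apply, smul_eq_mul, mul_assoc c]
    refine ⟨hf.1.const_mul c, ?_⟩
    rw [integral_const_mul, integral_const_mul, hf.2]
    ring

lemma main_conv (n : ℕ) (hn : 1 ≤ n) (ν μ : ℝ) (hν : -(1/2) < ν) (hμ : -(1/2) < μ) (ta : Fin n → ℝ) (hta : ∀ j, 0 < ta j)
    (hta' : Function.Injective ta) (φ : Matrix (Fin (2 * n)) (Fin (2 * n)) ℝ → ℝ) (hφ : IsInvTest (2 * n) φ) :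
    ∫ u, φ (Matrix.of u * Dmat ta * (Matrix.of u)ᵀ) ∂mJ (2 * n) ν μ = (mJ (2 * n) ν μ).real Set.univ *
      ∫ a in {a : Fin n → ℝ | ∀ j, 0 < a j}, φ (Dmat a) * pD n ν μ ta a := by
  obtain ⟨K, hK0, hfin, hKu, -⟩ := step3 n hn ν μ hν hμ
  set Z := (mJ (2 * n) ν μ).real Set.univ
  have hc : Continuous fun u : Fin (2 * n) → Fin (2 * n) → ℝ => Matrix.of u * Dmat ta * (Matrix.of u)ᵀ := by
    have : Continuous fun u : Fin (2 * n) → Fin (2 * n) → ℝ => Matrix.of u := continuous_id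
    exact (this.matrix_mul continuous_const).matrix_mul this.matrix_transpose
  have hc1 := continuous_eX.comp hc
  have hc2 := (continuous_eX (n := n)).comp continuous_Dmat
  obtain ⟨M, hM⟩ : ∃ M : ℝ, ∀ k, ta k ≤ M := ⟨∑ k, ta k, fun k => Finset.single_le_sum (f := ta) (fun i _ => (hta i).le) (Finset.mem_univ k)⟩
  obtain ⟨R1, hR1⟩ := (isCompact_closedBall (0 : Fin (2 * n) → Fin (2 * n) → ℝ) 1).exists_bound_of_continuousOn hc1.continuousOn
  obtain ⟨R2, hR2⟩ := (isCompact_Icc (a := (fun _ => 0 : Fin n → ℝ)) (b := fun _ => M)).exists_bound_of_continuousOn hc2.continuousOn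
  obtain ⟨ψ, hψ, ⟨C, hC⟩, hψφ⟩ := exists_psi φ hφ
  have hp0 : Integrable (pD n ν μ ta) (volume.restrict {a : Fin n → ℝ | ∀ j, 0 < a j}) := by
    have := (rhs_moment n hn ν μ hν hμ ta hta hta' 0 (fun _ => rfl)).1
    simpa only [sphOne, one_mul] using this
  have key := moment_det (mJ (2 * n) ν μ) (volume.restrict {a : Fin n → ℝ | ∀ j, 0 < a j}) (fun a => Z * pD n ν μ ta a)
    (measurable_const.mul (pD_meas n ν μ ta)) (hp0.const_mul Z)
    (fun u => eX (Matrix.of u * Dmat ta * (Matrix.of u)ᵀ)) hc1.measurable (fun a => eX (Dmat a)) hc2.measurable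
    (max 0 (max R1 R2)) (le_max_left _ _) ?_ ?_ ?_ ψ hψ C hC
  · have e1 : ∀ u : Fin (2 * n) → Fin (2 * n) → ℝ, ψ (eX (Matrix.of u * Dmat ta * (Matrix.of u)ᵀ)) = φ (Matrix.of u * Dmat ta * (Matrix.of u)ᵀ) :=
      fun u => hψφ _ (anti_conj _ _ (Dmat_tr ta))
    have e2 : ∀ a : Fin n → ℝ, ψ (eX (Dmat a)) = φ (Dmat a) := fun a => hψφ _ (Dmat_tr a)
    simp only [e1, e2] at key
    rw [key, ← integral_const_mul]
    congr 1; funext a; ring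
  · filter_upwards [mJ_ae ν μ] with u hu i
    exact ((norm_le_pi_norm (eX (Matrix.of u * Dmat ta * (Matrix.of u)ᵀ)) i).trans (hR1 u (sJ_bdd hu))).trans
      ((le_max_left _ _).trans (le_max_right _ _))
  · filter_upwards [ae_restrict_mem (pos_meas n)] with a ha
    have ha' : ∀ j, 0 < a j := ha
    by_cases hj : ∃ j, M < a j
    · obtain ⟨j, hj⟩ := hj
      left; rw [pD_zero n ν μ ta a M hM j hj, mul_zero]
    · right; intro i
      push Not at hj
      exact ((norm_le_pi_norm (eX (Dmat a)) i).trans (hR2 a ⟨fun j => (ha' j).le, hj⟩)).trans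
        ((le_max_right _ _).trans (le_max_right _ _))
  · intro Q
    obtain ⟨h, hh, hQ⟩ := poly_H Q
    have e1 : ∀ u : Fin (2 * n) → Fin (2 * n) → ℝ, MvPolynomial.eval (eX (Matrix.of u * Dmat ta * (Matrix.of u)ᵀ)) Q = h (Matrix.of u * Dmat ta * (Matrix.of u)ᵀ) :=
      fun u => hQ _ (anti_conj _ _ (Dmat_tr ta))
    have e2 : ∀ a : Fin n → ℝ, MvPolynomial.eval (eX (Dmat a)) Q = h (Dmat a) := fun a => hQ _ (Dmat_tr a)
    simp only [e1, e2]
    rw [(hsp_moment n hn ν μ hν hμ ta hta hta' hh).2, ← integral_const_mul]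
    congr 1; funext a; ring

lemma main_all (n : ℕ) (hn : 1 ≤ n)
    (ν μ : ℝ) (hν : -(1 / 2 : ℝ) < ν) (hμ : -(1 / 2 : ℝ) < μ)
    (ta : Fin n → ℝ) (hta : ∀ j, 0 < ta j) (hta' : Function.Injective ta) :
    IntegrableOn (jacDens n ν μ) (jacDom n) ∧
    0 < (∫ u in jacDom n, jacDens n ν μ u) ∧
    ∀ φ : Matrix (Fin (2 * n)) (Fin (2 * n)) ℝ → ℝ, IsInvTest (2 * n) φ →
      (1 / (∫ u in jacDom n, jacDens n ν μ u)) *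
          (∫ u in jacDom n, φ (Matrix.of u * Dmat ta * (Matrix.of u)ᵀ) * jacDens n ν μ u) =
        ∫ a in {a : Fin n → ℝ | ∀ j, 0 < a j}, φ (Dmat a) * pD n ν μ ta a := by
  obtain ⟨K, hK0, hfin, hKu, -⟩ := step3 n hn ν μ hν hμ
  have hZ : ∫ u in jacDom n, jacDens n ν μ u = (mJ (2 * n) ν μ).real Set.univ := by
    have := mJ_set (n := n) ν μ (fun _ => 1)
    simpa using this
  have hZ0 : 0 < (mJ (2 * n) ν μ).real Set.univ := by
    rw [hKu]
    exact mul_pos hK0 (Finset.prod_pos fun k _ => Gf_pos n ν μ hν hμ hn _)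
  refine ⟨?_, hZ ▸ hZ0, fun φ hφ => ?_⟩
  · by_contra hni
    rw [integral_undef hni] at hZ
    exact hZ0.ne hZ
  · rw [hZ, mJ_set ν μ (fun u => φ (Matrix.of u * Dmat ta * (Matrix.of u)ᵀ)), main_conv n hn ν μ hν hμ ta hta hta' φ hφ]
    field_simp
end

/-- Corollary 4.2: jPDF of the singular values of `g D(ã) gᵀ` for
`g` from the induced real Jacobi ensemble. -/
theorem jacobi_times_fixed_matrix (n : ℕ) (hn : 1 ≤ n)
    (ν μ : ℝ) (hν : -(1 / 2 : ℝ) < ν) (hμ : -(1 / 2 : ℝ) < μ)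
    (ta : Fin n → ℝ) (hta : ∀ j, 0 < ta j) (hta' : Function.Injective ta) :
    IntegrableOn (jacDens n ν μ) (jacDom n) ∧
    0 < (∫ u in jacDom n, jacDens n ν μ u) ∧
    ∀ φ : Matrix (Fin (2 * n)) (Fin (2 * n)) ℝ → ℝ, IsInvTest (2 * n) φ →
      (1 / (∫ u in jacDom n, jacDens n ν μ u)) *
          (∫ u in jacDom n, φ (Matrix.of u * Dmat ta * (Matrix.of u)ᵀ) * jacDens n ν μ u) =
        ∫ a in {a : Fin n → ℝ | ∀ j, 0 < a j},
          φ (Dmat a) *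
            ((1 / (Nat.factorial n : ℝ)) *
              (∏ j ∈ Finset.range n,
                Real.Gamma (2 * ν + 2 * μ + 2 * n + 2 * ((j : ℝ) + 1)) /
                  (Real.Gamma (2 * ν + 2 * ((j : ℝ) + 1) - 1) *
                    Real.Gamma (2 * μ + 2 * n + 1))) *
              ((vdm fun j => (a j) ^ 2) / (vdm fun j => (ta j) ^ 2)) *
              ((∏ j, (a j) ^ (2 * ν)) / (∏ j, (ta j) ^ (2 * ν + 1))) *
              (Matrix.of fun j k : Fin n =>
                if a j ≤ ta k then (1 - a j / ta k) ^ (2 * (μ + (n : ℝ))) else 0).det) := by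
  exact main_all n hn ν μ hν hμ ta hta hta'

end
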